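/- arXiv:0801.1483 — 3 statements merged into one kernel-verified Lean document; each statement's English description precedes it below -/
import Mathlib

section
/- Let F be a fullerene graph other than the dodecahedron F_20 that contains R_5 (the ring of five pentagons around a central pentagon) as a subgraph. Then F is not 2-resonant: there exist two disjoint hexagonal faces of F that do not form a resonant pattern. -/
open SimpleGraph

/-- The set of vertices incident with some edge of a face boundary. -/
def faceVerts (f : Finset (Sym2 V)) : Set V := {v | ∃ e ∈ f, v ∈ e}

/-- `G` has a perfect matching. -/
def HasPM (G : SimpleGraph V) : Prop := ∃ M : G.Subgraph, M.IsPerfectMatching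

/-- Number of odd connected components of `G`. -/
noncomputable def oddComponents (G : SimpleGraph V) : ℕ :=
  Nat.card {c : G.ConnectedComponent // Odd (Nat.card c.supp)}

/-- `G` is cyclically `k`-edge-connected: no set of fewer than `k` edges
separates `G` into two parts each containing a cycle. -/
def CycEdgeConn (G : SimpleGraph V) (k : ℕ) : Prop :=
  ∀ D : Finset (Sym2 V), D.card < k →
    ¬ ∃ A : Set V, (∀ a ∈ A, ∀ b ∉ A, ¬ (G.deleteEdges (↑D : Set (Sym2 V))).Adj a b) ∧
      ¬ (G.induce A).IsAcyclic ∧ ¬ (G.induce Aᶜ).IsAcyclic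

/-- A combinatorial fullerene: a cubic, 3-connected plane graph presented together with
its face boundaries (as edge sets of boundary cycles), every face a pentagon or a
hexagon, each edge on exactly two faces, Euler's formula, and exactly 12 pentagons. -/
structure IsFullerene [Fintype V] [DecidableEq V] (G : SimpleGraph V)
    (faces : Finset (Finset (Sym2 V))) : Prop where
  cubic : ∀ v : V, (G.neighborSet v).ncard = 3
  card_ge : 4 ≤ Fintype.card V
  threeConnected : ∀ s : Set V, s.ncard ≤ 2 → (G.induce sᶜ).Connected
  face_cycle : ∀ f ∈ faces, ∃ (v : V) (c : G.Walk v v), c.IsCycle ∧ c.edges.toFinset = f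
  face_size : ∀ f ∈ faces, f.card = 5 ∨ f.card = 6
  edge_two_faces : ∀ e ∈ G.edgeSet, (faces.filter (fun f => e ∈ f)).card = 2
  euler : Fintype.card V + faces.card = G.edgeSet.ncard + 2
  pentagons : (faces.filter (fun f => f.card = 5)).card = 12
/-- The face `f` is `M`-alternating: every vertex of `f` is matched by `M`
along an edge of `f`. -/
def AltFace (G : SimpleGraph V) (M : G.Subgraph) (f : Finset (Sym2 V)) : Prop :=
  ∀ v ∈ faceVerts f, ∃ u, s(v, u) ∈ f ∧ M.Adj v u

/-- A set of (disjoint hexagonal) faces is a resonant pattern if some perfect matching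
of `G` is alternating on all of them. -/
def IsResonantPattern (G : SimpleGraph V) (H : Finset (Finset (Sym2 V))) : Prop :=
  ∃ M : G.Subgraph, M.IsPerfectMatching ∧ ∀ f ∈ H, AltFace G M f

/-- `G` (with face set `faces`) is `k`-resonant. -/
def KResonant [Fintype V] [DecidableEq V] (G : SimpleGraph V)
    (faces : Finset (Finset (Sym2 V))) (k : ℕ) : Prop :=
  ∀ H : Finset (Finset (Sym2 V)), H ⊆ faces → (∀ f ∈ H, f.card = 6) →
    (∀ f ∈ H, ∀ g ∈ H, f ≠ g → Disjoint (faceVerts f) (faceVerts g)) →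
    H.card ≤ k → IsResonantPattern G H
/-- The graph `R₅`: a central pentagon (vertices `0..4`) surrounded by a ring of five
pentagons (outer ring `5..14`); the dodecahedron minus the vertices of one face. -/
def R5 : SimpleGraph (Fin 15) :=
  SimpleGraph.fromEdgeSet {s(0, 1), s(0, 4), s(0, 5), s(1, 2), s(1, 7), s(2, 3),
    s(2, 9), s(3, 4), s(3, 11), s(4, 13), s(5, 6), s(5, 14), s(6, 7), s(7, 8),
    s(8, 9), s(9, 10), s(10, 11), s(11, 12), s(12, 13), s(13, 14)}

section FaceStructure

variable {V : Type*} {G : SimpleGraph V} {faces : Finset (Finset (Sym2 V))}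

theorem mem_faceVerts {f : Finset (Sym2 V)} {x : V} :
    x ∈ faceVerts f ↔ ∃ y, s(x, y) ∈ f := by
  constructor
  · rintro ⟨e, he, hx⟩
    obtain ⟨y, rfl⟩ := hx
    exact ⟨y, he⟩
  · rintro ⟨y, hy⟩
    exact ⟨_, hy, Sym2.mem_mk_left x y⟩

theorem SimpleGraph.Walk.support_subset_of_closed {T : Set V} {u v : V} (p : G.Walk u v)
    (hu : u ∈ T) (hT : ∀ x ∈ T, ∀ y, s(x, y) ∈ p.edges → y ∈ T) : ∀ x ∈ p.support, x ∈ T := by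
  induction p with
  | nil => simpa using hu
  | cons h p ih =>
    intro x hx
    rw [Walk.support_cons, List.mem_cons] at hx
    rcases hx with rfl | hx
    · exact hu
    · exact ih (hT _ hu _ (by simp)) (fun a ha b hb => hT a ha b (by simp [hb])) x hx

variable [Fintype V] [DecidableEq V]

namespace IsFullerene

theorem exists_cycle_at (hF : IsFullerene G faces) {f : Finset (Sym2 V)} (hf : f ∈ faces) {x : V}
    (hx : x ∈ faceVerts f) :
    ∃ c : G.Walk x x, c.IsCycle ∧ c.edges.toFinset = f := by
  obtain ⟨v, c, hc, rfl⟩ := hF.face_cycle f hf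
  obtain ⟨y, hy⟩ := mem_faceVerts.1 hx
  have hxs : x ∈ c.support := c.fst_mem_support_of_mem_edges (List.mem_toFinset.1 hy)
  refine ⟨c.rotate x hxs, hc.rotate hxs, ?_⟩
  ext e
  simp [(c.rotate_edges x hxs).perm.mem_iff]

theorem adj_of_mem (hF : IsFullerene G faces) {f : Finset (Sym2 V)} (hf : f ∈ faces) {x y : V}
    (h : s(x, y) ∈ f) : G.Adj x y := by
  obtain ⟨v, c, hc, rfl⟩ := hF.face_cycle f hf
  exact c.adj_of_mem_edges (List.mem_toFinset.1 h)

/-- A face passing through `x` along the edge `xu` leaves along exactly one other edge. -/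
theorem exists_other (hF : IsFullerene G faces) {f : Finset (Sym2 V)} (hf : f ∈ faces) {x u : V}
    (h : s(x, u) ∈ f) : ∃ w, w ≠ u ∧ ∀ z, s(x, z) ∈ f ↔ z = u ∨ z = w := by
  obtain ⟨c, hc, hcf⟩ := hF.exists_cycle_at hf (mem_faceVerts.2 ⟨u, h⟩)
  have hmem : ∀ z, s(x, z) ∈ f ↔ z ∈ c.toSubgraph.neighborSet x := fun z => by
    rw [Subgraph.mem_neighborSet, Walk.adj_toSubgraph_iff_mem_edges, ← hcf, List.mem_toFinset]
  obtain ⟨a, b, hab, hs⟩ := Set.ncard_eq_two.1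
    (hc.ncard_neighborSet_toSubgraph_eq_two c.start_mem_support)
  simp only [hmem, hs, Set.mem_insert_iff, Set.mem_singleton_iff] at h ⊢
  rcases h with rfl | rfl
  · exact ⟨b, hab.symm, fun z => Iff.rfl⟩
  · exact ⟨a, hab, fun z => or_comm⟩

/-- A face using the edges `xu` and `xw` uses no other edge at `x`. -/
theorem eq_or_eq_of_mem (hF : IsFullerene G faces) {f : Finset (Sym2 V)} (hf : f ∈ faces)
    {x u w z : V} (huw : u ≠ w) (hu : s(x, u) ∈ f) (hw : s(x, w) ∈ f) (hz : s(x, z) ∈ f) :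
    z = u ∨ z = w := by
  obtain ⟨a, ha, h⟩ := hF.exists_other hf hu
  rcases (h w).1 hw with rfl | rfl
  · exact absurd rfl huw
  · exact (h z).1 hz

theorem faceVerts_subset_of_closed (hF : IsFullerene G faces) {f : Finset (Sym2 V)}
    (hf : f ∈ faces) {T : Set V} {x : V} (hx : x ∈ faceVerts f) (hxT : x ∈ T)
    (hT : ∀ a ∈ T, ∀ b, s(a, b) ∈ f → b ∈ T) : faceVerts f ⊆ T := by
  obtain ⟨c, hc, rfl⟩ := hF.exists_cycle_at hf hx
  intro y hy
  obtain ⟨z, hz⟩ := mem_faceVerts.1 hy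
  exact c.support_subset_of_closed hxT (fun a ha b hb => hT a ha b (List.mem_toFinset.2 hb)) y
    (c.fst_mem_support_of_mem_edges (List.mem_toFinset.1 hz))

theorem ncard_faceVerts (hF : IsFullerene G faces) {f : Finset (Sym2 V)} (hf : f ∈ faces) :
    (faceVerts f).ncard = f.card := by
  obtain ⟨v, c, hc, rfl⟩ := hF.face_cycle f hf
  have hs : faceVerts c.edges.toFinset = c.support.tail.toFinset := by
    ext x
    have hnil : ¬ c.Nil := hc.isCircuit.not_nil
    have hx : x ∈ c.support ↔ x ∈ c.support.tail := by
      rw [Walk.mem_support_iff]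
      constructor
      · rintro (rfl | h)
        · exact Walk.end_mem_tail_support hnil
        · exact h
      · exact Or.inr
    rw [Finset.mem_coe, List.mem_toFinset, ← hx,
      Walk.mem_support_iff_exists_mem_edges_of_not_nil hnil]
    simp [faceVerts]
  rw [hs, Set.ncard_coe_finset, List.toFinset_card_of_nodup hc.support_nodup,
    List.toFinset_card_of_nodup hc.isCircuit.isTrail.edges_nodup]
  simp

theorem exists_nbrs (hF : IsFullerene G faces) (x : V) :
    ∃ a b c, a ≠ b ∧ a ≠ c ∧ b ≠ c ∧ ∀ z, G.Adj x z ↔ z = a ∨ z = b ∨ z = c := by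
  obtain ⟨a, b, c, hab, hac, hbc, h⟩ := Set.ncard_eq_three.1 (hF.cubic x)
  refine ⟨a, b, c, hab, hac, hbc, fun z => ?_⟩
  rw [← mem_neighborSet, h]
  simp

theorem exists_third (hF : IsFullerene G faces) {x u w : V} (huw : u ≠ w) (hu : G.Adj x u)
    (hw : G.Adj x w) : ∃ t, t ≠ u ∧ t ≠ w ∧ ∀ z, G.Adj x z ↔ z = u ∨ z = w ∨ z = t := by
  obtain ⟨a, b, c, hab, hac, hbc, h⟩ := hF.exists_nbrs x
  rw [h] at hu hw
  simp only [h]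
  have : ∃ t, t ≠ u ∧ t ≠ w ∧ (t = a ∨ t = b ∨ t = c) := by
    by_cases ha : a = u ∨ a = w
    · by_cases hb : b = u ∨ b = w
      · exact ⟨c, by grind⟩
      · exact ⟨b, by grind⟩
    · exact ⟨a, by grind⟩
  obtain ⟨t, htu, htw, ht⟩ := this
  exact ⟨t, htu, htw, by grind⟩

theorem eq_of_adj (hF : IsFullerene G faces) {x u w t z : V} (huw : u ≠ w) (hut : u ≠ t)
    (hwt : w ≠ t) (hu : G.Adj x u) (hw : G.Adj x w) (ht : G.Adj x t) (hz : G.Adj x z) :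
    z = u ∨ z = w ∨ z = t := by
  obtain ⟨a, b, c, hab, hac, hbc, h⟩ := hF.exists_nbrs x
  rw [h] at hu hw ht hz
  grind

theorem card_filter_pair (hF : IsFullerene G faces) {x u w : V} (huw : u ≠ w) (hu : G.Adj x u)
    (hw : G.Adj x w) : (faces.filter fun f => s(x, u) ∈ f ∧ s(x, w) ∈ f).card = 1 := by
  obtain ⟨t, htu, htw, h⟩ := hF.exists_third huw hu hw
  have ht : G.Adj x t := (h t).2 (by simp)
  have key : ∀ {a b c : V}, a ≠ b → a ≠ c → b ≠ c → G.Adj x a →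
      (∀ z, G.Adj x z → z = a ∨ z = b ∨ z = c) →
      (faces.filter fun f => s(x, a) ∈ f ∧ s(x, b) ∈ f).card +
        (faces.filter fun f => s(x, a) ∈ f ∧ s(x, c) ∈ f).card = 2 := by
    intro a b c hab hac hbc ha habc
    rw [← hF.edge_two_faces s(x, a) ha, ← Finset.card_union_of_disjoint]
    · congr 1
      ext f
      simp only [Finset.mem_union, Finset.mem_filter]
      constructor
      · tauto
      · rintro ⟨hf, hfa⟩
        obtain ⟨d, hda, hd⟩ := hF.exists_other hf hfa
        have hfd := (hd d).2 (Or.inr rfl)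
        rcases habc d (hF.adj_of_mem hf hfd) with rfl | rfl | rfl
        · exact absurd rfl hda
        · exact Or.inl ⟨hf, hfa, hfd⟩
        · exact Or.inr ⟨hf, hfa, hfd⟩
    · rw [Finset.disjoint_left]
      intro f hf hf'
      simp only [Finset.mem_filter] at hf hf'
      rcases hF.eq_or_eq_of_mem hf.1 hab hf.2.1 hf.2.2 hf'.2.2 with h | h
      · exact hac h.symm
      · exact hbc h.symm
  have k1 := key huw htu.symm htw.symm hu (fun z => (h z).1)
  have k2 := key huw.symm htw.symm htu.symm hw (fun z hz => by have := (h z).1 hz; tauto)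
  have k3 := key htu htw huw ht (fun z hz => by have := (h z).1 hz; tauto)
  have swap : ∀ a b : V, (faces.filter fun f => s(x, a) ∈ f ∧ s(x, b) ∈ f).card =
      (faces.filter fun f => s(x, b) ∈ f ∧ s(x, a) ∈ f).card := fun a b => by
    simp only [and_comm]
  have s1 := swap u w
  have s2 := swap u t
  have s3 := swap w t
  omega

/-- Two distinct edges at a vertex lie in a common face. -/
theorem exists_face (hF : IsFullerene G faces) {x u w : V} (huw : u ≠ w) (hu : G.Adj x u)
    (hw : G.Adj x w) : ∃ f ∈ faces, s(x, u) ∈ f ∧ s(x, w) ∈ f := by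
  obtain ⟨f, hf⟩ := Finset.card_eq_one.1 (hF.card_filter_pair huw hu hw)
  have : f ∈ faces.filter fun f => s(x, u) ∈ f ∧ s(x, w) ∈ f := by simp [hf]
  exact ⟨f, (Finset.mem_filter.1 this).1, (Finset.mem_filter.1 this).2⟩

/-- Two distinct edges at a vertex lie in only one common face. -/
theorem face_unique (hF : IsFullerene G faces) {x u w : V} (huw : u ≠ w)
    {f g : Finset (Sym2 V)} (hf : f ∈ faces) (hg : g ∈ faces) (hfu : s(x, u) ∈ f)
    (hfw : s(x, w) ∈ f) (hgu : s(x, u) ∈ g) (hgw : s(x, w) ∈ g) : f = g :=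
  Finset.card_le_one.1
    (hF.card_filter_pair huw (hF.adj_of_mem hf hfu) (hF.adj_of_mem hf hfw)).le f
    (by simp [*]) g (by simp [*])

/-- A vertex set with at most two boundary vertices has nothing beyond them. -/
theorem mem_of_closed (hF : IsFullerene G faces) {T s : Set V} (hs : s.ncard ≤ 2) {x : V}
    (hxT : x ∈ T) (hxs : x ∉ s) (hT : ∀ a ∈ T, a ∉ s → ∀ b, G.Adj a b → b ∉ s → b ∈ T) (y : V)
    (hy : y ∉ s) : y ∈ T := by
  obtain ⟨p⟩ := (hF.threeConnected s hs).preconnected ⟨x, hxs⟩ ⟨y, hy⟩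
  have key : ∀ {a b : (sᶜ : Set V)} (p : (G.induce sᶜ).Walk a b), (a : V) ∈ T → (b : V) ∈ T := by
    intro a b p
    induction p with
    | nil => exact id
    | @cons a b c h p ih => exact fun ha => ih (hT a ha a.2 b h b.2)
  exact key p hxT

end IsFullerene

end FaceStructure

section Homology

variable {V : Type*} [Fintype V] [DecidableEq V] {G : SimpleGraph V}
  {faces : Finset (Finset (Sym2 V))}

namespace IsFullerene

theorem exists_mem_faceVerts (hF : IsFullerene G faces) {f : Finset (Sym2 V)} (hf : f ∈ faces) :
    ∃ x, x ∈ faceVerts f := by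
  have hpos : 0 < f.card := by rcases hF.face_size f hf with h | h <;> omega
  obtain ⟨e, he⟩ := Finset.card_pos.1 hpos
  induction e with
  | _ x y => exact ⟨x, mem_faceVerts.2 ⟨y, he⟩⟩

/-- Two faces through a common vertex share an edge there. -/
theorem exists_common_edge (hF : IsFullerene G faces) {f g : Finset (Sym2 V)} (hf : f ∈ faces)
    (hg : g ∈ faces) {x : V} (hxf : x ∈ faceVerts f) (hxg : x ∈ faceVerts g) :
    ∃ u, s(x, u) ∈ f ∧ s(x, u) ∈ g := by
  obtain ⟨u, hu⟩ := mem_faceVerts.1 hxf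
  obtain ⟨w, hw⟩ := mem_faceVerts.1 hxg
  obtain ⟨u', hne, hfu⟩ := hF.exists_other hf hu
  obtain ⟨w', hne', hgw⟩ := hF.exists_other hg hw
  have hu' := (hfu u').2 (Or.inr rfl)
  have hw' := (hgw w').2 (Or.inr rfl)
  by_contra! hcon
  have h1 := hcon u hu
  have h2 := hcon u' hu'
  rw [hgw] at h1 h2
  push Not at h1 h2
  have := hF.eq_of_adj hne.symm h1.1.symm.symm h2.1 (hF.adj_of_mem hf hu) (hF.adj_of_mem hf hu')
    (hF.adj_of_mem hg hw) (hF.adj_of_mem hg hw')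
  grind

/-- A function on vertices that is constant along edges is constant. -/
theorem forall_of_adj_closed (hF : IsFullerene G faces) {P : V → Prop} {x : V} (hx : P x)
    (hP : ∀ a b, P a → G.Adj a b → P b) (y : V) : P y :=
  hF.mem_of_closed (T := {v | P v}) (s := ∅) (by simp) hx (by simp)
    (fun a ha _ b hab _ => hP a b ha hab) y (by simp)

theorem exists_two_faces (hF : IsFullerene G faces) {e : Sym2 V} (he : e ∈ G.edgeSet) :
    ∃ f ∈ faces, ∃ g ∈ faces, f ≠ g ∧ e ∈ f ∧ e ∈ g ∧ ∀ h ∈ faces, e ∈ h → h = f ∨ h = g := by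
  obtain ⟨f, g, hfg, hs⟩ := Finset.card_eq_two.1 (hF.edge_two_faces e he)
  have hm : ∀ h, h ∈ faces ∧ e ∈ h ↔ h = f ∨ h = g := fun h => by
    rw [← Finset.mem_filter (p := fun f => e ∈ f), hs]
    simp
  have h1 := (hm f).2 (Or.inl rfl)
  have h2 := (hm g).2 (Or.inr rfl)
  exact ⟨f, h1.1, g, h2.1, hfg, h1.2, h2.2, fun h hh he => (hm h).1 ⟨hh, he⟩⟩

/-- The only face colourings agreeing across every edge are constant. -/
theorem face_coloring_const (hF : IsFullerene G faces) {α : Type*} (S : Finset (Sym2 V) → α)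
    (hS : ∀ e ∈ G.edgeSet, ∀ f ∈ faces, ∀ g ∈ faces, e ∈ f → e ∈ g → S f = S g)
    {f g : Finset (Sym2 V)} (hf : f ∈ faces) (hg : g ∈ faces) : S f = S g := by
  have hS' : ∀ x, ∀ f ∈ faces, ∀ g ∈ faces, x ∈ faceVerts f → x ∈ faceVerts g → S f = S g := by
    intro x f hf g hg hxf hxg
    obtain ⟨u, hu, hu'⟩ := hF.exists_common_edge hf hg hxf hxg
    exact hS _ (hF.adj_of_mem hf hu) f hf g hg hu hu'
  obtain ⟨x, hx⟩ := hF.exists_mem_faceVerts hf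
  obtain ⟨y, hy⟩ := hF.exists_mem_faceVerts hg
  refine (hF.forall_of_adj_closed (P := fun v => ∀ h ∈ faces, v ∈ faceVerts h → S f = S h)
    (fun h hh hxh => hS' x f hf h hh hx hxh) ?_ y) g hg hy
  intro a b ha hab h hh hbh
  obtain ⟨k, hk, -, -, -, hek, -⟩ := hF.exists_two_faces (e := s(a, b)) hab
  rw [ha k hk (mem_faceVerts.2 ⟨b, hek⟩)]
  exact hS' b k hk h hh (mem_faceVerts.2 ⟨a, Sym2.eq_swap ▸ hek⟩) hbh

theorem sum_incident (hF : IsFullerene G faces) [Fintype G.edgeSet] {R : Type*}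
    [AddCommMonoid R] {x a b d : V} (hab : a ≠ b) (had : a ≠ d) (hbd : b ≠ d) (ha : G.Adj x a)
    (hb : G.Adj x b) (hd : G.Adj x d) (w : Sym2 V → R) :
    (∑ e : G.edgeSet, if x ∈ e.1 then w e.1 else 0) = w s(x, a) + (w s(x, b) + w s(x, d)) := by
  have h1 : (∑ e : G.edgeSet, if x ∈ e.1 then w e.1 else 0) =
      ∑ e ∈ G.edgeFinset, if x ∈ e then w e else 0 :=
    (Finset.sum_subtype G.edgeFinset (fun e => by simp)
      (fun e => if x ∈ e then w e else 0)).symm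
  have h2 : G.edgeFinset.filter (fun e => x ∈ e) = {s(x, a), s(x, b), s(x, d)} := by
    ext e
    simp only [Finset.mem_filter, mem_edgeFinset, Finset.mem_insert, Finset.mem_singleton]
    constructor
    · rintro ⟨he, z, rfl⟩
      rcases hF.eq_of_adj hab had hbd ha hb hd he with rfl | rfl | rfl <;> simp
    · rintro (rfl | rfl | rfl) <;> simpa
  have hne : ∀ {y z : V}, y ≠ z → s(x, y) ≠ s(x, z) := fun h h' => h (Sym2.congr_right.1 h')
  rw [h1, ← Finset.sum_filter, h2, Finset.sum_insert, Finset.sum_pair (hne hbd)]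
  simp [hne hab, hne had]

theorem card_add_card_faces (hF : IsFullerene G faces) [Fintype G.edgeSet] :
    Fintype.card V + faces.card = Fintype.card G.edgeSet + 2 := by
  rw [hF.euler, Set.ncard_eq_toFinset_card', Set.toFinset_card]

open Module in
theorem finrank_le_one_of_const {ι : Type*} [Fintype ι] (K : Submodule (ZMod 2) (ι → ZMod 2))
    (hK : ∀ z ∈ K, ∀ i j, z i = z j) : finrank (ZMod 2) K ≤ 1 := by
  have hle : K ≤ Submodule.span (ZMod 2) {(fun _ => 1 : ι → ZMod 2)} := by
    intro z hz
    rw [Submodule.mem_span_singleton]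
    by_cases h : Nonempty ι
    · obtain ⟨i⟩ := h
      exact ⟨z i, funext fun j => by simp [hK z hz i j]⟩
    · exact ⟨0, funext fun j => (h ⟨j⟩).elim⟩
  exact (Submodule.finrank_mono hle).trans ((finrank_span_le_card _).trans (by simp))

open Module Matrix in
/-- Every mod 2 cycle is the boundary of a set of faces. -/
theorem exists_boundary (hF : IsFullerene G faces) (c : Sym2 V → ZMod 2)
    (hc : ∀ x a b d, a ≠ b → a ≠ d → b ≠ d → G.Adj x a → G.Adj x b → G.Adj x d →
      c s(x, a) + (c s(x, b) + c s(x, d)) = 0) :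
    ∃ S : Finset (Sym2 V) → ZMod 2, ∀ e ∈ G.edgeSet, ∀ f ∈ faces, ∀ g ∈ faces, f ≠ g →
      e ∈ f → e ∈ g → c e = S f + S g := by
  classical
  let M : Matrix G.edgeSet faces (ZMod 2) := fun e f => if e.1 ∈ f.1 then 1 else 0
  let N : Matrix V G.edgeSet (ZMod 2) := fun x e => if x ∈ e.1 then 1 else 0
  have hM : ∀ (z : faces → ZMod 2) (e : G.edgeSet) (f g : faces), f ≠ g → e.1 ∈ f.1 →
      e.1 ∈ g.1 → (M *ᵥ z) e = z f + z g := by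
    intro z e f g hfg hef heg
    have hfil : (Finset.univ.filter fun h : faces => e.1 ∈ h.1) = {f, g} := by
      obtain ⟨f', hf', g', hg', -, -, -, hall⟩ := hF.exists_two_faces e.2
      ext h
      simp only [Finset.mem_filter, Finset.mem_univ, true_and, Finset.mem_insert,
        Finset.mem_singleton]
      constructor
      · intro heh
        have h1 := hall f f.2 hef
        have h2 := hall g g.2 heg
        have h3 := hall h h.2 heh
        have h4 : f.1 ≠ g.1 := fun h => hfg (Subtype.ext h)
        simp only [Subtype.ext_iff]
        grind
      · rintro (rfl | rfl) <;> assumption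
    simp only [Matrix.mulVec, dotProduct, M, ite_mul, one_mul, zero_mul]
    rw [← Finset.sum_filter, hfil, Finset.sum_pair hfg]
  have hN : ∀ (w : Sym2 V → ZMod 2) (x a b d : V), a ≠ b → a ≠ d → b ≠ d → G.Adj x a →
      G.Adj x b → G.Adj x d →
      (N *ᵥ fun e => w e.1) x = w s(x, a) + (w s(x, b) + w s(x, d)) := by
    intro w x a b d hab had hbd ha hb hd
    rw [← hF.sum_incident hab had hbd ha hb hd w]
    simp [Matrix.mulVec, dotProduct, N]
  have hNT : ∀ (z : V → ZMod 2) (x y : V) (h : G.Adj x y), (Nᵀ *ᵥ z) ⟨s(x, y), h⟩ = z x + z y := by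
    intro z x y h
    have hfil : (Finset.univ.filter fun v : V => v ∈ s(x, y)) = {x, y} := by
      ext v; simp
    simp only [Matrix.mulVec, dotProduct, Matrix.transpose_apply]
    simp only [N, ite_mul, one_mul, zero_mul]
    rw [← Finset.sum_filter, hfil, Finset.sum_pair h.ne]
  have add_eq : ∀ u v : ZMod 2, u + v = 0 → u = v := by decide
  have hkerM : finrank (ZMod 2) (LinearMap.ker M.mulVecLin) ≤ 1 := by
    apply finrank_le_one_of_const
    intro z hz f g
    have hz' : M *ᵥ z = 0 := LinearMap.mem_ker.1 hz
    have := hF.face_coloring_const (fun h => if hh : h ∈ faces then z ⟨h, hh⟩ else 0) ?_ f.2 g.2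
    · simpa using this
    · intro e he f hf g hg hef heg
      simp only [hf, hg, dif_pos]
      by_cases hfg : f = g
      · subst hfg; rfl
      · apply add_eq
        rw [← hM z ⟨e, he⟩ ⟨f, hf⟩ ⟨g, hg⟩ (by simpa using hfg) hef heg, hz']
        rfl
  have hkerN : finrank (ZMod 2) (LinearMap.ker Nᵀ.mulVecLin) ≤ 1 := by
    apply finrank_le_one_of_const
    intro z hz x y
    have hz' : Nᵀ *ᵥ z = 0 := LinearMap.mem_ker.1 hz
    refine hF.forall_of_adj_closed (P := fun v => z x = z v) rfl ?_ y
    intro a b ha hab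
    rw [ha]
    apply add_eq
    rw [← hNT z a b hab, hz']
    rfl
  have hle : LinearMap.range M.mulVecLin ≤ LinearMap.ker N.mulVecLin := by
    rw [LinearMap.range_le_ker_iff, ← Matrix.mulVecLin_mul]
    suffices h : N * M = 0 by rw [h]; simp
    ext x f
    obtain ⟨a, b, d, hab, had, hbd, hnb⟩ := hF.exists_nbrs x
    have hsum := hN (fun e => if e ∈ f.1 then 1 else 0) x a b d hab had hbd
      ((hnb a).2 (by simp)) ((hnb b).2 (by simp)) ((hnb d).2 (by simp))
    have hmul : (N * M) x f = (N *ᵥ fun e => if e.1 ∈ f.1 then 1 else 0) x := rfl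
    rw [hmul, hsum, Matrix.zero_apply]
    by_cases hx : x ∈ faceVerts f.1
    · obtain ⟨u, hu⟩ := mem_faceVerts.1 hx
      obtain ⟨w, hwu, hw⟩ := hF.exists_other f.2 hu
      have h1 := (hnb u).1 (hF.adj_of_mem f.2 hu)
      have h2 := (hnb w).1 (hF.adj_of_mem f.2 ((hw w).2 (Or.inr rfl)))
      have htwo : (1 : ZMod 2) + 1 = 0 := by decide
      simp only [hw]
      rcases h1 with rfl | rfl | rfl <;> rcases h2 with rfl | rfl | rfl <;>
        first
        | exact absurd rfl hwu
        | simp [*, Ne.symm hab, Ne.symm had, Ne.symm hbd]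
    · simp only [mem_faceVerts, not_exists] at hx
      simp [hx]
  have hdim : finrank (ZMod 2) (LinearMap.ker N.mulVecLin) ≤
      finrank (ZMod 2) (LinearMap.range M.mulVecLin) := by
    have e1 := M.mulVecLin.finrank_range_add_finrank_ker
    have e2 := N.mulVecLin.finrank_range_add_finrank_ker
    have e3 := Nᵀ.mulVecLin.finrank_range_add_finrank_ker
    have e4 : finrank (ZMod 2) (LinearMap.range Nᵀ.mulVecLin) =
        finrank (ZMod 2) (LinearMap.range N.mulVecLin) := Matrix.rank_transpose N
    have e5 := hF.card_add_card_faces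
    rw [Module.finrank_fintype_fun_eq_card] at e1 e2 e3
    rw [Fintype.card_coe] at e1
    omega
  have heq := Submodule.eq_of_le_of_finrank_le hle hdim
  have hcN : (fun e : G.edgeSet => c e.1) ∈ LinearMap.ker N.mulVecLin := by
    rw [LinearMap.mem_ker, Matrix.mulVecLin_apply]
    ext x
    obtain ⟨a, b, d, hab, had, hbd, hnb⟩ := hF.exists_nbrs x
    have ha := (hnb a).2 (by simp)
    have hb := (hnb b).2 (by simp)
    have hd := (hnb d).2 (by simp)
    rw [hN c x a b d hab had hbd ha hb hd, hc x a b d hab had hbd ha hb hd]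
    rfl
  rw [← heq] at hcN
  obtain ⟨z, hz⟩ := hcN
  refine ⟨fun h => if hh : h ∈ faces then z ⟨h, hh⟩ else 0, ?_⟩
  intro e he f hf g hg hfg hef heg
  simp only [hf, hg, dif_pos]
  rw [← hM z ⟨e, he⟩ ⟨f, hf⟩ ⟨g, hg⟩ (by simpa using hfg) hef heg]
  exact (congrFun hz ⟨e, he⟩).symm

end IsFullerene

end Homology

/-- The vertex set of a chordless cycle: each vertex has exactly two neighbours in the set, and
the set is connected. -/
structure IsChordlessCycle {V : Type*} (G : SimpleGraph V) (C : Set V) : Prop where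
  nonempty : C.Nonempty
  two_nbrs : ∀ x ∈ C, ∃ u ∈ C, ∃ w ∈ C, u ≠ w ∧ G.Adj x u ∧ G.Adj x w ∧
    ∀ z ∈ C, G.Adj x z → z = u ∨ z = w
  subset_of_closed : ∀ T : Set V, ∀ x ∈ C, x ∈ T →
    (∀ a ∈ C, a ∈ T → ∀ b ∈ C, G.Adj a b → b ∈ T) → C ⊆ T

theorem IsChordlessCycle.of_fin {V : Type*} {G : SimpleGraph V} {n : ℕ} [NeZero n] (hn : 3 ≤ n)
    (p : Fin n → V) (hp : Function.Injective p) (hadj : ∀ i, G.Adj (p i) (p (i + 1)))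
    (hchord : ∀ i j, G.Adj (p i) (p j) → j = i + 1 ∨ i = j + 1) :
    IsChordlessCycle G (Set.range p) := by
  refine ⟨⟨p 0, 0, rfl⟩, ?_, ?_⟩
  · rintro _ ⟨i, rfl⟩
    refine ⟨p (i + 1), ⟨_, rfl⟩, p (i - 1), ⟨_, rfl⟩, ?_, hadj i, ?_, ?_⟩
    · intro h
      have h1 : i + 1 = i - 1 := hp h
      have h2 : (1 : Fin n) + 1 = 0 := by
        have h3 : i + (1 + 1) = i + 0 := by rw [← add_assoc, h1]; simp
        exact add_left_cancel h3
      have h4 := congrArg Fin.val h2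
      have h5 : (1 : Fin n).val = 1 := by
        rw [Fin.val_one']; exact Nat.mod_eq_of_lt (by omega)
      rw [Fin.val_add, h5, Nat.mod_eq_of_lt (by omega)] at h4
      simp at h4
    · have := hadj (i - 1)
      rw [sub_add_cancel] at this
      exact this.symm
    · rintro _ ⟨j, rfl⟩ h
      rcases hchord i j h with h | h
      · exact Or.inl (congrArg p h)
      · exact Or.inr (congrArg p (by rw [h]; simp))
  · rintro T _ ⟨i, rfl⟩ hiT hT _ ⟨j, rfl⟩
    have key : ∀ k : ℕ, p (i + Fin.ofNat n k) ∈ T := by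
      intro k
      induction k with
      | zero => simpa [Fin.ofNat] using hiT
      | succ k ih =>
        have h := hT _ ⟨_, rfl⟩ ih _ ⟨_, rfl⟩ (hadj _)
        have e : i + Fin.ofNat n k + 1 = i + Fin.ofNat n (k + 1) := by
          rw [add_assoc]
          congr 1
          ext
          simp [Fin.val_add]
        rwa [e] at h
    have := key (j - i).val
    rwa [Fin.ofNat_val_eq_self, add_sub_cancel] at this

theorem IsChordlessCycle.of_hexagon {V : Type*} {G : SimpleGraph V} {a b c d e f : V}
    (hnd : [a, b, c, d, e, f].Nodup)
    (hab : G.Adj a b) (hbc : G.Adj b c) (hcd : G.Adj c d) (hde : G.Adj d e) (hef : G.Adj e f)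
    (hfa : G.Adj f a) (hac : ¬ G.Adj a c) (had : ¬ G.Adj a d) (hae : ¬ G.Adj a e)
    (hbd : ¬ G.Adj b d) (hbe : ¬ G.Adj b e) (hbf : ¬ G.Adj b f) (hce : ¬ G.Adj c e)
    (hcf : ¬ G.Adj c f) (hdf : ¬ G.Adj d f) :
    IsChordlessCycle G (Set.range ![a, b, c, d, e, f]) := by
  refine .of_fin (by norm_num) _ ?_ ?_ ?_
  · intro i j h
    simp only [List.nodup_cons, List.mem_cons, List.not_mem_nil, or_false, not_or] at hnd
    fin_cases i <;> fin_cases j <;> simp at h ⊢ <;> grind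
  · intro i
    fin_cases i <;> simpa
  · intro i j h
    fin_cases i <;> fin_cases j <;>
      simp [G.adj_comm c a, G.adj_comm d a, G.adj_comm e a, G.adj_comm d b, G.adj_comm e b,
        G.adj_comm f b, G.adj_comm e c, G.adj_comm f c, G.adj_comm f d, *] at h ⊢

section Separation

variable {V : Type*} [Fintype V] [DecidableEq V] {G : SimpleGraph V}
  {faces : Finset (Finset (Sym2 V))}

namespace IsFullerene

/-- If every face meeting the complement of a chordless cycle `C` has the same colour, then `C`
bounds a face. -/
theorem exists_face_of_monochromatic (hF : IsFullerene G faces) {C : Set V}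
    (hC : IsChordlessCycle G C) {S : Finset (Sym2 V) → ZMod 2}
    (hS : ∀ x ∈ C, ∀ y ∈ C, G.Adj x y → ∀ f ∈ faces, ∀ g ∈ faces, f ≠ g →
      s(x, y) ∈ f → s(x, y) ∈ g → 1 = S f + S g) (k : ZMod 2)
    (hk : ∀ x ∉ C, ∀ f ∈ faces, x ∈ faceVerts f → S f = k) :
    ∃ f ∈ faces, faceVerts f = C ∧ ∀ x ∈ C, ∀ y ∈ C, G.Adj x y → s(x, y) ∈ f := by
  have hlocal : ∀ x ∈ C, ∃ f ∈ faces, S f = k + 1 ∧ ∀ z ∈ C, G.Adj x z → s(x, z) ∈ f := by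
    intro x hx
    obtain ⟨u, hu, w, hw, huw, hxu, hxw, hall⟩ := hC.two_nbrs x hx
    obtain ⟨t, htu, htw, hnb⟩ := hF.exists_third huw hxu hxw
    have hxt : G.Adj x t := (hnb t).2 (by simp)
    have ht : t ∉ C := fun h => by rcases hall t h hxt with h | h <;> contradiction
    obtain ⟨f, hf, hfu, hfw⟩ := hF.exists_face huw hxu hxw
    obtain ⟨g, hg, hgu, hgt⟩ := hF.exists_face htu.symm hxu hxt
    have hfg : f ≠ g := by
      rintro rfl
      rcases hF.eq_or_eq_of_mem hf huw hfu hfw hgt with h | h <;> contradiction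
    have hgk : S g = k := hk t ht g hg (mem_faceVerts.2 ⟨x, Sym2.eq_swap ▸ hgt⟩)
    have h1 := hS x hx u hu hxu f hf g hg hfg hfu hgu
    refine ⟨f, hf, ?_, fun z hz hxz => ?_⟩
    · have : ∀ k m : ZMod 2, 1 = m + k → m = k + 1 := by decide
      exact this k (S f) (hgk ▸ h1)
    · rcases hall z hz hxz with rfl | rfl <;> assumption
  obtain ⟨x₀, hx₀⟩ := hC.nonempty
  obtain ⟨f, hf, hfk, hfx₀⟩ := hlocal x₀ hx₀
  have hsub : C ⊆ {x | ∀ z ∈ C, G.Adj x z → s(x, z) ∈ f} := by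
    refine hC.subset_of_closed _ x₀ hx₀ hfx₀ ?_
    intro a ha haf b hb hab
    obtain ⟨g, hg, hgk, hgb⟩ := hlocal b hb
    have h1 := haf b hb hab
    have h2 := hgb a ha hab.symm
    rw [Sym2.eq_swap] at h2
    by_cases hfg : f = g
    · subst hfg
      exact hgb
    · have := hS a ha b hb hab f hf g hg hfg h1 h2
      rw [hfk, hgk, CharTwo.add_self_eq_zero] at this
      exact absurd this one_ne_zero
  refine ⟨f, hf, Set.Subset.antisymm ?_ ?_, hsub⟩
  · obtain ⟨u, hu, w, hw, huw, hxu, hxw, hall⟩ := hC.two_nbrs x₀ hx₀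
    refine hF.faceVerts_subset_of_closed hf (mem_faceVerts.2 ⟨u, hfx₀ u hu hxu⟩) hx₀ ?_
    intro a ha b hab
    obtain ⟨u, hu, w, hw, huw, hxu, hxw, hall⟩ := hC.two_nbrs a ha
    rcases hF.eq_or_eq_of_mem hf huw (hsub ha u hu hxu) (hsub ha w hw hxw) hab with rfl | rfl <;>
      assumption
  · intro a ha
    obtain ⟨u, hu, w, hw, huw, hxu, hxw, hall⟩ := hC.two_nbrs a ha
    exact mem_faceVerts.2 ⟨u, hsub ha u hu hxu⟩

/-- A chordless cycle either bounds a face or separates the graph. -/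
theorem face_or_separates (hF : IsFullerene G faces) {C : Set V} (hC : IsChordlessCycle G C) :
    (∃ f ∈ faces, faceVerts f = C ∧ ∀ x ∈ C, ∀ y ∈ C, G.Adj x y → s(x, y) ∈ f) ∨
    ∃ X : Set V, (∃ x ∈ X, x ∉ C) ∧ (∃ y ∉ X, y ∉ C) ∧
      ∀ a ∉ C, ∀ b ∉ C, G.Adj a b → a ∈ X → b ∈ X := by
  classical
  obtain ⟨S, hS⟩ := hF.exists_boundary (fun e => if ∀ x ∈ e, x ∈ C then 1 else 0) (by
    intro x a b d hab had hbd ha hb hd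
    simp only [Sym2.mem_iff, forall_eq_or_imp, forall_eq]
    by_cases hx : x ∈ C
    · obtain ⟨u, hu, w, hw, huw, hxu, hxw, hall⟩ := hC.two_nbrs x hx
      have hu' := hF.eq_of_adj hab had hbd ha hb hd hxu
      have hw' := hF.eq_of_adj hab had hbd ha hb hd hxw
      have hmem : ∀ z, G.Adj x z → (z ∈ C ↔ z = u ∨ z = w) := fun z hz =>
        ⟨fun h => hall z h hz, by rintro (rfl | rfl) <;> assumption⟩
      have htwo : (1 : ZMod 2) + 1 = 0 := by decide
      simp only [hx, true_and, hmem a ha, hmem b hb, hmem d hd]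
      rcases hu' with rfl | rfl | rfl <;> rcases hw' with rfl | rfl | rfl <;>
        first
        | exact absurd rfl huw
        | simp [*, Ne.symm hab, Ne.symm had, Ne.symm hbd]
    · simp [hx])
  have hout : ∀ x ∉ C, ∀ f ∈ faces, ∀ g ∈ faces, x ∈ faceVerts f → x ∈ faceVerts g →
      S f = S g := by
    intro x hx f hf g hg hxf hxg
    obtain ⟨u, hu, hu'⟩ := hF.exists_common_edge hf hg hxf hxg
    by_cases hfg : f = g
    · rw [hfg]
    · have := hS _ (hF.adj_of_mem hf hu) f hf g hg hfg hu hu'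
      simp only [Sym2.mem_iff, forall_eq_or_imp, hx, false_and, if_false] at this
      generalize S f = m at this ⊢
      generalize S g = l at this ⊢
      revert m l
      decide
  have hin : ∀ x ∈ C, ∀ y ∈ C, G.Adj x y → ∀ f ∈ faces, ∀ g ∈ faces, f ≠ g →
      s(x, y) ∈ f → s(x, y) ∈ g → 1 = S f + S g := by
    intro x hx y hy hxy f hf g hg hfg hxf hxg
    have := hS _ hxy f hf g hg hfg hxf hxg
    simpa [hx, hy] using this
  have hcol : ∀ x ∉ C, (∀ f ∈ faces, x ∈ faceVerts f → S f = 0) ∨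
      (∀ f ∈ faces, x ∈ faceVerts f → S f = 1) := by
    intro x hx
    by_cases h : ∀ f ∈ faces, x ∈ faceVerts f → S f = 0
    · exact Or.inl h
    · push Not at h
      obtain ⟨f, hf, hxf, hne⟩ := h
      refine Or.inr fun g hg hxg => ?_
      rw [hout x hx g hg f hf hxg hxf]
      generalize S f = m at hne
      revert m
      decide
  by_cases h1 : ∀ x ∉ C, ∀ f ∈ faces, x ∈ faceVerts f → S f = 0
  · exact Or.inl (hF.exists_face_of_monochromatic hC hin 0 h1)
  by_cases h2 : ∀ x ∉ C, ∀ f ∈ faces, x ∈ faceVerts f → S f = 1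
  · exact Or.inl (hF.exists_face_of_monochromatic hC hin 1 h2)
  right
  push Not at h1 h2
  obtain ⟨x, hx, f, hf, hxf, hfS⟩ := h1
  obtain ⟨y, hy, g, hg, hyg, hgS⟩ := h2
  refine ⟨{v | ∀ f ∈ faces, v ∈ faceVerts f → S f = 1}, ⟨x, ?_, hx⟩, ⟨y, ?_, hy⟩, ?_⟩
  · exact (hcol x hx).resolve_left fun h => hfS (h f hf hxf)
  · exact fun h => hgS (h g hg hyg)
  · intro a ha b hb hab haX h hh hbh
    obtain ⟨k, hk, -, -, -, hek, -⟩ := hF.exists_two_faces (e := s(a, b)) hab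
    rw [hout b hb h hh k hk hbh (mem_faceVerts.2 ⟨a, Sym2.eq_swap ▸ hek⟩)]
    exact haX k hk (mem_faceVerts.2 ⟨b, hek⟩)

/-- A part of the complement of `C` that is separated from the rest by `C` has at least three
attachments on `C`. -/
theorem two_lt_ncard_attach (hF : IsFullerene G faces) {C X : Set V} {x y : V} (hx : x ∈ X)
    (hxC : x ∉ C) (hy : y ∉ X) (hyC : y ∉ C)
    (hX : ∀ a ∉ C, ∀ b ∉ C, G.Adj a b → a ∈ X → b ∈ X) :
    2 < {a ∈ C | ∃ u ∈ X, u ∉ C ∧ G.Adj a u}.ncard := by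
  by_contra! hle
  refine hy (hF.mem_of_closed (T := X \ C) hle ⟨hx, hxC⟩ (fun h => hxC h.1) ?_ y
    (fun h => hyC h.1)).1
  rintro a ⟨ha, haC⟩ - b hab hb
  by_cases hbC : b ∈ C
  · exact absurd ⟨hbC, a, ha, haC, hab.symm⟩ hb
  · exact ⟨hX a haC b hbC hab ha, hbC⟩

/-- A chordless cycle of length at most five bounds a face. -/
theorem exists_face_of_ncard_le (hF : IsFullerene G faces) {C : Set V}
    (hC : IsChordlessCycle G C) (h5 : C.ncard ≤ 5) :
    ∃ f ∈ faces, faceVerts f = C ∧ ∀ x ∈ C, ∀ y ∈ C, G.Adj x y → s(x, y) ∈ f := by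
  refine (hF.face_or_separates hC).resolve_right ?_
  rintro ⟨X, ⟨x, hx, hxC⟩, ⟨y, hy, hyC⟩, hX⟩
  have h1 := hF.two_lt_ncard_attach hx hxC hy hyC hX
  have h2 := hF.two_lt_ncard_attach (X := Xᶜ) hy hyC (not_not.2 hx) hxC
    fun a ha b hb hab haX hbX => haX (hX b hb a ha hab.symm hbX)
  have hdisj : Disjoint {a ∈ C | ∃ u ∈ X, u ∉ C ∧ G.Adj a u}
      {a ∈ C | ∃ u ∈ Xᶜ, u ∉ C ∧ G.Adj a u} := by
    rw [Set.disjoint_left]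
    rintro a ⟨ha, u, hu, huC, hau⟩ ⟨-, v, hv, hvC, hav⟩
    obtain ⟨p, hp, q, hq, hpq, hap, haq, -⟩ := hC.two_nbrs a ha
    have huv : u ≠ v := fun h => hv (h ▸ hu)
    rcases hF.eq_of_adj hpq (ne_of_mem_of_not_mem hp huC) (ne_of_mem_of_not_mem hq huC) hap haq
      hau hav with rfl | rfl | rfl
    · exact hvC hp
    · exact hvC hq
    · exact huv rfl
  have h3 := Set.ncard_union_eq hdisj
  have h4 : ({a ∈ C | ∃ u ∈ X, u ∉ C ∧ G.Adj a u} ∪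
      {a ∈ C | ∃ u ∈ Xᶜ, u ∉ C ∧ G.Adj a u}).ncard ≤ C.ncard :=
    Set.ncard_le_ncard (Set.union_subset (fun _ h => h.1) (fun _ h => h.1))
  omega

theorem not_chordlessCycle_of_ncard_lt (hF : IsFullerene G faces) {C : Set V}
    (hC : IsChordlessCycle G C) (h5 : C.ncard < 5) : False := by
  obtain ⟨f, hf, hfC, -⟩ := hF.exists_face_of_ncard_le hC h5.le
  have h1 := hF.ncard_faceVerts hf
  rw [hfC] at h1
  rcases hF.face_size f hf with h | h <;> omega

theorem no_triangle (hF : IsFullerene G faces) {a b c : V} (hab : G.Adj a b) (hbc : G.Adj b c)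
    (hca : G.Adj c a) : False := by
  have hinj : Function.Injective ![a, b, c] := by
    intro i j h
    fin_cases i <;> fin_cases j <;>
      simp_all [hab.ne, hbc.ne, hca.ne, hab.ne', hbc.ne', hca.ne']
  refine hF.not_chordlessCycle_of_ncard_lt (C := Set.range ![a, b, c])
    (.of_fin le_rfl _ hinj ?_ ?_) ?_
  · intro i
    fin_cases i <;> simpa
  · intro i j _
    fin_cases i <;> fin_cases j <;> simp_all
  · rw [Set.ncard_range_of_injective hinj]
    simp

theorem no_square (hF : IsFullerene G faces) {a b c d : V} (hab : G.Adj a b) (hbc : G.Adj b c)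
    (hcd : G.Adj c d) (hda : G.Adj d a) (hac : a ≠ c) (hbd : b ≠ d) : False := by
  have hac' : ¬ G.Adj a c := fun h => hF.no_triangle hab hbc h.symm
  have hbd' : ¬ G.Adj b d := fun h => hF.no_triangle hbc hcd h.symm
  have hinj : Function.Injective ![a, b, c, d] := by
    intro i j h
    have := hab.ne; have := hbc.ne; have := hcd.ne; have := hda.ne
    fin_cases i <;> fin_cases j <;> simp at h ⊢ <;> grind
  refine hF.not_chordlessCycle_of_ncard_lt (C := Set.range ![a, b, c, d])
    (.of_fin (by norm_num) _ hinj ?_ ?_) ?_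
  · intro i
    fin_cases i <;> simpa
  · intro i j h
    fin_cases i <;> fin_cases j <;> simp [G.adj_comm c a, G.adj_comm d b, hac', hbd'] at h ⊢
  · rw [Set.ncard_range_of_injective hinj]
    simp

/-- Every 5-cycle bounds a face. -/
theorem exists_pentagon (hF : IsFullerene G faces) {a b c d e : V} (hab : G.Adj a b)
    (hbc : G.Adj b c) (hcd : G.Adj c d) (hde : G.Adj d e) (hea : G.Adj e a) (hac : a ≠ c)
    (hbd : b ≠ d) (hce : c ≠ e) (hda : d ≠ a) (heb : e ≠ b) :
    ∃ f ∈ faces, faceVerts f = {a, b, c, d, e} ∧ s(a, b) ∈ f ∧ s(b, c) ∈ f ∧ s(c, d) ∈ f ∧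
      s(d, e) ∈ f ∧ s(e, a) ∈ f := by
  have hac' : ¬ G.Adj a c := fun h => hF.no_triangle hab hbc h.symm
  have hbd' : ¬ G.Adj b d := fun h => hF.no_triangle hbc hcd h.symm
  have hce' : ¬ G.Adj c e := fun h => hF.no_triangle hcd hde h.symm
  have hda' : ¬ G.Adj d a := fun h => hF.no_triangle hde hea h.symm
  have heb' : ¬ G.Adj e b := fun h => hF.no_triangle hea hab h.symm
  have hinj : Function.Injective ![a, b, c, d, e] := by
    intro i j h
    have := hab.ne; have := hbc.ne; have := hcd.ne; have := hde.ne; have := hea.ne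
    fin_cases i <;> fin_cases j <;> simp at h ⊢ <;> grind
  have hC : IsChordlessCycle G (Set.range ![a, b, c, d, e]) := by
    refine .of_fin (by norm_num) _ hinj ?_ ?_
    · intro i
      fin_cases i <;> simpa
    · intro i j h
      fin_cases i <;> fin_cases j <;>
        simp [G.adj_comm c a, G.adj_comm d b, G.adj_comm e c, G.adj_comm a d, G.adj_comm b e,
          hac', hbd', hce', hda', heb'] at h ⊢
  obtain ⟨f, hf, hfC, hfe⟩ := hF.exists_face_of_ncard_le hC (by
    rw [Set.ncard_range_of_injective hinj]; simp)
  have hr : Set.range ![a, b, c, d, e] = {a, b, c, d, e} := by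
    ext x
    simp [eq_comm]
    tauto
  rw [hr] at hfC hfe
  exact ⟨f, hf, hfC, hfe a (by simp) b (by simp) hab, hfe b (by simp) c (by simp) hbc,
    hfe c (by simp) d (by simp) hcd, hfe d (by simp) e (by simp) hde,
    hfe e (by simp) a (by simp) hea⟩

end IsFullerene

end Separation

section Cap

variable {V : Type*} {G : SimpleGraph V}

/-- A copy of `R₅` in `G`, with central pentagon `p`, outer ring `q 0, r 0, q 1, r 1, …`, where
`a i` is the neighbour of `r i` that is not on the ring. -/
structure IsCap (G : SimpleGraph V) (p q r a : Fin 5 → V) : Prop where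
  pp : ∀ i, G.Adj (p i) (p (i + 1))
  pq : ∀ i, G.Adj (p i) (q i)
  qr : ∀ i, G.Adj (q i) (r i)
  rq : ∀ i, G.Adj (r i) (q (i + 1))
  ra : ∀ i, G.Adj (r i) (a i)
  p_inj : ∀ i j, p i = p j → i = j
  q_inj : ∀ i j, q i = q j → i = j
  r_inj : ∀ i j, r i = r j → i = j
  p_ne_q : ∀ i j, p i ≠ q j
  p_ne_r : ∀ i j, p i ≠ r j
  q_ne_r : ∀ i j, q i ≠ r j
  a_ne_left : ∀ i, a i ≠ q i
  a_ne_right : ∀ i, a i ≠ q (i + 1)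

namespace IsCap

variable {p q r a : Fin 5 → V}

theorem rotate (h : IsCap G p q r a) (k : Fin 5) :
    IsCap G (fun i => p (i + k)) (fun i => q (i + k)) (fun i => r (i + k))
      (fun i => a (i + k)) where
  pp i := by simpa only [add_right_comm] using h.pp (i + k)
  pq i := h.pq (i + k)
  qr i := h.qr (i + k)
  rq i := by simpa only [add_right_comm] using h.rq (i + k)
  ra i := h.ra (i + k)
  p_inj i j hij := add_right_cancel (h.p_inj _ _ hij)
  q_inj i j hij := add_right_cancel (h.q_inj _ _ hij)
  r_inj i j hij := add_right_cancel (h.r_inj _ _ hij)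
  p_ne_q i j := h.p_ne_q _ _
  p_ne_r i j := h.p_ne_r _ _
  q_ne_r i j := h.q_ne_r _ _
  a_ne_left i := h.a_ne_left (i + k)
  a_ne_right i := by simpa only [add_right_comm] using h.a_ne_right (i + k)

end IsCap

/-- The five faces `H i` around a copy of `R₅`. The neighbours of `a i` and `a (i + 1)` on `H i`
other than `r i` and `r (i + 1)` are `w i` and `v i`; they coincide if `H i` is a hexagon. -/
structure IsCollar (G : SimpleGraph V) (faces : Finset (Finset (Sym2 V))) (q r a : Fin 5 → V)
    (H : Fin 5 → Finset (Sym2 V)) (w v : Fin 5 → V) : Prop where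
  mem : ∀ i, H i ∈ faces
  left : ∀ i, s(r i, a i) ∈ H i
  rq : ∀ i, s(r i, q (i + 1)) ∈ H i
  qr : ∀ i, s(r (i + 1), q (i + 1)) ∈ H i
  right : ∀ i, s(r (i + 1), a (i + 1)) ∈ H i
  aw : ∀ i, s(a i, w i) ∈ H i
  av : ∀ i, s(a (i + 1), v i) ∈ H i
  size : ∀ i, ((H i).card = 5 ∧ w i = a (i + 1) ∧ v i = a i) ∨
    ((H i).card = 6 ∧ w i = v i ∧ w i ≠ a i ∧ w i ≠ a (i + 1) ∧
      faceVerts (H i) = {a i, r i, q (i + 1), r (i + 1), a (i + 1), w i})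
  ne_succ : ∀ i, H i ≠ H (i + 1)
  adj_a : ∀ i z, G.Adj (a (i + 1)) z → z = r (i + 1) ∨ z = w (i + 1) ∨ z = v i

namespace IsCollar

variable {faces : Finset (Finset (Sym2 V))} {q r a w v : Fin 5 → V} {H : Fin 5 → Finset (Sym2 V)}

theorem rotate (hH : IsCollar G faces q r a H w v) (k : Fin 5) :
    IsCollar G faces (fun i => q (i + k)) (fun i => r (i + k)) (fun i => a (i + k))
      (fun i => H (i + k)) (fun i => w (i + k)) (fun i => v (i + k)) where
  mem i := hH.mem (i + k)
  left i := hH.left (i + k)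
  rq i := by simpa only [add_right_comm] using hH.rq (i + k)
  qr i := by simpa only [add_right_comm] using hH.qr (i + k)
  right i := by simpa only [add_right_comm] using hH.right (i + k)
  aw i := hH.aw (i + k)
  av i := by simpa only [add_right_comm] using hH.av (i + k)
  size i := by simpa only [add_right_comm] using hH.size (i + k)
  ne_succ i := by simpa only [add_right_comm] using hH.ne_succ (i + k)
  adj_a i := by simpa only [add_right_comm] using hH.adj_a (i + k)

end IsCollar

variable [DecidableEq V]

theorem ncard_setOf_mem_list {l : List V} (hl : l.Nodup) : {x | x ∈ l}.ncard = l.length := by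
  rw [← List.toFinset_card_of_nodup hl, ← Set.ncard_coe_finset]
  congr 1
  ext x
  simp

variable [Fintype V] {faces : Finset (Finset (Sym2 V))}

namespace IsFullerene

/-- A face containing a path on five vertices is closed up by an edge or by one further vertex. -/
theorem face_of_path (hF : IsFullerene G faces) {f : Finset (Sym2 V)} (hf : f ∈ faces)
    {a b c d e : V} (hnd : [a, b, c, d, e].Nodup) (hab : s(a, b) ∈ f) (hbc : s(b, c) ∈ f)
    (hcd : s(c, d) ∈ f) (hde : s(d, e) ∈ f) :
    (f.card = 5 ∧ s(a, e) ∈ f) ∨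
      (f.card = 6 ∧ ∃ y, [a, b, c, d, e, y].Nodup ∧ s(a, y) ∈ f ∧ s(e, y) ∈ f ∧
        faceVerts f = {a, b, c, d, e, y}) := by
  have hba : s(b, a) ∈ f := Sym2.eq_swap ▸ hab
  have hcb : s(c, b) ∈ f := Sym2.eq_swap ▸ hbc
  have hdc : s(d, c) ∈ f := Sym2.eq_swap ▸ hcd
  have hed : s(e, d) ∈ f := Sym2.eq_swap ▸ hde
  have hbN := fun z => hF.eq_or_eq_of_mem hf (z := z) (by grind) hba hbc
  have hcN := fun z => hF.eq_or_eq_of_mem hf (z := z) (by grind) hcb hcd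
  have hdN := fun z => hF.eq_or_eq_of_mem hf (z := z) (by grind) hdc hde
  have hirr : ∀ z, s(z, z) ∉ f := fun z hz => (hF.adj_of_mem hf hz).ne rfl
  obtain ⟨w, hwb, haN⟩ := hF.exists_other hf hab
  obtain ⟨v, hvd, heN⟩ := hF.exists_other hf hed
  have haw := (haN w).2 (Or.inr rfl)
  have hev := (heN v).2 (Or.inr rfl)
  have hwa : s(w, a) ∈ f := Sym2.eq_swap ▸ haw
  have hve : s(v, e) ∈ f := Sym2.eq_swap ▸ hev
  have hwa' : w ≠ a := fun h => hirr a (h ▸ haw)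
  have hve' : v ≠ e := fun h => hirr e (h ▸ hev)
  have hwc : w ≠ c := fun h => by have := hcN a (h ▸ hwa); grind
  have hwd : w ≠ d := fun h => by have := hdN a (h ▸ hwa); grind
  have hvb : v ≠ b := fun h => by have := hbN e (h ▸ hve); grind
  have hvc : v ≠ c := fun h => by have := hcN e (h ▸ hve); grind
  have hcard := hF.ncard_faceVerts hf
  have hsub : ∀ l : List V, (∀ x ∈ l, x ∈ faceVerts f) → l.Nodup → l.length ≤ f.card := by
    intro l hl hnd
    rw [← hcard, ← ncard_setOf_mem_list hnd]
    exact Set.ncard_le_ncard hl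
  have hmem : ∀ {x y : V}, s(x, y) ∈ f → x ∈ faceVerts f := fun h => mem_faceVerts.2 ⟨_, h⟩
  by_cases hwe : w = e
  · subst hwe
    refine Or.inl ⟨?_, haw⟩
    have hle : faceVerts f ⊆ {x | x ∈ [a, b, c, d, w]} := by
      refine hF.faceVerts_subset_of_closed hf (hmem hab) (by simp) ?_
      have hwv : v = a := by have := (heN a).1 hwa; grind
      intro x hx y hxy
      simp only [Set.mem_ofPred_eq, List.mem_cons, List.not_mem_nil, or_false] at hx ⊢
      rcases hx with rfl | rfl | rfl | rfl | rfl
      · have := (haN y).1 hxy; tauto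
      · have := hbN y hxy; tauto
      · have := hcN y hxy; tauto
      · have := hdN y hxy; tauto
      · have := (heN y).1 hxy; rw [hwv] at this; tauto
    have := Set.ncard_le_ncard hle
    rw [ncard_setOf_mem_list hnd, hcard] at this
    rcases hF.face_size f hf with h | h
    · exact h
    · rw [h] at this; simp at this
  · have hva : v ≠ a := fun h => by have := (haN e).1 (h ▸ hve); grind
    have hnd' : [a, b, c, d, e, w].Nodup := by grind
    have h6 := hsub [a, b, c, d, e, w] (by
      simp only [List.mem_cons, List.not_mem_nil, or_false]
      rintro x (rfl | rfl | rfl | rfl | rfl | rfl)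
      exacts [hmem hab, hmem hbc, hmem hcd, hmem hde, hmem hed, hmem hwa]) hnd'
    have hvw : v = w := by
      by_contra hvw
      have h7 := hsub [a, b, c, d, e, w, v] (by
        simp only [List.mem_cons, List.not_mem_nil, or_false]
        rintro x (rfl | rfl | rfl | rfl | rfl | rfl | rfl)
        exacts [hmem hab, hmem hbc, hmem hcd, hmem hde, hmem hed, hmem hwa, hmem hve]) (by
          clear hsub hbN hcN hdN haN heN hirr h6
          simp only [List.nodup_cons, List.mem_cons, List.not_mem_nil, or_false, not_or] at hnd' ⊢
          grind)
      simp only [List.length_cons, List.length_nil] at h7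
      rcases hF.face_size f hf with h | h <;> omega
    subst hvw
    simp only [List.length_cons, List.length_nil] at h6
    have hc6 : f.card = 6 := by rcases hF.face_size f hf with h | h <;> omega
    refine Or.inr ⟨hc6, v, hnd', haw, hev, ?_⟩
    have hset : ({a, b, c, d, e, v} : Set V) = {x | x ∈ [a, b, c, d, e, v]} := by
      ext x; simp
    rw [hset]
    refine (Set.eq_of_subset_of_ncard_le ?_ ?_).symm
    · simp only [List.mem_cons, List.not_mem_nil, or_false]
      rintro x (rfl | rfl | rfl | rfl | rfl | rfl)
      exacts [hmem hab, hmem hbc, hmem hcd, hmem hde, hmem hed, hmem hwa]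
    · rw [ncard_setOf_mem_list hnd', hcard, hc6]
      rfl

end IsFullerene

namespace IsCap

variable {p q r a : Fin 5 → V}

theorem adj_p (hF : IsFullerene G faces) (h : IsCap G p q r a) {i : Fin 5} {z : V}
    (hz : G.Adj (p i) z) : z = p (i + 1) ∨ z = p (i + 4) ∨ z = q i := by
  have h4 := h.pp (i + 4)
  rw [show i + 4 + 1 = i by grind] at h4
  exact hF.eq_of_adj (fun e => absurd (h.p_inj _ _ e) (by grind)) (h.p_ne_q _ _)
    (h.p_ne_q _ _) (h.pp i) h4.symm (h.pq i) hz

theorem adj_q (hF : IsFullerene G faces) (h : IsCap G p q r a) {i : Fin 5} {z : V}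
    (hz : G.Adj (q i) z) : z = p i ∨ z = r i ∨ z = r (i + 4) := by
  have h4 := h.rq (i + 4)
  rw [show i + 4 + 1 = i by grind] at h4
  exact hF.eq_of_adj (h.p_ne_r _ _) (h.p_ne_r _ _)
    (fun e => absurd (h.r_inj _ _ e) (by grind)) (h.pq i).symm (h.qr i) h4.symm hz

theorem adj_r (hF : IsFullerene G faces) (h : IsCap G p q r a) {i : Fin 5} {z : V}
    (hz : G.Adj (r i) z) : z = q i ∨ z = q (i + 1) ∨ z = a i :=
  hF.eq_of_adj (fun e => absurd (h.q_inj _ _ e) (by grind)) (h.a_ne_left i).symm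
    (h.a_ne_right i).symm (h.qr i).symm (h.rq i) (h.ra i) hz

theorem exists_inner_pentagon (hF : IsFullerene G faces) (h : IsCap G p q r a) (i : Fin 5) :
    ∃ f ∈ faces, faceVerts f = {p i, p (i + 1), q (i + 1), r i, q i} ∧
      s(r i, q i) ∈ f ∧ s(r i, q (i + 1)) ∈ f := by
  obtain ⟨f, hf, hfv, -, -, h1, h2, -⟩ := hF.exists_pentagon (h.pp i) (h.pq (i + 1))
    (h.rq i).symm (h.qr i).symm (h.pq i).symm (h.p_ne_q _ _) (h.p_ne_r _ _)
    (fun e => absurd (h.q_inj _ _ e) (by grind)) (h.p_ne_r _ _).symm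
    (h.p_ne_q _ _).symm
  exact ⟨f, hf, hfv, h2, Sym2.eq_swap ▸ h1⟩

/-- A face through `q i`, `r i` and `q (i + 1)` meets the outer ring in no other `r j`. -/
theorem eq_of_mem_inner_pentagon (hF : IsFullerene G faces) (h : IsCap G p q r a) {i j : Fin 5}
    {f : Finset (Sym2 V)} (hf : f ∈ faces) (h1 : s(r i, q i) ∈ f) (h2 : s(r i, q (i + 1)) ∈ f)
    (hj : r j ∈ faceVerts f) : j = i := by
  obtain ⟨g, hg, hgv, h3, h4⟩ := h.exists_inner_pentagon hF i
  obtain rfl := hF.face_unique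
    (fun e => absurd (h.q_inj _ _ e) (by grind)) hf hg h1 h2 h3 h4
  rw [hgv] at hj
  rcases hj with e | e | e | e | e
  · exact absurd e.symm (h.p_ne_r _ _)
  · exact absurd e.symm (h.p_ne_r _ _)
  · exact absurd e.symm (h.q_ne_r _ _)
  · exact h.r_inj _ _ e
  · exact absurd e.symm (h.q_ne_r _ _)

theorem not_adj_r_succ (hF : IsFullerene G faces) (h : IsCap G p q r a) (i : Fin 5) :
    ¬ G.Adj (r i) (r (i + 1)) :=
  fun e => hF.no_triangle (h.rq i) (h.qr (i + 1)) e.symm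

theorem not_adj_r_add_two (hF : IsFullerene G faces) (h : IsCap G p q r a) (i : Fin 5) :
    ¬ G.Adj (r i) (r (i + 1 + 1)) := by
  intro e
  obtain ⟨f, hf, hfv, -, h1, h2, -, -⟩ := hF.exists_pentagon (h.rq i) (h.qr (i + 1))
    (h.rq (i + 1)) (h.qr (i + 1 + 1)) e.symm
    (fun e => absurd (h.r_inj _ _ e) (by grind))
    (fun e => absurd (h.q_inj _ _ e) (by grind))
    (fun e => absurd (h.r_inj _ _ e) (by grind)) (h.q_ne_r _ _) (h.q_ne_r _ _).symm
  have := h.eq_of_mem_inner_pentagon hF (j := i) hf (Sym2.eq_swap ▸ h1) h2 (by rw [hfv]; simp)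
  grind

theorem a_ne_p (hF : IsFullerene G faces) (h : IsCap G p q r a) (i j : Fin 5) :
    a i ≠ p j := by
  intro e
  rcases h.adj_p hF (e ▸ h.ra i).symm with e | e | e
  · exact h.p_ne_r _ _ e.symm
  · exact h.p_ne_r _ _ e.symm
  · exact h.q_ne_r _ _ e.symm

theorem a_ne_q (hF : IsFullerene G faces) (h : IsCap G p q r a) (i j : Fin 5) :
    a i ≠ q j := by
  intro e
  rcases h.adj_q hF (e ▸ h.ra i).symm with e' | e' | e'
  · exact h.p_ne_r _ _ e'.symm
  · exact h.a_ne_left j (h.r_inj _ _ e' ▸ e)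
  · obtain rfl : j = i + 1 := by rw [h.r_inj _ _ e']; grind
    exact h.a_ne_right i e

theorem a_ne_r (hF : IsFullerene G faces) (h : IsCap G p q r a) (i j : Fin 5) :
    a i ≠ r j := by
  intro e
  have hij : G.Adj (r i) (r j) := e ▸ h.ra i
  have : i = j ∨ j = i + 1 ∨ j = i + 1 + 1 ∨ i = j + 1 ∨ i = j + 1 + 1 := by
    clear e hij
    revert i j
    decide
  rcases this with rfl | rfl | rfl | rfl | rfl
  · exact hij.ne rfl
  · exact h.not_adj_r_succ hF _ hij
  · exact h.not_adj_r_add_two hF _ hij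
  · exact h.not_adj_r_succ hF _ hij.symm
  · exact h.not_adj_r_add_two hF _ hij.symm

theorem a_ne_a_succ (hF : IsFullerene G faces) (h : IsCap G p q r a) (i : Fin 5) :
    a i ≠ a (i + 1) := fun e =>
  hF.no_square (h.rq i) (h.qr (i + 1)) (h.ra (i + 1)) (e ▸ (h.ra i).symm)
    (fun e => absurd (h.r_inj _ _ e) (by grind)) (h.a_ne_q hF _ _).symm

theorem a_ne_a_add_two (hF : IsFullerene G faces) (h : IsCap G p q r a) (i : Fin 5) :
    a i ≠ a (i + 2) := by
  intro e
  have e2 : i + 1 + 1 = i + 2 := by grind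
  have hqr1 := h.qr (i + 1)
  have hrq1 := e2 ▸ h.rq (i + 1)
  have hq {j k : Fin 5} : ¬ G.Adj (q j) (q k) := fun hjk => by
    have := h.adj_q hF hjk
    grind [h.p_ne_q, h.q_ne_r]
  have hqa {j k : Fin 5} : ¬ G.Adj (q j) (a k) := fun hjk => by
    have := h.adj_q hF hjk
    grind [h.a_ne_p hF, h.a_ne_r hF]
  have hC : IsChordlessCycle G
      (Set.range ![r i, q (i + 1), r (i + 1), q (i + 2), r (i + 2), a i]) := by
    refine .of_hexagon ?_ (h.rq i) hqr1 hrq1 (h.qr _) (e ▸ h.ra _) (h.ra i).symm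
      (h.not_adj_r_succ hF i) ?_ (e2 ▸ h.not_adj_r_add_two hF i) hq ?_ hqa
      (e2 ▸ h.not_adj_r_succ hF (i + 1)) ?_ hqa
    · simp only [List.nodup_cons, List.mem_cons, List.not_mem_nil, or_false, not_or]
      grind [h.r_inj, h.q_inj, h.q_ne_r, h.a_ne_q hF, h.a_ne_r hF]
    · intro hz
      have := h.adj_r hF hz
      grind [h.q_inj, h.a_ne_q hF]
    · intro hz
      have := h.adj_q hF hz
      grind [h.r_inj, h.p_ne_r]
    · intro hz
      have := h.adj_r hF hz
      grind [h.a_ne_q hF, h.a_ne_a_succ hF i]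
  set C := Set.range ![r i, q (i + 1), r (i + 1), q (i + 2), r (i + 2), a i] with hCdef
  have hmem : ∀ x, x ∈ C ↔ x = r i ∨ x = q (i + 1) ∨ x = r (i + 1) ∨ x = q (i + 2) ∨
      x = r (i + 2) ∨ x = a i := by
    intro x
    rw [hCdef]
    simp
    tauto
  rcases hF.face_or_separates hC with ⟨f, hf, hfC, hfe⟩ | ⟨X, ⟨x, hx, hxC⟩, ⟨y, hy, hyC⟩, hX⟩
  · have := h.eq_of_mem_inner_pentagon hF (i := i + 1) (j := i) hf
      (hfe _ ((hmem _).2 (by tauto)) _ ((hmem _).2 (by tauto)) hqr1.symm)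
      (by rw [e2]; exact hfe _ ((hmem _).2 (by tauto)) _ ((hmem _).2 (by tauto)) hrq1)
      (by rw [hfC]; exact (hmem _).2 (by tauto))
    grind
  have key : ∀ Y : Set V, ∀ x ∈ Y, x ∉ C → ∀ y ∉ Y, y ∉ C →
      (∀ a ∉ C, ∀ b ∉ C, G.Adj a b → a ∈ Y → b ∈ Y) → p i ∈ Y := by
    intro Y x hx hxC y hy hyC hY
    by_contra hpi
    have hpC : ∀ j, p j ∉ C := fun j => by
      rw [hmem]; grind [h.p_ne_q, h.p_ne_r, h.a_ne_p hF]
    have hp1 : p (i + 1) ∉ Y := fun hm => hpi (hY _ (hpC _) _ (hpC _) (h.pp i).symm hm)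
    have hp2 : p (i + 2) ∉ Y := fun hm =>
      hp1 (hY _ (hpC _) _ (hpC _) (e2 ▸ h.pp (i + 1)).symm hm)
    have e3 : i + 2 + 1 = i + 3 := by grind
    have hp3 : p (i + 3) ∉ Y := fun hm =>
      hp2 (hY _ (hpC _) _ (hpC _) (e3 ▸ h.pp (i + 2)).symm hm)
    have hq0 : q i ∉ Y := fun hm => hpi (hY _ (by
      rw [hmem]; grind [h.q_ne_r, h.a_ne_q hF, h.q_inj])
      _ (hpC _) (h.pq i).symm hm)
    have hq3 : q (i + 3) ∉ Y := fun hm => hp3 (hY _ (by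
      rw [hmem]; grind [h.q_ne_r, h.a_ne_q hF, h.q_inj])
      _ (hpC _) (h.pq _).symm hm)
    refine (hF.two_lt_ncard_attach hx hxC hy hyC hY).not_ge
      ((Set.ncard_le_ncard (t := {r (i + 1), a i}) ?_).trans ((Set.ncard_insert_le _ _).trans (by simp)))
    rintro c ⟨hc, u, hu, huC, hcu⟩
    rw [hmem] at hc huC
    rcases hc with rfl | rfl | rfl | rfl | rfl | rfl
    · have := h.adj_r hF hcu
      grind
    · have := h.adj_q hF hcu
      rw [show i + 1 + 4 = i by grind] at this
      grind
    · simp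
    · have := h.adj_q hF hcu
      rw [show i + 2 + 4 = i + 1 by grind] at this
      grind
    · have := h.adj_r hF hcu
      grind
    · simp
  exact key Xᶜ y hy hyC x (not_not.2 hx) hxC
    (fun a ha b hb hab haX hbX => haX (hX b hb a ha hab.symm hbX)) (key X x hx hxC y hy hyC hX)

theorem a_inj (hF : IsFullerene G faces) (h : IsCap G p q r a) (i j : Fin 5) (e : a i = a j) :
    i = j := by
  have : i = j ∨ j = i + 1 ∨ j = i + 2 ∨ i = j + 1 ∨ i = j + 2 := by
    clear e
    revert i j
    decide
  rcases this with rfl | rfl | rfl | rfl | rfl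
  · rfl
  · exact absurd e (h.a_ne_a_succ hF _)
  · exact absurd e (h.a_ne_a_add_two hF _)
  · exact absurd e.symm (h.a_ne_a_succ hF _)
  · exact absurd e.symm (h.a_ne_a_add_two hF _)

theorem exists_outer_face (hF : IsFullerene G faces) (h : IsCap G p q r a) (i : Fin 5) :
    ∃ f ∈ faces, s(r i, a i) ∈ f ∧ s(r i, q (i + 1)) ∈ f ∧ s(r (i + 1), q (i + 1)) ∈ f ∧
      s(r (i + 1), a (i + 1)) ∈ f := by
  have hne : i + 1 ≠ i := by grind
  obtain ⟨f, hf, h1, h2⟩ := hF.exists_face (fun e => hne (h.r_inj _ _ e).symm) (h.rq i).symm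
    (h.qr (i + 1))
  rw [Sym2.eq_swap] at h1 h2
  obtain ⟨u, hu, hu'⟩ := hF.exists_other hf h1
  obtain ⟨w, hw, hw'⟩ := hF.exists_other hf h2
  have hru := (hu' u).2 (Or.inr rfl)
  have hrw := (hw' w).2 (Or.inr rfl)
  refine ⟨f, hf, ?_, h1, h2, ?_⟩
  · rcases h.adj_r hF (hF.adj_of_mem hf hru) with rfl | rfl | rfl
    · exact absurd (h.eq_of_mem_inner_pentagon hF hf hru h1 (mem_faceVerts.2 ⟨_, h2⟩)) hne
    · exact absurd rfl hu
    · exact hru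
  · rcases h.adj_r hF (hF.adj_of_mem hf hrw) with rfl | rfl | rfl
    · exact absurd rfl hw
    · exact absurd (h.eq_of_mem_inner_pentagon hF hf h2 hrw (mem_faceVerts.2 ⟨_, h1⟩)).symm hne
    · exact hrw

theorem exists_collar (hF : IsFullerene G faces) (h : IsCap G p q r a) :
    ∃ H w v, IsCollar G faces q r a H w v := by
  choose H hH h1 h2 h3 h4 using h.exists_outer_face hF
  have hwv : ∀ i, ∃ w v, s(a i, w) ∈ H i ∧ s(a (i + 1), v) ∈ H i ∧ w ≠ r i ∧ v ≠ r (i + 1) ∧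
      (((H i).card = 5 ∧ w = a (i + 1) ∧ v = a i) ∨
      ((H i).card = 6 ∧ w = v ∧ w ≠ a i ∧ w ≠ a (i + 1) ∧
        faceVerts (H i) = {a i, r i, q (i + 1), r (i + 1), a (i + 1), w})) := by
    intro i
    have hne : i ≠ i + 1 := by grind
    have hr := fun e => hne (h.r_inj _ _ e)
    have ha := fun e => hne (h.a_inj hF _ _ e)
    have hnd : [a i, r i, q (i + 1), r (i + 1), a (i + 1)].Nodup := by
      simp only [List.nodup_cons, List.mem_cons, List.not_mem_nil, or_false, not_or]
      grind [h.q_ne_r, h.a_ne_q hF, h.a_ne_r hF]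
    rcases hF.face_of_path (hH i) hnd (Sym2.eq_swap ▸ h1 i) (h2 i) (Sym2.eq_swap ▸ h3 i) (h4 i)
      with ⟨hc, he⟩ | ⟨hc, y, hy, he, he', hv⟩
    · exact ⟨a (i + 1), a i, he, Sym2.eq_swap ▸ he, h.a_ne_r hF _ _, h.a_ne_r hF _ _,
        Or.inl ⟨hc, rfl, rfl⟩⟩
    · simp only [List.nodup_cons, List.mem_cons, List.not_mem_nil, or_false, not_or] at hy
      exact ⟨y, y, he, he', by grind, by grind, Or.inr ⟨hc, rfl, by grind, by grind, hv⟩⟩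
  choose w v haw hav hwr hvr hsize using hwv
  have hne : ∀ i, H i ≠ H (i + 1) := by
    intro i e
    have hi : i + 1 ≠ i + 1 + 1 := by grind
    have := hF.eq_or_eq_of_mem (hH i) (h.a_ne_q hF (i + 1) (i + 1)).symm (h3 i) (h4 i)
      (e ▸ h2 (i + 1))
    rcases this with e | e
    · exact hi (h.q_inj _ _ e).symm
    · exact h.a_ne_q hF _ _ e.symm
  refine ⟨H, w, v, hH, h1, h2, h3, h4, haw, hav, hsize, hne, fun i z hz => ?_⟩
  refine hF.eq_of_adj (hwr _).symm (hvr i).symm ?_ (h.ra _).symm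
    (hF.adj_of_mem (hH _) (haw _)) (hF.adj_of_mem (hH _) (hav i)) hz
  intro e
  exact hne i (hF.face_unique (hvr i).symm (hH _) (hH _) (Sym2.eq_swap ▸ h4 i) (hav i)
    (Sym2.eq_swap ▸ h1 (i + 1)) (e ▸ haw (i + 1)))

end IsCap

theorem IsFullerene.card_eq (hF : IsFullerene G faces) :
    Fintype.card V = 20 + 2 * (faces.filter fun f => f.card = 6).card := by
  classical
  have hdeg : ∀ v, G.degree v = 3 := fun v => by
    rw [← hF.cubic v, ← Nat.card_coe_set_eq, Nat.card_eq_fintype_card,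
      G.card_neighborSet_eq_degree]
  have hE := G.sum_degrees_eq_twice_card_edges
  simp only [hdeg, Finset.sum_const, Finset.card_univ, smul_eq_mul] at hE
  have hsplit := Finset.card_filter_add_card_filter_not (s := faces) fun f => f.card = 5
  have h6 : (faces.filter fun f => ¬ f.card = 5) = faces.filter fun f => f.card = 6 :=
    Finset.filter_congr fun f hf => by
      have := hF.face_size f hf
      omega
  have h1 := hF.euler
  rw [← G.coe_edgeFinset, Set.ncard_coe_finset] at h1
  have h2 := hF.pentagons
  rw [h6] at hsplit
  omega

namespace IsCollar

variable {p q r a w v : Fin 5 → V} {H : Fin 5 → Finset (Sym2 V)}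

theorem card_le (hF : IsFullerene G faces) (h : IsCap G p q r a)
    (hH : IsCollar G faces q r a H w v) {s : Set V} (hs : s.ncard ≤ 2) (hp : p 0 ∉ s)
    (hw : ∀ i, w i ∈ s ∨ ∃ j, w i = a j) : Fintype.card V ≤ 20 + s.ncard := by
  have hv : ∀ i, v i ∈ s ∨ ∃ j, v i = a j := by
    intro i
    rcases hH.size i with ⟨-, -, e⟩ | ⟨-, e, -⟩
    · exact Or.inr ⟨i, e⟩
    · exact e ▸ hw i
  set T := Set.range p ∪ Set.range q ∪ Set.range r ∪ Set.range a with hT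
  have hT20 : T.ncard ≤ 20 := by
    rw [hT]
    have hle : ∀ g : Fin 5 → V, (Set.range g).ncard ≤ 5 := fun g => by
      rw [← Set.image_univ]
      exact (Set.ncard_image_le Set.finite_univ).trans (by simp [Set.ncard_univ])
    have h1 := Set.ncard_union_le (Set.range p ∪ Set.range q ∪ Set.range r) (Set.range a)
    have h2 := Set.ncard_union_le (Set.range p ∪ Set.range q) (Set.range r)
    have h3 := Set.ncard_union_le (Set.range p) (Set.range q)
    have := hle p; have := hle q; have := hle r; have := hle a
    omega
  have huniv : (Set.univ : Set V) ⊆ T ∪ s := by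
    intro y _
    by_cases hy : y ∈ s
    · exact Or.inr hy
    refine Or.inl (hF.mem_of_closed (T := T) hs (x := p 0) (by simp [hT]) hp ?_ y hy)
    rintro x hx - z hxz hz
    have hpT : ∀ i, p i ∈ T := by simp [hT]
    have hqT : ∀ i, q i ∈ T := by simp [hT]
    have hrT : ∀ i, r i ∈ T := by simp [hT]
    have haT : ∀ i, a i ∈ T := by simp [hT]
    rcases hx with ((⟨i, rfl⟩ | ⟨i, rfl⟩) | ⟨i, rfl⟩) | ⟨i, rfl⟩
    · rcases h.adj_p hF hxz with rfl | rfl | rfl <;> simp only [hpT, hqT]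
    · rcases h.adj_q hF hxz with rfl | rfl | rfl <;> simp only [hpT, hrT]
    · rcases h.adj_r hF hxz with rfl | rfl | rfl <;> simp only [hqT, haT]
    · obtain ⟨i, rfl⟩ : ∃ j, i = j + 1 := ⟨i - 1, by simp⟩
      rcases hH.adj_a i z hxz with rfl | rfl | rfl
      · exact hrT _
      · obtain ⟨j, e⟩ := (hw (i + 1)).resolve_left hz
        exact e ▸ haT j
      · obtain ⟨j, e⟩ := (hv i).resolve_left hz
        exact e ▸ haT j
  have h1 := Set.ncard_le_ncard huniv
  have h2 := Set.ncard_union_le T s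
  rw [Set.ncard_univ, Nat.card_eq_fintype_card] at h1
  omega

/-- If only two consecutive faces of the collar can be hexagons then there are `20` vertices. -/
theorem card_eq_of_forall (hF : IsFullerene G faces) (h : IsCap G p q r a)
    (hH : IsCollar G faces q r a H w v) {j : Fin 5}
    (hj : ∀ i, (H i).card = 6 → i = j ∨ i = j + 1) : Fintype.card V = 20 := by
  set I := {i | (H i).card = 6}
  have hI : I.ncard ≤ 2 := (Set.ncard_le_ncard (t := {j, j + 1}) hj).trans
    ((Set.ncard_insert_le _ _).trans (by simp))
  have himg : (w '' I).ncard ≤ I.ncard := Set.ncard_image_le I.toFinite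
  have hle := hH.card_le hF h (s := w '' I) (himg.trans hI) (by
    rintro ⟨i, -, e⟩
    have hadj := hF.adj_of_mem (hH.mem i) (hH.aw i)
    rw [e] at hadj
    rcases h.adj_p hF hadj.symm with e | e | e
    exacts [h.a_ne_p hF _ _ e, h.a_ne_p hF _ _ e, h.a_ne_q hF _ _ e]) (by
    intro i
    rcases hH.size i with ⟨-, e, -⟩ | ⟨e, -⟩
    · exact Or.inr ⟨_, e⟩
    · exact Or.inl ⟨i, e, rfl⟩)
  have hinj : Set.InjOn H I := by
    intro i hi k hk e
    have := hH.ne_succ j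
    rcases hj i hi with rfl | rfl <;> rcases hj k hk with rfl | rfl <;> grind
  have hcard : I.ncard ≤ (faces.filter fun f => f.card = 6).card := by
    rw [← hinj.ncard_image, ← Set.ncard_coe_finset]
    refine Set.ncard_le_ncard ?_
    rintro _ ⟨i, hi, rfl⟩
    simpa using ⟨hH.mem i, hi⟩
  have := hF.card_eq
  omega

/-- A face through the edge from `a i` to `a (i + 1)` and one of `r i`, `r (i + 1)` is a
pentagon. -/
theorem card_eq_five_of_adj (hF : IsFullerene G faces) (h : IsCap G p q r a) {i : Fin 5}
    {f : Finset (Sym2 V)} (hf : f ∈ faces) (hi : s(a i, a (i + 1)) ∈ f)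
    (hr : s(r i, a i) ∈ f ∨ s(r (i + 1), a (i + 1)) ∈ f) : f.card = 5 := by
  have hne : i ≠ i + 1 := by grind
  obtain ⟨g, hg, hgv, -, -, h1, h2, h3⟩ := hF.exists_pentagon (h.rq i) (h.qr (i + 1))
    (h.ra (i + 1)) (hF.adj_of_mem hf hi).symm (h.ra i).symm (fun e => hne (h.r_inj _ _ e))
    (h.a_ne_q hF _ _).symm (h.a_ne_r hF _ _).symm (h.a_ne_r hF _ _) (h.a_ne_q hF _ _)
  have hfg : f = g := by
    rcases hr with hr | hr
    · exact hF.face_unique (h.a_ne_r hF _ _).symm hf hg (Sym2.eq_swap ▸ hr) hi h3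
        (Sym2.eq_swap ▸ h2)
    · exact hF.face_unique (h.a_ne_r hF _ _).symm hf hg (Sym2.eq_swap ▸ hr) (Sym2.eq_swap ▸ hi)
        (Sym2.eq_swap ▸ h1) h2
  have hcard := hF.ncard_faceVerts hf
  rw [hfg, hgv] at hcard
  have hle : ({r i, q (i + 1), r (i + 1), a (i + 1), a i} : Set V).ncard ≤ 5 := by
    have h1 := Set.ncard_insert_le (r i) {q (i + 1), r (i + 1), a (i + 1), a i}
    have h2 := Set.ncard_insert_le (q (i + 1)) {r (i + 1), a (i + 1), a i}
    have h3 := Set.ncard_insert_le (r (i + 1)) {a (i + 1), a i}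
    have h4 := Set.ncard_insert_le (a (i + 1)) {a i}
    rw [Set.ncard_singleton] at h4
    omega
  have := hF.face_size g hg
  rw [hfg]
  omega

theorem disjoint_of_card_eq_six (hF : IsFullerene G faces) (hne : Fintype.card V ≠ 20)
    (h : IsCap G p q r a) (hH : IsCollar G faces q r a H w v) (h0 : (H 0).card = 6)
    (h2 : (H 2).card = 6) : Disjoint (faceVerts (H 0)) (faceVerts (H 2)) := by
  obtain ⟨-, hv0, hw00, hw01, hH0⟩ := (hH.size 0).resolve_left (by omega)
  obtain ⟨-, hv2, hw22, hw23, hH2⟩ := (hH.size 2).resolve_left (by omega)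
  have haw := fun i => hF.adj_of_mem (hH.mem i) (hH.aw i)
  have hav := fun i => hF.adj_of_mem (hH.mem i) (hH.av i)
  have ha01 : G.Adj (a 1) (w 0) := hv0 ▸ hav 0
  have ha23 : G.Adj (a 3) (w 2) := hv2 ▸ hav 2
  have hq : ∀ i j, w i ≠ q j := fun i j e => by
    rcases h.adj_q hF (e ▸ haw i).symm with e | e | e
    exacts [h.a_ne_p hF _ _ e, h.a_ne_r hF _ _ e, h.a_ne_r hF _ _ e]
  have hr : ∀ {i j}, G.Adj (a i) (r j) → i = j := fun {i j} hij => by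
    rcases h.adj_r hF hij.symm with e | e | e
    exacts [absurd e (h.a_ne_q hF _ _), absurd e (h.a_ne_q hF _ _), h.a_inj hF _ _ e]
  have hr0 : ∀ j, w 0 ≠ r j := fun j e => by
    have e0 := hr (e ▸ haw 0)
    have e1 := hr (e ▸ ha01)
    grind
  have hr2 : ∀ j, w 2 ≠ r j := fun j e => by
    have e0 := hr (e ▸ haw 2)
    have e1 := hr (e ▸ ha23)
    grind
  have hinj : ∀ {i j : Fin 5}, i ≠ j → a i ≠ a j := fun hij e => hij (h.a_inj hF _ _ e)
  have hww : w 0 ≠ w 2 := fun e => by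
    have := hF.eq_of_adj (hinj (by decide)) (hinj (by decide)) (hinj (by decide)) (haw 0).symm
      ha01.symm (e ▸ (haw 2).symm) (e ▸ ha23.symm)
    rcases this with e | e | e <;> exact hinj (by decide) e
  have hw02 : w 0 ≠ a 2 := fun e => by
    have := card_eq_five_of_adj hF h (i := 1) (hH.mem 0) (e ▸ hv0 ▸ hH.av 0)
      (Or.inl (hH.right 0))
    omega
  have hw21 : w 2 ≠ a 1 := fun e => by
    have := card_eq_five_of_adj hF h (i := 1) (hH.mem 2)
      (Sym2.eq_swap ▸ (e ▸ hH.aw 2 : s(a 2, a 1) ∈ H 2)) (Or.inr (hH.left 2))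
    omega
  have hiff : w 0 = a 3 ∨ w 2 = a 0 → w 0 = a 3 ∧ w 2 = a 0 ∧ w 3 = a 1 ∧ v 4 = a 2 := by
    have n3 : ∀ z, G.Adj (a 3) z → z = r 3 ∨ z = w 3 ∨ z = v 2 := hH.adj_a 2
    have n0 : ∀ z, G.Adj (a 0) z → z = r 0 ∨ z = w 0 ∨ z = v 4 := hH.adj_a 4
    have hcross : w 0 = a 3 → w 2 = a 0 ∧ w 3 = a 1 := fun e => by
      have e0 := n3 (a 0) (e ▸ haw 0).symm
      have e1 := n3 (a 1) (e ▸ ha01).symm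
      grind [h.a_ne_r hF, hinj (show (0 : Fin 5) ≠ 1 by decide)]
    have hcross' : w 2 = a 0 → w 0 = a 3 ∧ v 4 = a 2 := fun e => by
      have e0 := n0 (a 2) (e ▸ haw 2).symm
      have e1 := n0 (a 3) (e ▸ ha23).symm
      grind [h.a_ne_r hF, hinj (show (2 : Fin 5) ≠ 3 by decide)]
    grind
  have hw03 : ¬ (w 0 = a 3 ∨ w 2 = a 0) := fun e => by
    obtain ⟨e0, e2, e3, e4⟩ := hiff e
    have hv3 : v 3 = a 1 := by
      rcases hH.size 3 with ⟨-, e', -⟩ | ⟨-, e', -⟩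
      · exact absurd (e3.symm.trans e') (hinj (by decide))
      · exact e' ▸ e3
    have hw4 : w 4 = a 2 := by
      rcases hH.size 4 with ⟨-, -, e'⟩ | ⟨-, e', -⟩
      · exact absurd (e4.symm.trans e') (hinj (by decide))
      · exact e' ▸ e4
    have hw1 : w 1 = a 4 := by
      have h41 : G.Adj (a 4) (a 1) := hv3 ▸ hav 3
      rcases hH.adj_a 0 (a 4) h41.symm with e' | e' | e'
      · exact absurd e' (h.a_ne_r hF _ _)
      · exact e'.symm
      · exact absurd (e'.trans (hv0.symm.trans e0)) (hinj (by decide))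
    have := hH.card_le hF h (s := ∅) (by simp) (by simp) (fun i => Or.inr (by
      fin_cases i
      exacts [⟨_, e0⟩, ⟨_, hw1⟩, ⟨_, e2⟩, ⟨_, e3⟩, ⟨_, hw4⟩]))
    have hc := hF.card_eq
    rw [Set.ncard_empty] at this
    omega
  rw [hH0, hH2, Set.disjoint_left]
  have e1 : (0 : Fin 5) + 1 = 1 := rfl
  have e3 : (2 : Fin 5) + 1 = 3 := rfl
  have nr : ∀ {i j : Fin 5}, i ≠ j → r i ≠ r j := fun hij e => hij (h.r_inj _ _ e)
  have nq : ∀ {i j : Fin 5}, i ≠ j → q i ≠ q j := fun hij e => hij (h.q_inj _ _ e)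
  simp only [e1, e3, Set.mem_insert_iff, Set.mem_singleton_iff, not_or] at hw03 ⊢
  rintro x (rfl | rfl | rfl | rfl | rfl | rfl)
  · exact ⟨hinj (by decide), h.a_ne_r hF _ _, h.a_ne_q hF _ _, h.a_ne_r hF _ _,
      hinj (by decide), fun e => hw03.2 e.symm⟩
  · exact ⟨(h.a_ne_r hF _ _).symm, nr (by decide), (h.q_ne_r _ _).symm, nr (by decide),
      (h.a_ne_r hF _ _).symm, (hr2 _).symm⟩
  · exact ⟨(h.a_ne_q hF _ _).symm, h.q_ne_r _ _, nq (by decide), h.q_ne_r _ _,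
      (h.a_ne_q hF _ _).symm, (hq _ _).symm⟩
  · exact ⟨(h.a_ne_r hF _ _).symm, nr (by decide), (h.q_ne_r _ _).symm, nr (by decide),
      (h.a_ne_r hF _ _).symm, (hr2 _).symm⟩
  · exact ⟨hinj (by decide), h.a_ne_r hF _ _, h.a_ne_q hF _ _, h.a_ne_r hF _ _,
      hinj (by decide), hw21.symm⟩
  · exact ⟨hw02, hr0 _, hq _ _, hr0 _, hw03.1, hww⟩

theorem not_isResonantPattern (hF : IsFullerene G faces) (h : IsCap G p q r a)
    (hH : IsCollar G faces q r a H w v) : ¬ IsResonantPattern G {H 0, H 2} := by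
  rintro ⟨M, hM, halt⟩
  rw [Subgraph.isPerfectMatching_iff] at hM
  have huniq : ∀ {x y z : V}, M.Adj x y → M.Adj x z → y = z := fun hy hz => (hM _).unique hy hz
  have hex : ∀ x, ∃ y, M.Adj x y ∧ G.Adj x y := fun x => by
    obtain ⟨y, hy, -⟩ := hM x
    exact ⟨y, hy, hy.adj_sub⟩
  have nr : ∀ {i j : Fin 5}, i ≠ j → r i ≠ r j := fun hij e => hij (h.r_inj _ _ e)
  have nq : ∀ {i j : Fin 5}, i ≠ j → q i ≠ q j := fun hij e => hij (h.q_inj _ _ e)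
  -- Along an alternating face of the collar the partners of `r i`, `q (i + 1)`, `r (i + 1)` lie
  -- on that face.
  have key : ∀ i, AltFace G M (H i) → ¬ M.Adj (r i) (q i) ∧ ¬ M.Adj (q (i + 1)) (p (i + 1)) ∧
      ¬ M.Adj (r (i + 1)) (q (i + 1 + 1)) := by
    intro i hi
    have hii : i ≠ i + 1 := by grind
    have hfar : i + 1 + 1 ≠ i + 1 := by grind
    refine ⟨fun hm => ?_, fun hm => ?_, fun hm => ?_⟩
    · obtain ⟨u, hu, hMu⟩ := hi (r i) (mem_faceVerts.2 ⟨_, hH.left i⟩)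
      obtain rfl := huniq hm hMu
      rcases hF.eq_or_eq_of_mem (hH.mem i) (h.a_ne_q hF _ _) (hH.left i) (hH.rq i) hu with e | e
      exacts [h.a_ne_q hF _ _ e.symm, nq hii e]
    · obtain ⟨u, hu, hMu⟩ := hi (q (i + 1)) (mem_faceVerts.2 ⟨_, Sym2.eq_swap ▸ hH.rq i⟩)
      obtain rfl := huniq hm hMu
      rcases hF.eq_or_eq_of_mem (hH.mem i) (nr hii) (Sym2.eq_swap ▸ hH.rq i)
        (Sym2.eq_swap ▸ hH.qr i) hu with e | e
      exacts [h.p_ne_r _ _ e, h.p_ne_r _ _ e]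
    · obtain ⟨u, hu, hMu⟩ := hi (r (i + 1)) (mem_faceVerts.2 ⟨_, hH.qr i⟩)
      obtain rfl := huniq hm hMu
      rcases hF.eq_or_eq_of_mem (hH.mem i) (h.a_ne_q hF _ _) (hH.right i) (hH.qr i) hu with e | e
      exacts [h.a_ne_q hF _ _ e.symm, nq hfar e]
  obtain ⟨hr0, hq1, hr1⟩ := key 0 (halt _ (by simp))
  obtain ⟨hr2, hq3, hr3⟩ := key 2 (halt _ (by simp))
  have np : ∀ {i j : Fin 5}, i ≠ j → p i ≠ p j := fun hij e => hij (h.p_inj _ _ e)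
  have hq2 : M.Adj (q 2) (p 2) := by
    obtain ⟨y, hM2, hG⟩ := hex (q 2)
    rcases h.adj_q hF hG with rfl | rfl | rfl
    exacts [hM2, absurd hM2.symm hr2, absurd hM2.symm hr1]
  have hp1 : M.Adj (p 1) (p 0) := by
    obtain ⟨y, hM1, hG⟩ := hex (p 1)
    rcases h.adj_p hF hG with rfl | rfl | rfl
    exacts [absurd (huniq hq2.symm hM1.symm) (h.p_ne_q _ _).symm, hM1, absurd hM1.symm hq1]
  have hp3 : M.Adj (p 3) (p 4) := by
    obtain ⟨y, hM3, hG⟩ := hex (p 3)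
    rcases h.adj_p hF hG with rfl | rfl | rfl
    exacts [hM3, absurd (huniq hq2.symm hM3.symm) (h.p_ne_q _ _).symm, absurd hM3.symm hq3]
  have hq0 : M.Adj (q 0) (r 4) := by
    obtain ⟨y, hM0, hG⟩ := hex (q 0)
    rcases h.adj_q hF hG with rfl | rfl | rfl
    exacts [absurd (huniq hp1.symm hM0.symm) (h.p_ne_q _ _), absurd hM0.symm hr0, hM0]
  obtain ⟨y, hM4, hG⟩ := hex (q 4)
  rcases h.adj_q hF hG with rfl | rfl | rfl
  · exact h.p_ne_q _ _ (huniq hp3.symm hM4.symm)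
  · exact nq (by decide) (huniq hq0.symm hM4.symm)
  · exact hr3 hM4.symm

/-- A collar with hexagons at distance two contains a nonresonant pair of disjoint hexagons. -/
theorem exists_nonresonant (hF : IsFullerene G faces) (hne : Fintype.card V ≠ 20)
    (h : IsCap G p q r a) (hH : IsCollar G faces q r a H w v) (h0 : (H 0).card = 6)
    (h2 : (H 2).card = 6) :
    ∃ h1 ∈ faces, ∃ h2 ∈ faces, h1.card = 6 ∧ h2.card = 6 ∧ h1 ≠ h2 ∧
      Disjoint (faceVerts h1) (faceVerts h2) ∧ ¬ IsResonantPattern G {h1, h2} := by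
  have hdisj := hH.disjoint_of_card_eq_six hF hne h h0 h2
  refine ⟨H 0, hH.mem 0, H 2, hH.mem 2, h0, h2, fun e => ?_, hdisj, hH.not_isResonantPattern hF h⟩
  have hm : a 0 ∈ faceVerts (H 0) := mem_faceVerts.2 ⟨_, hH.aw 0⟩
  exact Set.disjoint_left.1 hdisj hm (e ▸ hm)

end IsCollar

theorem exists_add_two_or_consecutive (P : Fin 5 → Bool) :
    (∃ i, P i ∧ P (2 + i)) ∨ ∃ j, ∀ i, P i → i = j ∨ i = j + 1 := by
  revert P
  decide

end Cap

/-- a fullerene graph other than the dodecahedron `F₂₀` (the unique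
fullerene on 20 vertices) containing `R₅` as a subgraph is not 2-resonant: some two
disjoint hexagonal faces do not form a resonant pattern. -/
theorem not_two_resonant_of_R5 {V : Type*} [Fintype V] [DecidableEq V]
    (G : SimpleGraph V) (faces : Finset (Finset (Sym2 V)))
    (hF : IsFullerene G faces)
    (hne : Fintype.card V ≠ 20)
    (φ : Fin 15 → V) (hinj : Function.Injective φ)
    (hemb : ∀ i j : Fin 15, R5.Adj i j → G.Adj (φ i) (φ j)) :
    ∃ h1 ∈ faces, ∃ h2 ∈ faces, h1.card = 6 ∧ h2.card = 6 ∧ h1 ≠ h2 ∧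
      Disjoint (faceVerts h1) (faceVerts h2) ∧
      ¬ IsResonantPattern G {h1, h2} := by
  set P : Fin 5 → Fin 15 := ![0, 1, 2, 3, 4]
  set Q : Fin 5 → Fin 15 := ![5, 7, 9, 11, 13]
  set R : Fin 5 → Fin 15 := ![6, 8, 10, 12, 14]
  have hqr : ∀ i, G.Adj (φ (Q i)) (φ (R i)) := fun i => hemb _ _ (by
    fin_cases i <;> simp [R5, Q, R])
  have hrq : ∀ i, G.Adj (φ (R i)) (φ (Q (i + 1))) := fun i => hemb _ _ (by
    fin_cases i <;> simp [R5, Q, R])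
  have hQ : ∀ i, Q i ≠ Q (i + 1) := by decide
  choose a haq haq' ha using fun i =>
    hF.exists_third (hinj.ne (hQ i)) (hqr i).symm (hrq i)
  have h : IsCap G (φ ∘ P) (φ ∘ Q) (φ ∘ R) a :=
    { pp := fun i => hemb _ _ (by fin_cases i <;> simp [R5, P])
      pq := fun i => hemb _ _ (by fin_cases i <;> simp [R5, P, Q])
      qr := hqr
      rq := hrq
      ra := fun i => (ha i _).2 (Or.inr (Or.inr rfl))
      p_inj := fun i j e => (by decide : ∀ i j, P i = P j → i = j) i j (hinj e)
      q_inj := fun i j e => (by decide : ∀ i j, Q i = Q j → i = j) i j (hinj e)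
      r_inj := fun i j e => (by decide : ∀ i j, R i = R j → i = j) i j (hinj e)
      p_ne_q := fun i j => hinj.ne ((by decide : ∀ i j, P i ≠ Q j) i j)
      p_ne_r := fun i j => hinj.ne ((by decide : ∀ i j, P i ≠ R j) i j)
      q_ne_r := fun i j => hinj.ne ((by decide : ∀ i j, Q i ≠ R j) i j)
      a_ne_left := haq
      a_ne_right := haq' }
  obtain ⟨H, w, v, hH⟩ := h.exists_collar hF
  rcases exists_add_two_or_consecutive fun i => (H i).card = 6 with ⟨i, h0, h2⟩ | ⟨j, hj⟩
  · exact (hH.rotate i).exists_nonresonant hF hne (h.rotate i)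
      (by simpa using h0) (by simpa using h2)
  · exact absurd (hH.card_eq_of_forall hF h (j := j) fun i hi => hj i (by simpa using hi)) hne
end

section
/- Let F be a fullerene graph other than F_24 that contains R_6 (the ring of six pentagons around a central hexagon) as a subgraph. Then F is not 2-resonant. -/
open SimpleGraph

/-- The graph `R₆`: a central hexagon (vertices `0..5`) surrounded by a ring of six
pentagons (outer ring `6..17`); the fullerene `F₂₄` minus the vertices of one
hexagonal face. -/
def R6 : SimpleGraph (Fin 18) :=
  SimpleGraph.fromEdgeSet {s(0, 1), s(0, 5), s(0, 6), s(1, 2), s(1, 8), s(2, 3),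
    s(2, 10), s(3, 4), s(3, 12), s(4, 5), s(4, 14), s(5, 16), s(6, 7), s(6, 17),
    s(7, 8), s(8, 9), s(9, 10), s(10, 11), s(11, 12), s(12, 13), s(13, 14),
    s(14, 15), s(15, 16), s(16, 17)}


namespace Fullerene

/-- Every vertex is incident with an even number of edges of `C`. -/
def EvenEdges {V : Type*} [DecidableEq V] (C : Finset (Sym2 V)) : Prop :=
  ∀ v, Even (C.filter (v ∈ ·)).card

section Local

variable {V : Type*} [DecidableEq V] {G : SimpleGraph V}

lemma evenEdges_of_isCycle {v : V} {c : G.Walk v v} (hc : c.IsCycle) :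
    EvenEdges c.edges.toFinset := by
  intro x
  have h := (hc.isTrail.even_countP_edges_iff x).2 (fun h => absurd rfl h)
  rw [List.countP_eq_length_filter] at h
  rw [← List.toFinset_card_of_nodup (hc.edges_nodup.filter _)] at h
  simpa [List.toFinset_filter] using h

lemma EvenEdges.eq_of_subset {C f : Finset (Sym2 V)} (hC : EvenEdges C) (hf : EvenEdges f)
    (hsub : C ⊆ f) (hcard : f.card ≤ C.card + 1) : f = C := by
  by_contra hne
  have hlt : C ⊂ f := hsub.ssubset_of_ne (Ne.symm hne)
  have h1 : (f \ C).card = 1 := by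
    have := Finset.card_lt_card hlt
    rw [Finset.card_sdiff_of_subset hsub]
    omega
  obtain ⟨e, he⟩ := Finset.card_eq_one.1 h1
  have hfe : f = insert e C := by
    rw [← Finset.sdiff_union_of_subset hsub, he]
    rfl
  have heC : e ∉ C := by
    have : e ∈ f \ C := by simp [he]
    exact (Finset.mem_sdiff.1 this).2
  induction e using Sym2.ind with
  | _ u w =>
    have h2 := hf u
    have h3 := hC u
    rw [hfe, Finset.filter_insert, if_pos (Sym2.mem_mk_left u w),
      Finset.card_insert_of_notMem (by simp [heC])] at h2
    grind

lemma finrank_le_one_of_forall_eq {ι K : Type*} [Finite ι] [Field K] {W : Submodule K (ι → K)}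
    (h : ∀ x ∈ W, ∀ i j, x i = x j) : Module.finrank K W ≤ 1 := by
  have hle : W ≤ Submodule.span K {fun _ => 1} := by
    intro x hx
    rw [Submodule.mem_span_singleton]
    rcases isEmpty_or_nonempty ι with hι | ⟨⟨i⟩⟩
    · exact ⟨0, Subsingleton.elim _ _⟩
    · exact ⟨x i, funext fun j => by simp [h x hx i j]⟩
  exact (Submodule.finrank_mono hle).trans
    ((finrank_span_le_card _).trans (by simp))

lemma sum_incident_eq_zero {C : Finset (Sym2 V)} (hsub : ∀ e ∈ C, e ∈ G.edgeSet)
    (hC : EvenEdges C) [Fintype G.edgeSet] (v : V) :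
    ∑ e : G.edgeSet, (if v ∈ e.1 then (1 : ZMod 2) else 0) * (if e.1 ∈ C then 1 else 0) = 0 := by
  have h : ∑ e : G.edgeSet, (if v ∈ e.1 then (1 : ZMod 2) else 0) * (if e.1 ∈ C then 1 else 0) =
      ∑ e ∈ C.filter (v ∈ ·), (1 : ZMod 2) := by
    rw [Finset.sum_set_coe (f := fun e => (if v ∈ e then (1 : ZMod 2) else 0) *
      (if e ∈ C then 1 else 0))]
    simp only [← ite_and, mul_ite, mul_one, mul_zero]
    rw [← Finset.sum_filter]
    congr 1
    ext e
    simp only [Finset.mem_filter, Set.mem_toFinset]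
    exact ⟨fun h => h.2, fun h => ⟨hsub e h.1, h⟩⟩
  rw [h, Finset.sum_const, nsmul_eq_mul, mul_one]
  exact (ZMod.natCast_eq_zero_iff_even).2 (hC v)

end Local

section Faces

variable {V : Type*} [Fintype V] [DecidableEq V] {G : SimpleGraph V}
  {faces : Finset (Finset (Sym2 V))}

lemma connected (hF : IsFullerene G faces) : G.Connected := by
  have h := hF.threeConnected ∅ (by simp)
  rw [Set.compl_empty] at h
  exact (induceUnivIso G).connected_iff.1 h

lemma forall_of_adj_closed (hF : IsFullerene G faces) {p : V → Prop} {v : V} (hv : p v)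
    (h : ∀ u w, G.Adj u w → p u → p w) (w : V) : p w := by
  obtain ⟨q⟩ := (connected hF).preconnected v w
  induction q with
  | nil => exact hv
  | cons hadj _ ih => exact ih (h _ _ hadj hv)

lemma eq_of_adj (hF : IsFullerene G faces) {v x y z w : V} (hx : G.Adj v x) (hy : G.Adj v y)
    (hz : G.Adj v z) (hxy : x ≠ y) (hxz : x ≠ z) (hyz : y ≠ z) (hw : G.Adj v w) :
    w = x ∨ w = y ∨ w = z := by
  have hsub : (({x, y, z} : Finset V) : Set V) ⊆ G.neighborSet v := by
    intro a ha
    simp only [Finset.coe_insert, Finset.coe_singleton, Set.mem_insert_iff,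
      Set.mem_singleton_iff] at ha
    rcases ha with rfl | rfl | rfl <;> assumption
  have heq := Set.eq_of_subset_of_ncard_le hsub (by
    rw [hF.cubic v, Set.ncard_coe_finset, Finset.card_eq_three.2 ⟨x, y, z, hxy, hxz, hyz, rfl⟩])
    (Set.toFinite _)
  have : w ∈ G.neighborSet v := hw
  rw [← heq] at this
  simpa using this

lemma exists_third (hF : IsFullerene G faces) (v x y : V) :
    ∃ z, G.Adj v z ∧ x ≠ z ∧ y ≠ z := by
  by_contra! h
  have hsub : G.neighborSet v ⊆ {x, y} := by
    intro z hz
    by_contra hz'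
    simp only [Set.mem_insert_iff, Set.mem_singleton_iff, not_or] at hz'
    exact hz'.2 (h z hz (Ne.symm hz'.1)).symm
  have h1 := Set.ncard_le_ncard hsub (Set.toFinite _)
  have h2 := Set.ncard_insert_le x {y}
  rw [hF.cubic v] at h1
  rw [Set.ncard_singleton] at h2
  omega

lemma evenEdges_of_mem (hF : IsFullerene G faces) {f : Finset (Sym2 V)} (hf : f ∈ faces) :
    EvenEdges f := by
  obtain ⟨v, c, hc, rfl⟩ := hF.face_cycle f hf
  exact evenEdges_of_isCycle hc

lemma adj_of_mem (hF : IsFullerene G faces) {f : Finset (Sym2 V)} (hf : f ∈ faces) {u v : V}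
    (h : s(u, v) ∈ f) : G.Adj u v := by
  obtain ⟨v, c, hc, rfl⟩ := hF.face_cycle f hf
  exact c.edges_subset_edgeSet (List.mem_toFinset.1 h)

/-- A face through an edge at a cubic vertex uses exactly one of the two other edges. -/
lemma mem_iff_notMem (hF : IsFullerene G faces) {f : Finset (Sym2 V)} (hf : f ∈ faces)
    {v x y z : V} (hx : G.Adj v x) (hy : G.Adj v y) (hz : G.Adj v z) (hxy : x ≠ y) (hxz : x ≠ z)
    (hyz : y ≠ z) (hmem : s(v, x) ∈ f) : s(v, y) ∈ f ↔ s(v, z) ∉ f := by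
  have h1 : f.filter (v ∈ ·) =
      ({s(v, x), s(v, y), s(v, z)} : Finset (Sym2 V)).filter (· ∈ f) := by
    ext e
    simp only [Finset.mem_filter, Finset.mem_insert, Finset.mem_singleton]
    constructor
    · rintro ⟨he, w, rfl⟩
      rcases eq_of_adj hF hx hy hz hxy hxz hyz (adj_of_mem hF hf he) with rfl | rfl | rfl <;>
        simp [he]
    · rintro ⟨rfl | rfl | rfl, he⟩ <;> simp [he]
  have h2 := evenEdges_of_mem hF hf v
  rw [h1] at h2
  have d1 : s(v, x) ≠ s(v, y) := mt Sym2.congr_right.1 hxy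
  have d2 : s(v, x) ≠ s(v, z) := mt Sym2.congr_right.1 hxz
  have d3 : s(v, y) ≠ s(v, z) := mt Sym2.congr_right.1 hyz
  by_cases hy' : s(v, y) ∈ f <;> by_cases hz' : s(v, z) ∈ f <;>
    simp_all [Finset.filter_insert, Finset.filter_singleton]
  exact absurd h2 (by decide)

lemma exists_two_faces (hF : IsFullerene G faces) {u v : V} (h : G.Adj u v) :
    ∃ f g, f ∈ faces ∧ g ∈ faces ∧ f ≠ g ∧ s(u, v) ∈ f ∧ s(u, v) ∈ g ∧
      faces.filter (fun f => s(u, v) ∈ f) = {f, g} := by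
  obtain ⟨f, g, hne, heq⟩ := Finset.card_eq_two.1 (hF.edge_two_faces s(u, v) h)
  have hf : f ∈ faces.filter (fun f => s(u, v) ∈ f) := by simp [heq]
  have hg : g ∈ faces.filter (fun f => s(u, v) ∈ f) := by simp [heq]
  rw [Finset.mem_filter] at hf hg
  exact ⟨f, g, hf.1, hg.1, hne, hf.2, hg.2, heq⟩

lemma eq_or_eq_of_mem (hF : IsFullerene G faces) {f g q : Finset (Sym2 V)} {e : Sym2 V}
    (hf : f ∈ faces) (hg : g ∈ faces) (hq : q ∈ faces) (hef : e ∈ f) (heg : e ∈ g) (heq : e ∈ q)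
    (hne : f ≠ g) : q = f ∨ q = g := by
  induction e using Sym2.ind with
  | _ u v =>
    obtain ⟨f', g', -, -, -, -, -, h⟩ := exists_two_faces hF (adj_of_mem hF hf hef)
    have key : ∀ r ∈ faces, s(u, v) ∈ r → r = f' ∨ r = g' := by
      intro r hr her
      have : r ∈ faces.filter (fun f => s(u, v) ∈ f) := Finset.mem_filter.2 ⟨hr, her⟩
      simpa [h] using this
    grind

/-- Two consecutive edges lie on at most one common face. -/
lemma eq_of_corner (hF : IsFullerene G faces) {f g : Finset (Sym2 V)} (hf : f ∈ faces)
    (hg : g ∈ faces) {v x y : V} (hxy : x ≠ y) (hxf : s(v, x) ∈ f) (hyf : s(v, y) ∈ f)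
    (hxg : s(v, x) ∈ g) (hyg : s(v, y) ∈ g) : f = g := by
  by_contra hne
  have hx := adj_of_mem hF hf hxf
  have hy := adj_of_mem hF hf hyf
  obtain ⟨z, hz, hxz, hyz⟩ := exists_third hF v x y
  obtain ⟨q, -, hq, -, -, hzq, -⟩ := exists_two_faces hF hz
  have h1 := mem_iff_notMem hF hq hz hx hy hxz.symm hyz.symm hxy hzq
  have h2 := mem_iff_notMem hF hf hx hy hz hxy hxz hyz hxf
  have h3 := mem_iff_notMem hF hg hx hy hz hxy hxz hyz hxg
  by_cases hxq : s(v, x) ∈ q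
  · rcases eq_or_eq_of_mem hF hf hg hq hxf hxg hxq hne with rfl | rfl <;> tauto
  · have hyq : s(v, y) ∈ q := by tauto
    rcases eq_or_eq_of_mem hF hf hg hq hyf hyg hyq hne with rfl | rfl <;> tauto

lemma exists_corner (hF : IsFullerene G faces) {v x y : V} (hx : G.Adj v x) (hy : G.Adj v y)
    (hxy : x ≠ y) : ∃ f ∈ faces, s(v, x) ∈ f ∧ s(v, y) ∈ f := by
  obtain ⟨z, hz, hxz, hyz⟩ := exists_third hF v x y
  obtain ⟨f, g, hf, hg, hne, hxf, hxg, -⟩ := exists_two_faces hF hx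
  have h2 := mem_iff_notMem hF hf hx hy hz hxy hxz hyz hxf
  have h3 := mem_iff_notMem hF hg hx hy hz hxy hxz hyz hxg
  by_cases hzf : s(v, z) ∈ f
  · by_cases hzg : s(v, z) ∈ g
    · exact absurd (eq_of_corner hF hf hg hxz hxf hzf hxg hzg) hne
    · exact ⟨g, hg, hxg, h3.2 hzg⟩
  · exact ⟨f, hf, hxf, h2.2 hzf⟩

/-- Two faces through a common vertex share an edge at that vertex. -/
lemma exists_common_edge (hF : IsFullerene G faces) {f g : Finset (Sym2 V)} (hf : f ∈ faces)
    (hg : g ∈ faces) {v x y : V} (hx : s(v, x) ∈ f) (hy : s(v, y) ∈ g) :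
    ∃ w, s(v, w) ∈ f ∧ s(v, w) ∈ g := by
  have hvx := adj_of_mem hF hf hx
  have hvy := adj_of_mem hF hg hy
  by_cases hxy : x = y
  · exact ⟨x, hx, hxy ▸ hy⟩
  · obtain ⟨z, hz, hxz, hyz⟩ := exists_third hF v x y
    have h1 := mem_iff_notMem hF hf hvx hvy hz hxy hxz hyz hx
    have h2 := mem_iff_notMem hF hg hvy hvx hz (Ne.symm hxy) hyz hxz hy
    by_cases hyf : s(v, y) ∈ f
    · exact ⟨y, hyf, hy⟩
    · by_cases hxg : s(v, x) ∈ g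
      · exact ⟨x, hx, hxg⟩
      · exact ⟨z, by tauto, by tauto⟩

/-- A function on the faces that agrees on faces sharing an edge is constant. -/
lemma eq_of_forall_shared_edge (hF : IsFullerene G faces) {α : Type*} {x : Finset (Sym2 V) → α}
    (h : ∀ e, ∀ f ∈ faces, ∀ g ∈ faces, e ∈ f → e ∈ g → x f = x g)
    {f g : Finset (Sym2 V)} (hf : f ∈ faces) (hg : g ∈ faces) : x f = x g := by
  have hmem : ∀ f ∈ faces, ∃ u v, s(u, v) ∈ f := by
    intro f hf
    have : f.Nonempty := Finset.card_pos.1 (by rcases hF.face_size f hf with h | h <;> omega)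
    obtain ⟨e, he⟩ := this
    induction e using Sym2.ind with
    | _ u v => exact ⟨u, v, he⟩
  obtain ⟨u, v, huv⟩ := hmem f hf
  obtain ⟨u', v', huv'⟩ := hmem g hg
  refine (forall_of_adj_closed hF (p := fun u => ∀ q ∈ faces, ∀ w, s(u, w) ∈ q → x f = x q)
    (v := u) ?_ ?_ u') g hg v' huv'
  · intro q hq w hw
    obtain ⟨y, hy1, hy2⟩ := exists_common_edge hF hf hq huv hw
    exact h _ f hf q hq hy1 hy2
  · intro a b hab ha q hq w hw
    obtain ⟨r, -, hr, -, -, hr', -⟩ := exists_two_faces hF hab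
    obtain ⟨y, hy1, hy2⟩ := exists_common_edge hF hr hq (Sym2.eq_swap ▸ hr' : s(b, a) ∈ r) hw
    rw [ha r hr b hr', h _ r hr q hq hy1 hy2]

/-- The Jordan curve property: every even edge set bounds a set of faces modulo two. -/
lemma exists_boundary (hF : IsFullerene G faces) {C : Finset (Sym2 V)}
    (hsub : ∀ e ∈ C, e ∈ G.edgeSet) (hC : EvenEdges C) :
    ∃ x : Finset (Sym2 V) → ZMod 2, ∀ f ∈ faces, ∀ g ∈ faces, f ≠ g →
      ∀ e ∈ f, e ∈ g → x f + x g = if e ∈ C then 1 else 0 := by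
  classical
  let D : Matrix V G.edgeSet (ZMod 2) := fun v e => if v ∈ e.1 then 1 else 0
  let B : Matrix G.edgeSet faces (ZMod 2) := fun e f => if e.1 ∈ f.1 then 1 else 0
  have hedge : ∀ f ∈ faces, ∀ e ∈ f, e ∈ G.edgeSet := by
    intro f hf e he
    induction e using Sym2.ind with
    | _ a b => exact adj_of_mem hF hf he
  have hBval : ∀ (x : faces → ZMod 2) (f g : faces), f ≠ g → ∀ e : G.edgeSet, e.1 ∈ f.1 →
      e.1 ∈ g.1 → B.mulVec x e = x f + x g := by
    intro x f g hne e hef heg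
    rw [← Finset.sum_pair hne]
    simp only [Matrix.mulVec, dotProduct, B, ite_mul, one_mul, zero_mul]
    rw [← Finset.sum_filter]
    congr 1
    ext q
    simp only [Finset.mem_filter, Finset.mem_univ, true_and, Finset.mem_insert,
      Finset.mem_singleton]
    constructor
    · intro hq
      rcases eq_or_eq_of_mem hF f.2 g.2 q.2 hef heg hq (fun h => hne (Subtype.ext h)) with h | h
      · exact Or.inl (Subtype.ext h)
      · exact Or.inr (Subtype.ext h)
    · rintro (rfl | rfl) <;> assumption
  have hle : LinearMap.range B.mulVecLin ≤ LinearMap.ker D.mulVecLin := by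
    rintro _ ⟨x, rfl⟩
    have hDB : D * B = 0 := by
      ext v f
      simp only [D, B, Matrix.zero_apply]
      exact sum_incident_eq_zero (hedge f.1 f.2) (evenEdges_of_mem hF f.2) v
    simp [hDB]
  have hkerB : Module.finrank (ZMod 2) (LinearMap.ker B.mulVecLin) ≤ 1 := by
    refine finrank_le_one_of_forall_eq fun x hx i j => ?_
    have hshared : ∀ e, ∀ f, ∀ hf : f ∈ faces, ∀ g, ∀ hg : g ∈ faces, e ∈ f → e ∈ g →
        x ⟨f, hf⟩ = x ⟨g, hg⟩ := by
      intro e f hf g hg hef heg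
      by_cases hne : f = g
      · subst hne
        rfl
      · have h := hBval x ⟨f, hf⟩ ⟨g, hg⟩ (by simpa using hne) ⟨e, hedge f hf e hef⟩ hef heg
        have h0 : B.mulVec x ⟨e, hedge f hf e hef⟩ = 0 := congrFun hx _
        rw [h0] at h
        exact CharTwo.add_eq_zero.1 h.symm
    have := eq_of_forall_shared_edge hF (x := fun f => if h : f ∈ faces then x ⟨f, h⟩ else 0)
      (fun e f hf g hg hef heg => by simpa [hf, hg] using hshared e f hf g hg hef heg) i.2 j.2
    simpa using this
  have hkerD : Module.finrank (ZMod 2) (LinearMap.ker D.transpose.mulVecLin) ≤ 1 := by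
    refine finrank_le_one_of_forall_eq fun y hy i j => ?_
    refine forall_of_adj_closed hF (p := fun w => y i = y w) (v := i) rfl ?_ j
    intro u w huw hu
    have h0 : D.transpose.mulVec y ⟨s(u, w), huw⟩ = 0 := congrFun hy _
    have h1 : D.transpose.mulVec y ⟨s(u, w), huw⟩ = y u + y w := by
      rw [← Finset.sum_pair huw.ne]
      simp only [Matrix.mulVec, dotProduct, Matrix.transpose_apply]
      simp only [D, ite_mul, one_mul, zero_mul]
      rw [← Finset.sum_filter]
      congr 1
      ext q
      simp
    rw [h1] at h0
    exact hu.trans (CharTwo.add_eq_zero.1 h0)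
  have h1 := B.mulVecLin.finrank_range_add_finrank_ker
  have h2 := D.mulVecLin.finrank_range_add_finrank_ker
  have h3 := D.transpose.mulVecLin.finrank_range_add_finrank_ker
  have h4 : Module.finrank (ZMod 2) (LinearMap.range D.transpose.mulVecLin) =
    Module.finrank (ZMod 2) (LinearMap.range D.mulVecLin) := D.rank_transpose
  have h5 := hF.euler
  rw [← Nat.card_coe_set_eq, Nat.card_eq_fintype_card] at h5
  simp only [Module.finrank_fintype_fun_eq_card, Fintype.card_coe] at h1 h2 h3
  have heq := Submodule.eq_of_le_of_finrank_le hle (by omega)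
  have hy : (fun e : G.edgeSet => if e.1 ∈ C then (1 : ZMod 2) else 0) ∈
      LinearMap.ker D.mulVecLin := by
    ext v
    exact sum_incident_eq_zero hsub hC v
  rw [← heq] at hy
  obtain ⟨x, hx⟩ := hy
  refine ⟨fun f => if h : f ∈ faces then x ⟨f, h⟩ else 0, ?_⟩
  intro f hf g hg hne e hef heg
  have := hBval x ⟨f, hf⟩ ⟨g, hg⟩ (by simpa using hne) ⟨e, hedge f hf e hef⟩ hef heg
  simp only [dif_pos hf, dif_pos hg]
  rw [← this]
  exact congrFun hx ⟨e, hedge f hf e hef⟩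

/-- An edge of an even edge set `C` lies on a face that avoids every vertex joined to `r`
by a path off `C`. -/
lemma exists_face_avoiding (hF : IsFullerene G faces) {C : Finset (Sym2 V)}
    (hsub : ∀ e ∈ C, e ∈ G.edgeSet) (hC : EvenEdges C) {u v : V} (huv : s(u, v) ∈ C) {r : V}
    (hr : ∀ w, s(r, w) ∉ C) :
    ∃ f ∈ faces, s(u, v) ∈ f ∧
      ∀ w, Relation.ReflTransGen (fun a b => G.Adj a b ∧ ∀ z, s(b, z) ∉ C) r w →
        ∀ z, s(w, z) ∉ f := by
  obtain ⟨x, hx⟩ := exists_boundary hF hsub hC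
  have hside : ∀ w, (∀ z, s(w, z) ∉ C) → ∀ f ∈ faces, ∀ g ∈ faces, ∀ y z, s(w, y) ∈ f →
      s(w, z) ∈ g → x f = x g := by
    intro w hw f hf g hg y z hy hz
    by_cases hne : f = g
    · rw [hne]
    · obtain ⟨q, hqf, hqg⟩ := exists_common_edge hF hf hg hy hz
      have := hx f hf g hg hne _ hqf hqg
      rw [if_neg (hw q)] at this
      exact CharTwo.add_eq_zero.1 this
  obtain ⟨r', hr', -⟩ := exists_third hF r r r
  obtain ⟨f₀, -, hf₀, -, -, hrf₀, -⟩ := exists_two_faces hF hr'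
  have hreach : ∀ w, Relation.ReflTransGen (fun a b => G.Adj a b ∧ ∀ z, s(b, z) ∉ C) r w →
      ∀ f ∈ faces, ∀ z, s(w, z) ∈ f → x f = x f₀ := by
    intro w hw
    induction hw with
    | refl => exact fun f hf z hz => hside r hr f hf f₀ hf₀ z r' hz hrf₀
    | tail _ hab ih =>
      intro f hf z hz
      obtain ⟨g, -, hg, -, -, hgab, -⟩ := exists_two_faces hF hab.1
      rw [← ih g hg _ hgab]
      exact hside _ hab.2 f hf g hg z _ hz (Sym2.eq_swap ▸ hgab)
  obtain ⟨f, g, hf, hg, hne, huf, hug, -⟩ := exists_two_faces hF (hsub _ huv)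
  have hfg := hx f hf g hg hne _ huf hug
  rw [if_pos huv] at hfg
  by_cases hxf : x f = x f₀
  · refine ⟨g, hg, hug, fun w hw z hz => ?_⟩
    rw [hxf, hreach w hw g hg z hz, CharTwo.add_self_eq_zero] at hfg
    exact zero_ne_one hfg
  · exact ⟨f, hf, huf, fun w hw z hz => hxf (hreach w hw f hf z hz)⟩

lemma mem_of_avoiding (hF : IsFullerene G faces) {f : Finset (Sym2 V)} (hf : f ∈ faces)
    {v x y z : V} (hx : s(x, v) ∈ f) (hy : G.Adj v y) (hz : G.Adj v z) (hxy : x ≠ y)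
    (hxz : x ≠ z) (hyz : y ≠ z) (havoid : ∀ w, s(z, w) ∉ f) : s(v, y) ∈ f := by
  refine (mem_iff_notMem hF hf (adj_of_mem hF hf hx).symm hy hz hxy hxz hyz
    (Sym2.eq_swap ▸ hx)).2 ?_
  rw [Sym2.eq_swap]
  exact havoid v

/-- A cycle of length at least five whose edges all lie on a face is that face. -/
lemma IsCycle.edges_mem_faces (hF : IsFullerene G faces) {v : V} {c : G.Walk v v}
    (hc : c.IsCycle) (hlen : 5 ≤ c.length) {f : Finset (Sym2 V)} (hf : f ∈ faces)
    (hsub : c.edges.toFinset ⊆ f) : c.edges.toFinset ∈ faces := by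
  have hcard : c.edges.toFinset.card = c.length := by
    rw [List.toFinset_card_of_nodup hc.edges_nodup, Walk.length_edges]
  rw [← (evenEdges_of_isCycle hc).eq_of_subset (evenEdges_of_mem hF hf) hsub]
  · exact hf
  · rcases hF.face_size f hf with h | h <;> omega

lemma two_of_three (hF : IsFullerene G faces) {f : Finset (Sym2 V)} (hf : f ∈ faces)
    {v w x y z : V} (hw : s(v, w) ∈ f) (hx : G.Adj v x) (hy : G.Adj v y) (hz : G.Adj v z)
    (hxy : x ≠ y) (hxz : x ≠ z) (hyz : y ≠ z) :
    (s(v, x) ∈ f ∧ s(v, y) ∈ f) ∨ (s(v, x) ∈ f ∧ s(v, z) ∈ f) ∨ (s(v, y) ∈ f ∧ s(v, z) ∈ f) := by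
  have h1 := mem_iff_notMem hF hf hx hy hz hxy hxz hyz
  have h2 := mem_iff_notMem hF hf hy hx hz hxy.symm hyz hxz
  have h3 := mem_iff_notMem hF hf hz hx hy hxz.symm hyz.symm hxy
  rcases eq_of_adj hF hx hy hz hxy hxz hyz (adj_of_mem hF hf hw) with rfl | rfl | rfl <;> tauto

lemma exists_edges_of_card_five (hF : IsFullerene G faces) {f : Finset (Sym2 V)} (hf : f ∈ faces)
    (hcard : f.card = 5) {p x : V} (hpx : s(p, x) ∈ f) :
    ∃ q r s t, f = {s(p, q), s(q, r), s(r, s), s(s, t), s(t, p)} ∧ [p, q, r, s, t].Nodup := by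
  obtain ⟨v, c, hc, rfl⟩ := hF.face_cycle f hf
  have hp : p ∈ c.support := c.fst_mem_support_of_mem_edges (List.mem_toFinset.1 hpx)
  have hperm := (c.rotate_edges p hp).perm
  have hcyc := hc.rotate hp
  rw [← List.toFinset_eq_of_perm _ _ hperm] at hcard ⊢
  generalize c.rotate p hp = w at hcyc hcard
  have hlen : w.length = 5 := by
    rw [← w.length_edges, ← List.toFinset_card_of_nodup hcyc.edges_nodup, hcard]
  match w, hlen with
  | .cons (v := q) _ (.cons (v := r) _ (.cons (v := s) _ (.cons (v := t) _ (.cons _ .nil)))), _ =>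
    refine ⟨q, r, s, t, by simp, ?_⟩
    have := hcyc.support_nodup
    simp only [Walk.support_cons, Walk.support_nil, List.tail_cons] at this
    grind

/-- In a pentagonal face, the far neighbours of the two neighbours of a vertex are adjacent. -/
lemma adj_of_card_five (hF : IsFullerene G faces) {f : Finset (Sym2 V)} (hf : f ∈ faces)
    (hcard : f.card = 5) {p x y x' y' : V} (hx : s(p, x) ∈ f) (hy : s(p, y) ∈ f) (hxy : x ≠ y)
    (hx' : s(x, x') ∈ f) (hy' : s(y, y') ∈ f) (hxp : x' ≠ p) (hyp : y' ≠ p) : G.Adj x' y' := by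
  refine adj_of_mem hF hf ?_
  obtain ⟨q, r, s, t, rfl, hnodup⟩ := exists_edges_of_card_five hF hf hcard hx
  simp only [Finset.mem_insert, Finset.mem_singleton, Sym2.eq_iff] at hx hy hx' hy' ⊢
  simp only [List.nodup_cons, List.mem_cons] at hnodup
  grind

end Faces

/-- A hexagon `a` surrounded by a ring of six pentagons: `b i` is the neighbour of `a i` on the
ring, and `c i` is the ring vertex between `b i` and `b (i + 1)`. -/
structure PentagonRing {V : Type*} (G : SimpleGraph V) (a b c : Fin 6 → V) : Prop where
  adj_aa : ∀ i, G.Adj (a i) (a (i + 1))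
  adj_ab : ∀ i, G.Adj (a i) (b i)
  adj_bc : ∀ i, G.Adj (b i) (c i)
  adj_cb : ∀ i, G.Adj (c i) (b (i + 1))
  a_inj : Function.Injective a
  b_inj : Function.Injective b
  c_inj : Function.Injective c
  a_ne_b : ∀ i j, a i ≠ b j
  a_ne_c : ∀ i j, a i ≠ c j
  b_ne_c : ∀ i j, b i ≠ c j

namespace PentagonRing

variable {V : Type*} [DecidableEq V] {G : SimpleGraph V}
  {faces : Finset (Finset (Sym2 V))} {a b c : Fin 6 → V}

lemma shift {V : Type*} {G : SimpleGraph V} {a b c : Fin 6 → V} (h : PentagonRing G a b c)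
    (k : Fin 6) :
    PentagonRing G (fun i => a (i + k)) (fun i => b (i + k)) (fun i => c (i + k)) where
  adj_aa i := by simpa only [add_right_comm] using h.adj_aa (i + k)
  adj_ab i := h.adj_ab (i + k)
  adj_bc i := h.adj_bc (i + k)
  adj_cb i := by simpa only [add_right_comm] using h.adj_cb (i + k)
  a_inj := h.a_inj.comp (add_left_injective k)
  b_inj := h.b_inj.comp (add_left_injective k)
  c_inj := h.c_inj.comp (add_left_injective k)
  a_ne_b _ _ := h.a_ne_b _ _
  a_ne_c _ _ := h.a_ne_c _ _
  b_ne_c _ _ := h.b_ne_c _ _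

/-- The edges of the central hexagon. -/
def hexagon (a : Fin 6 → V) : Finset (Sym2 V) :=
  {s(a 0, a 1), s(a 1, a 2), s(a 2, a 3), s(a 3, a 4), s(a 4, a 5), s(a 5, a 0)}

/-- The edges of the pentagon on the edge from `a i` to `a (i + 1)`. -/
def pentagon (a b c : Fin 6 → V) (i : Fin 6) : Finset (Sym2 V) :=
  {s(a i, a (i + 1)), s(a (i + 1), b (i + 1)), s(b (i + 1), c i), s(c i, b i), s(b i, a i)}

lemma card_hexagon (h : PentagonRing G a b c) : (hexagon a).card = 6 := by
  have : hexagon a = Finset.univ.image (fun i : Fin 6 => s(a i, a (i + 1))) := by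
    ext e
    simp [hexagon, Fin.exists_fin_succ, eq_comm]
  rw [this, Finset.card_image_of_injective, Finset.card_fin]
  intro i j hij
  simp only [Sym2.eq_iff, h.a_inj.eq_iff] at hij
  revert i j
  decide

lemma edge_mem_hexagon (a : Fin 6 → V) (i : Fin 6) : s(a i, a (i + 1)) ∈ hexagon a := by
  fin_cases i <;> simp [hexagon]

lemma exists_of_mem_faceVerts_hexagon {v : V} (hv : v ∈ faceVerts (hexagon a)) :
    ∃ i, v = a (i + 1) := by
  obtain ⟨e, he, hve⟩ := hv
  have key : ∃ i, v = a i := by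
    simp only [hexagon, Finset.mem_insert, Finset.mem_singleton] at he
    rcases he with rfl | rfl | rfl | rfl | rfl | rfl <;>
      rcases Sym2.mem_iff.1 hve with rfl | rfl <;> exact ⟨_, rfl⟩
  obtain ⟨i, rfl⟩ := key
  exact ⟨i - 1, by rw [sub_add_cancel]⟩

/-- The face across `b (i + 1)` from the central hexagon. -/
structure IsOuterFace (faces : Finset (Finset (Sym2 V))) (b c : Fin 6 → V) (i : Fin 6)
    (g : Finset (Sym2 V)) : Prop where
  mem : g ∈ faces
  left_mem : s(b (i + 1), c i) ∈ g
  right_mem : s(b (i + 1), c (i + 1)) ∈ g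

lemma ne_pentagon {i : Fin 6} {g : Finset (Sym2 V)} (h : PentagonRing G a b c)
    (hg : IsOuterFace faces b c i g) (j : Fin 6) : g ≠ pentagon a b c j := by
  rintro rfl
  have h1 := hg.left_mem
  have h2 := hg.right_mem
  simp [pentagon, h.b_ne_c, (h.a_ne_b _ _).symm, (h.a_ne_c _ _).symm,
    (h.b_ne_c _ _).symm, h.b_inj.eq_iff, h.c_inj.eq_iff] at h1 h2
  grind

lemma ne_hexagon {i : Fin 6} {g : Finset (Sym2 V)} (h : PentagonRing G a b c)
    (hg : IsOuterFace faces b c i g) : g ≠ hexagon a := by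
  rintro rfl
  have h1 := hg.left_mem
  simp [hexagon, (h.a_ne_b _ _).symm, (h.a_ne_c _ _).symm] at h1

variable [Fintype V]

lemma hexagon_mem (hF : IsFullerene G faces) (h : PentagonRing G a b c) :
    hexagon a ∈ faces := by
  have hab := h.a_ne_b
  have hac := h.a_ne_c
  have hba := fun i j => (h.a_ne_b i j).symm
  have hca := fun i j => (h.a_ne_c i j).symm
  let w : G.Walk (a 0) (a 0) := .cons (h.adj_aa 0) (.cons (h.adj_aa 1) (.cons (h.adj_aa 2)
    (.cons (h.adj_aa 3) (.cons (h.adj_aa 4) (.cons (h.adj_aa 5) .nil)))))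
  have hw : w.IsCycle := by
    simp [w, Walk.cons_isCycle_iff, h.a_inj.eq_iff]
  have hwC : w.edges.toFinset = hexagon a := by
    simp [w, hexagon]
  have hsub : ∀ e ∈ hexagon a, e ∈ G.edgeSet := by
    intro e he
    rw [← hwC, List.mem_toFinset] at he
    exact w.edges_subset_edgeSet he
  have hoffb : ∀ i z, s(b i, z) ∉ hexagon a := by
    simp [hexagon, hba]
  have hoffc : ∀ i z, s(c i, z) ∉ hexagon a := by
    simp [hexagon, hca]
  obtain ⟨f, hf, h01, hav⟩ := exists_face_avoiding hF hsub (hwC ▸ evenEdges_of_isCycle hw)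
    (by simp [hexagon] : s(a 0, a 1) ∈ hexagon a) (hoffb 0)
  have hstep : ∀ i, Relation.ReflTransGen
      (fun x y => G.Adj x y ∧ ∀ z, s(y, z) ∉ hexagon a) (b i) (b (i + 1)) := fun i =>
    .tail (.single ⟨h.adj_bc i, hoffc i⟩) ⟨h.adj_cb i, hoffb _⟩
  have hb1 := hstep 0
  have hb2 := hb1.trans (hstep 1)
  have hb3 := hb2.trans (hstep 2)
  have hb4 := hb3.trans (hstep 3)
  have hb5 := hb4.trans (hstep 4)
  have hnext : ∀ i, Relation.ReflTransGen
      (fun x y => G.Adj x y ∧ ∀ z, s(y, z) ∉ hexagon a) (b 0) (b (i + 1)) →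
      s(a i, a (i + 1)) ∈ f → s(a (i + 1), a (i + 1 + 1)) ∈ f := by
    intro i hi hmem
    have hne : ∀ i : Fin 6, i ≠ i + 1 + 1 := by decide
    exact mem_of_avoiding hF hf hmem (h.adj_aa _) (h.adj_ab _) (h.a_inj.ne (hne i)) (hab _ _)
      (hab _ _) (hav _ hi)
  have h12 := hnext 0 hb1 h01
  have h23 := hnext 1 hb2 h12
  have h34 := hnext 2 hb3 h23
  have h45 := hnext 3 hb4 h34
  have h50 := hnext 4 hb5 h45
  rw [← hwC]
  refine IsCycle.edges_mem_faces hF hw (by simp [w]) hf ?_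
  rw [hwC]
  simp only [hexagon, Finset.insert_subset_iff, Finset.singleton_subset_iff]
  exact ⟨h01, h12, h23, h34, h45, h50⟩

lemma pentagon_zero_mem (hF : IsFullerene G faces) (h : PentagonRing G a b c) :
    pentagon a b c 0 ∈ faces := by
  have hab := h.a_ne_b
  have hac := h.a_ne_c
  have hbc := h.b_ne_c
  have hba := fun i j => (h.a_ne_b i j).symm
  have hca := fun i j => (h.a_ne_c i j).symm
  have hcb := fun i j => (h.b_ne_c i j).symm
  let w : G.Walk (a 0) (a 0) := .cons (h.adj_aa 0) (.cons (h.adj_ab 1) (.cons (h.adj_cb 0).symm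
    (.cons (h.adj_bc 0).symm (.cons (h.adj_ab 0).symm .nil))))
  have hw : w.IsCycle := by
    simp [w, Walk.cons_isCycle_iff, h.a_inj.eq_iff, h.b_inj.eq_iff, hab, hac, hbc, hba, hca, hcb]
  have hwC : w.edges.toFinset = pentagon a b c 0 := by
    simp [w, pentagon]
  have hsub : ∀ e ∈ pentagon a b c 0, e ∈ G.edgeSet := by
    intro e he
    rw [← hwC, List.mem_toFinset] at he
    exact w.edges_subset_edgeSet he
  have hoffa : ∀ i, i ≠ 0 → i ≠ 1 → ∀ z, s(a i, z) ∉ pentagon a b c 0 := by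
    intro i h0 h1
    simp [pentagon, hab, hac, h.a_inj.eq_iff, h0, h1]
  have hoffb : ∀ i, i ≠ 0 → i ≠ 1 → ∀ z, s(b i, z) ∉ pentagon a b c 0 := by
    intro i h0 h1
    simp [pentagon, hba, hbc, h.b_inj.eq_iff, h0, h1]
  have hoffc : ∀ i, i ≠ 0 → ∀ z, s(c i, z) ∉ pentagon a b c 0 := by
    intro i h0
    simp [pentagon, hca, hcb, h.c_inj.eq_iff, h0]
  obtain ⟨f, hf, h01, hav⟩ := exists_face_avoiding hF hsub (hwC ▸ evenEdges_of_isCycle hw)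
    (by simp [pentagon] : s(a 0, a 1) ∈ pentagon a b c 0)
    (hoffa 2 (by decide) (by decide))
  have ha2 := hav (a 2) .refl
  have hra5 : Relation.ReflTransGen
      (fun x y => G.Adj x y ∧ ∀ z, s(y, z) ∉ pentagon a b c 0) (a 2) (a 5) :=
    (((Relation.ReflTransGen.single ⟨h.adj_aa 2, hoffa 3 (by decide) (by decide)⟩).tail
      ⟨h.adj_aa 3, hoffa 4 (by decide) (by decide)⟩).tail
      ⟨h.adj_aa 4, hoffa 5 (by decide) (by decide)⟩)
  have ha5 := hav (a 5) hra5
  have hc5 := hav (c 5) ((hra5.tail ⟨h.adj_ab 5, hoffb 5 (by decide) (by decide)⟩).tail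
      ⟨h.adj_bc 5, hoffc 5 (by decide)⟩)
  have hc1 := hav (c 1) ((Relation.ReflTransGen.single
      ⟨h.adj_ab 2, hoffb 2 (by decide) (by decide)⟩).tail
      ⟨(h.adj_cb 1).symm, hoffc 1 (by decide)⟩)
  have m1 : s(a 1, b 1) ∈ f := mem_of_avoiding hF hf h01 (h.adj_ab 1) (h.adj_aa 1) (hab _ _)
    (h.a_inj.ne (by decide)) (hba _ _) ha2
  have m2 : s(b 1, c 0) ∈ f := mem_of_avoiding hF hf m1 (h.adj_cb 0).symm (h.adj_bc 1) (hac _ _)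
    (hac _ _) (h.c_inj.ne (by decide)) hc1
  have m3 : s(a 0, b 0) ∈ f := mem_of_avoiding hF hf (Sym2.eq_swap ▸ h01) (h.adj_ab 0)
    (h.adj_aa 5).symm (hab _ _) (h.a_inj.ne (by decide)) (hba _ _) ha5
  have m4 : s(b 0, c 0) ∈ f := mem_of_avoiding hF hf m3 (h.adj_bc 0) (h.adj_cb 5).symm (hac _ _)
    (hac _ _) (h.c_inj.ne (by decide)) hc5
  rw [← hwC]
  refine IsCycle.edges_mem_faces hF hw (by simp [w]) hf ?_
  rw [hwC]
  simp only [pentagon, Finset.insert_subset_iff, Finset.singleton_subset_iff]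
  exact ⟨h01, m1, m2, Sym2.eq_swap ▸ m4, Sym2.eq_swap ▸ m3⟩

lemma pentagon_mem (hF : IsFullerene G faces) (h : PentagonRing G a b c) (i : Fin 6) :
    pentagon a b c i ∈ faces := by
  simpa [pentagon, add_comm] using (h.shift i).pentagon_zero_mem hF

lemma exists_isOuterFace (hF : IsFullerene G faces) (h : PentagonRing G a b c) (i : Fin 6) :
    ∃ g, IsOuterFace faces b c i g := by
  obtain ⟨g, hg, h1, h2⟩ := exists_corner hF (h.adj_cb i).symm (h.adj_bc (i + 1))
    (h.c_inj.ne (by simp))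
  exact ⟨g, hg, h1, h2⟩

lemma left_notMem {i : Fin 6} {g : Finset (Sym2 V)} (hF : IsFullerene G faces)
    (h : PentagonRing G a b c) (hg : IsOuterFace faces b c i g) : s(c i, b i) ∉ g := by
  intro hmem
  refine ne_pentagon h hg i (eq_of_corner hF hg.mem (h.pentagon_mem hF i) (v := c i)
    (h.b_inj.ne (by simp : i ≠ i + 1)) hmem (Sym2.eq_swap ▸ hg.left_mem) ?_ ?_) <;>
  simp [pentagon]

lemma right_notMem {i : Fin 6} {g : Finset (Sym2 V)} (hF : IsFullerene G faces)
    (h : PentagonRing G a b c) (hg : IsOuterFace faces b c i g) :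
    s(c (i + 1), b (i + 1 + 1)) ∉ g := by
  intro hmem
  refine ne_pentagon h hg (i + 1) (eq_of_corner hF hg.mem (h.pentagon_mem hF (i + 1))
    (v := c (i + 1)) (h.b_inj.ne (by simp : i + 1 + 1 ≠ i + 1)) hmem
    (Sym2.eq_swap ▸ hg.right_mem) ?_ ?_) <;>
  simp [pentagon]

lemma disjoint_hexagon {i : Fin 6} {g : Finset (Sym2 V)} (hF : IsFullerene G faces)
    (h : PentagonRing G a b c) (hg : IsOuterFace faces b c i g) :
    Disjoint (faceVerts (hexagon a)) (faceVerts g) := by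
  rw [Set.disjoint_left]
  rintro v hv ⟨e, he, w, rfl⟩
  obtain ⟨j, rfl⟩ := exists_of_mem_faceVerts_hexagon hv
  have hne : ∀ j : Fin 6, j ≠ j + 1 + 1 := by decide
  rcases two_of_three hF hg.mem he (h.adj_aa j).symm (h.adj_aa (j + 1)) (h.adj_ab (j + 1))
    (h.a_inj.ne (hne j)) (h.a_ne_b _ _) (h.a_ne_b _ _) with ⟨h1, h2⟩ | ⟨h1, h2⟩ | ⟨h1, h2⟩
  · exact ne_hexagon h hg (eq_of_corner hF hg.mem (h.hexagon_mem hF) (h.a_inj.ne (hne j)) h1 h2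
      (Sym2.eq_swap ▸ edge_mem_hexagon a j) (edge_mem_hexagon a _))
  · refine ne_pentagon h hg j (eq_of_corner hF hg.mem (h.pentagon_mem hF j)
      (h.a_ne_b j (j + 1)) h1 h2 ?_ ?_) <;> simp [pentagon]
  · refine ne_pentagon h hg (j + 1) (eq_of_corner hF hg.mem (h.pentagon_mem hF (j + 1))
      (h.a_ne_b _ _) h1 h2 ?_ ?_) <;> simp [pentagon]

lemma neighbors_a (hF : IsFullerene G faces) (h : PentagonRing G a b c) {i : Fin 6} {w : V}
    (hw : G.Adj (a (i + 1)) w) : w = a i ∨ w = a (i + 1 + 1) ∨ w = b (i + 1) := by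
  have hne : ∀ j : Fin 6, j ≠ j + 1 + 1 := by decide
  exact eq_of_adj hF (h.adj_aa i).symm (h.adj_aa (i + 1)) (h.adj_ab (i + 1))
    (h.a_inj.ne (hne i)) (h.a_ne_b _ _) (h.a_ne_b _ _) hw

lemma neighbors_b (hF : IsFullerene G faces) (h : PentagonRing G a b c) {i : Fin 6} {w : V}
    (hw : G.Adj (b (i + 1)) w) : w = a (i + 1) ∨ w = c i ∨ w = c (i + 1) :=
  eq_of_adj hF (h.adj_ab (i + 1)).symm (h.adj_cb i).symm (h.adj_bc (i + 1))
    (h.a_ne_c _ _) (h.a_ne_c _ _) (h.c_inj.ne (by simp)) hw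

/-- A matching that alternates on the central hexagon matches every ring vertex `c i` to some
ring vertex `b j`, hence cannot alternate on an outer face. -/
lemma not_altFace (hF : IsFullerene G faces) (h : PentagonRing G a b c) {i : Fin 6}
    {g : Finset (Sym2 V)} (hg : IsOuterFace faces b c i g) {M : G.Subgraph}
    (hM : M.IsPerfectMatching) (hhex : AltFace G M (hexagon a)) : ¬ AltFace G M g := by
  intro halt
  rw [Subgraph.isPerfectMatching_iff] at hM
  have huniq : ∀ {v x y}, M.Adj v x → M.Adj v y → x = y := fun hx hy => (hM _).unique hx hy
  have hb : ∀ i, ∃ j, M.Adj (b (i + 1)) (c j) := by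
    intro i
    obtain ⟨w, hw, -⟩ := hM (b (i + 1))
    rcases h.neighbors_b hF hw.adj_sub with rfl | rfl | rfl
    · obtain ⟨u, hu, hMu⟩ := hhex (a (i + 1)) ⟨_, edge_mem_hexagon a (i + 1), by simp⟩
      rw [huniq hMu hw.symm] at hu
      simp [hexagon, (h.a_ne_b _ _).symm] at hu
    · exact ⟨_, hw⟩
    · exact ⟨_, hw⟩
  choose σ hσ using hb
  have hinj : Function.Injective σ := by
    intro i j hij
    have h1 := (hσ i).symm
    rw [hij] at h1
    simpa using h.b_inj (huniq h1 (hσ j).symm)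
  have hsurj := Finite.surjective_of_injective hinj
  have hc : ∀ j, ∃ k, M.Adj (c j) (b k) := by
    intro j
    obtain ⟨k, rfl⟩ := hsurj j
    exact ⟨_, (hσ k).symm⟩
  have hcase : ∀ j k, G.Adj (c j) (b k) → k = j ∨ k = j + 1 := by
    intro j k hjk
    obtain ⟨k, rfl⟩ : ∃ k', k = k' + 1 := ⟨k - 1, by rw [sub_add_cancel]⟩
    rcases h.neighbors_b hF hjk.symm with h1 | h1 | h1
    · exact absurd h1.symm (h.a_ne_c _ _)
    · exact Or.inr (by rw [h.c_inj h1])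
    · exact Or.inl (h.c_inj h1).symm
  have hleft : M.Adj (c i) (b (i + 1)) := by
    obtain ⟨k, hk⟩ := hc i
    obtain ⟨u, hu, hMu⟩ := halt (c i) ⟨_, hg.left_mem, by simp⟩
    rcases hcase i k hk.adj_sub with rfl | rfl
    · rw [huniq hMu hk] at hu
      exact absurd hu (h.left_notMem hF hg)
    · exact hk
  have hright : M.Adj (c (i + 1)) (b (i + 1)) := by
    obtain ⟨k, hk⟩ := hc (i + 1)
    obtain ⟨u, hu, hMu⟩ := halt (c (i + 1)) ⟨_, hg.right_mem, by simp⟩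
    rcases hcase (i + 1) k hk.adj_sub with rfl | rfl
    · exact hk
    · rw [huniq hMu hk] at hu
      exact absurd hu (h.right_notMem hF hg)
  have := h.c_inj (huniq hleft.symm hright.symm)
  simp at this

lemma outer_card_eq_five (hF : IsFullerene G faces) (h : PentagonRing G a b c)
    (hres : KResonant G faces 2) {i : Fin 6} {g : Finset (Sym2 V)}
    (hg : IsOuterFace faces b c i g) : g.card = 5 := by
  refine (hF.face_size g hg.mem).resolve_right fun hcard => ?_
  have hdisj := h.disjoint_hexagon hF hg
  obtain ⟨M, hM, halt⟩ := hres {hexagon a, g}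
    (by simp [Finset.insert_subset_iff, h.hexagon_mem hF, hg.mem])
    (by simp [h.card_hexagon, hcard])
    (by
      simp only [Finset.mem_insert, Finset.mem_singleton]
      rintro f (rfl | rfl) f' (rfl | rfl) hne
      · exact absurd rfl hne
      · exact hdisj
      · exact hdisj.symm
      · exact absurd rfl hne)
    Finset.card_le_two
  exact h.not_altFace hF hg hM (halt _ (by simp)) (halt _ (by simp))

/-- A pentagon ring all of whose outer faces are pentagons spans the whole graph. -/
lemma card_eq_of_outer_pentagons (hF : IsFullerene G faces) (h : PentagonRing G a b c)
    (hpent : ∀ i g, IsOuterFace faces b c i g → g.card = 5) : Fintype.card V = 24 := by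
  choose d hcd hbd hbd' using fun i => exists_third hF (c i) (b i) (b (i + 1))
  have hneb : ∀ i : Fin 6, b i ≠ b (i + 1) := fun i => h.b_inj.ne (by simp)
  have hdd : ∀ i, G.Adj (d i) (d (i + 1)) := by
    intro i
    obtain ⟨g, hg⟩ := h.exists_isOuterFace hF i
    have h1 : s(c i, d i) ∈ g :=
      ((mem_iff_notMem hF hg.mem (h.adj_cb i) (hcd i) (h.adj_bc i).symm (hbd' i)
        (hneb i).symm (hbd i).symm (Sym2.eq_swap ▸ hg.left_mem)).2 (h.left_notMem hF hg))
    have h2 : s(c (i + 1), d (i + 1)) ∈ g :=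
      ((mem_iff_notMem hF hg.mem (h.adj_bc (i + 1)).symm (hcd (i + 1)) (h.adj_cb (i + 1))
        (hbd (i + 1)) (hneb _) (hbd' (i + 1)).symm (Sym2.eq_swap ▸ hg.right_mem)).2
        (h.right_notMem hF hg))
    exact adj_of_card_five hF hg.mem (hpent i g hg) hg.left_mem hg.right_mem
      (h.c_inj.ne (by simp)) h1 h2 (hbd' i).symm (hbd (i + 1)).symm
  have hNc : ∀ {i w}, G.Adj (c i) w → w = b i ∨ w = b (i + 1) ∨ w = d i := fun {i w} hw =>
    eq_of_adj hF (h.adj_bc i).symm (h.adj_cb i) (hcd i) (hneb i) (hbd i) (hbd' i) hw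
  have hpred : ∀ i : Fin 6, ∃ j, i = j + 1 := fun i => ⟨i - 1, by rw [sub_add_cancel]⟩
  have had : ∀ i j, a i ≠ d j := by
    intro i j hij
    obtain ⟨i, rfl⟩ := hpred i
    have hadj := (hcd j).symm
    rw [← hij] at hadj
    rcases h.neighbors_a hF hadj with h1 | h1 | h1
    · exact h.a_ne_c _ _ h1.symm
    · exact h.a_ne_c _ _ h1.symm
    · exact h.b_ne_c _ _ h1.symm
  have hbd_ne : ∀ i j, b i ≠ d j := by
    intro i j hij
    obtain ⟨i, rfl⟩ := hpred i
    have hadj := (hcd j).symm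
    rw [← hij] at hadj
    rcases h.neighbors_b hF hadj with h1 | h1 | h1
    · exact h.a_ne_c _ _ h1.symm
    · rw [h.c_inj h1] at hij
      exact hbd' _ hij
    · rw [← h.c_inj h1] at hij
      exact hbd _ hij
  have hne2 : ∀ j : Fin 6, j ≠ j + 1 + 1 := by decide
  have hcd_ne : ∀ i j, c i ≠ d j := by
    have hsymm : ∀ {i j}, c i = d j → c j = d i := by
      intro i j hij
      have hadj := (hcd j).symm
      rw [← hij] at hadj
      rcases hNc hadj with h1 | h1 | h1
      · exact absurd h1.symm (h.b_ne_c _ _)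
      · exact absurd h1.symm (h.b_ne_c _ _)
      · exact h1
    have hnext : ∀ {i j k}, c i = d j → G.Adj (d j) (d k) → k = i := by
      intro i j k hij hadj
      rw [← hij] at hadj
      rcases hNc hadj with h1 | h1 | h1
      · exact absurd h1.symm (hbd_ne _ _)
      · exact absurd h1.symm (hbd_ne _ _)
      · exact h.c_inj ((hsymm ((hsymm hij).trans h1.symm)).trans hij.symm)
    intro i j hij
    obtain ⟨j, rfl⟩ := hpred j
    exact hne2 j ((hnext hij (hdd j).symm).trans (hnext hij (hdd (j + 1))).symm)
  have hd_inj : Function.Injective d := by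
    intro i j hij
    by_contra hne
    obtain ⟨i, rfl⟩ := hpred i
    obtain ⟨j, rfl⟩ := hpred j
    have hq : ∀ {w}, G.Adj (d (i + 1)) w → w = c (i + 1) ∨ w = c (j + 1) ∨ w = d (i + 1 + 1) :=
      fun {w} hw => eq_of_adj hF (hcd (i + 1)).symm (hij ▸ (hcd (j + 1)).symm) (hdd (i + 1))
        (h.c_inj.ne hne) (hcd_ne _ _) (hcd_ne _ _) hw
    have hdq : ∀ {k}, G.Adj (d (i + 1)) (d k) → d k = d (i + 1 + 1) := by
      intro k hk
      rcases hq hk with h1 | h1 | h1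
      · exact absurd h1.symm (hcd_ne _ _)
      · exact absurd h1.symm (hcd_ne _ _)
      · exact h1
    have hi := hdq (hdd i).symm
    have hj := hdq (hij ▸ (hdd j).symm)
    have hj' := hdq (hij ▸ hdd (j + 1))
    have hcq : ∀ {k}, d k = d (i + 1 + 1) → k = i + 1 + 1 ∨ k = i := by
      intro k hk
      rcases eq_of_adj hF (hcd (i + 1 + 1)).symm (hi ▸ (hcd i).symm) (hdd (i + 1)).symm
        (h.c_inj.ne (hne2 i).symm) (hcd_ne _ _) (hcd_ne _ _) (hk ▸ (hcd k).symm) with h1 | h1 | h1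
      · exact Or.inl (h.c_inj h1)
      · exact Or.inr (h.c_inj h1)
      · exact absurd h1 (hcd_ne _ _)
    have hfin : ∀ i j : Fin 6, i + 1 ≠ j + 1 → (j = i + 1 + 1 ∨ j = i) →
        (j + 1 + 1 = i + 1 + 1 ∨ j + 1 + 1 = i) → False := by decide
    exact hfin i j hne (hcq hj) (hcq hj')
  have hNd : ∀ {i w}, G.Adj (d (i + 1)) w → w = c (i + 1) ∨ w = d i ∨ w = d (i + 1 + 1) :=
    fun {i w} hw => eq_of_adj hF (hcd (i + 1)).symm (hdd i).symm (hdd (i + 1)) (hcd_ne _ _)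
      (hcd_ne _ _) (hd_inj.ne (hne2 i)) hw
  let F : Fin 6 ⊕ Fin 6 ⊕ Fin 6 ⊕ Fin 6 → V := Sum.elim a (Sum.elim b (Sum.elim c d))
  have hinj : Function.Injective F :=
    h.a_inj.sumElim (h.b_inj.sumElim (h.c_inj.sumElim hd_inj hcd_ne)
      (by rintro i (j | j); exacts [h.b_ne_c i j, hbd_ne i j]))
      (by rintro i (j | j | j); exacts [h.a_ne_b i j, h.a_ne_c i j, had i j])
  have hmem : ∀ v, v ∈ Set.range F ↔
      (∃ i, v = a i) ∨ (∃ i, v = b i) ∨ (∃ i, v = c i) ∨ (∃ i, v = d i) := by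
    intro v
    simp [F, eq_comm]
  have hsurj : Function.Surjective F := by
    refine forall_of_adj_closed hF (p := fun v => v ∈ Set.range F) (v := a 0)
      ⟨Sum.inl 0, rfl⟩ ?_
    intro u w huw hu
    rw [hmem] at hu ⊢
    rcases hu with ⟨i, rfl⟩ | ⟨i, rfl⟩ | ⟨i, rfl⟩ | ⟨i, rfl⟩ <;> obtain ⟨i, rfl⟩ := hpred i
    · rcases h.neighbors_a hF huw with rfl | rfl | rfl <;> simp
    · rcases h.neighbors_b hF huw with rfl | rfl | rfl <;> simp
    · rcases hNc huw with rfl | rfl | rfl <;> simp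
    · rcases hNd huw with rfl | rfl | rfl <;> simp
  rw [← Fintype.card_of_bijective ⟨hinj, hsurj⟩]
  simp

end PentagonRing

end Fullerene

lemma R6_adj_hub (i : Fin 6) : R6.Adj ⟨i.val, by omega⟩ ⟨(i + 1).val, by omega⟩ := by
  simp only [R6, fromEdgeSet_adj, Set.mem_insert_iff, Set.mem_singleton_iff]
  decide +revert

lemma R6_adj_spoke (i : Fin 6) : R6.Adj ⟨i.val, by omega⟩ ⟨6 + 2 * i.val, by omega⟩ := by
  simp only [R6, fromEdgeSet_adj, Set.mem_insert_iff, Set.mem_singleton_iff]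
  decide +revert

lemma R6_adj_rim (i : Fin 6) : R6.Adj ⟨6 + 2 * i.val, by omega⟩ ⟨7 + 2 * i.val, by omega⟩ := by
  simp only [R6, fromEdgeSet_adj, Set.mem_insert_iff, Set.mem_singleton_iff]
  decide +revert

lemma R6_adj_rim_succ (i : Fin 6) : R6.Adj ⟨7 + 2 * i.val, by omega⟩ ⟨6 + 2 * (i + 1).val, by omega⟩ := by
  simp only [R6, fromEdgeSet_adj, Set.mem_insert_iff, Set.mem_singleton_iff]
  decide +revert

/-- a fullerene graph other than `F₂₄` (the unique fullerene on 24
vertices) containing `R₆` as a subgraph is not 2-resonant. -/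
theorem not_two_resonant_of_R6 {V : Type*} [Fintype V] [DecidableEq V]
    (G : SimpleGraph V) (faces : Finset (Finset (Sym2 V)))
    (hF : IsFullerene G faces)
    (hne : Fintype.card V ≠ 24)
    (φ : Fin 18 → V) (hinj : Function.Injective φ)
    (hemb : ∀ i j : Fin 18, R6.Adj i j → G.Adj (φ i) (φ j)) :
    ¬ KResonant G faces 2 := by
  intro hres
  have hring : Fullerene.PentagonRing G (fun i => φ ⟨i, by omega⟩)
      (fun i => φ ⟨6 + 2 * i, by omega⟩) (fun i => φ ⟨7 + 2 * i, by omega⟩) := by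
    constructor
    · exact fun i => hemb _ _ (R6_adj_hub i)
    · exact fun i => hemb _ _ (R6_adj_spoke i)
    · exact fun i => hemb _ _ (R6_adj_rim i)
    · exact fun i => hemb _ _ (R6_adj_rim_succ i)
    all_goals
      intro i j
      simp only [ne_eq, hinj.eq_iff, Fin.mk.injEq]
      omega
  exact hne (hring.card_eq_of_outer_pentagons hF fun i g hg => hring.outer_card_eq_five hF hres hg)
end

section
/- If a fullerene graph contains a pentagonal ring, then the minimum length τ(F) of a pentagonal ring in F satisfies 5 ≤ τ(F) ≤ 12. -/
open SimpleGraph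

/-- A pentagonal ring of length `l`: a cyclic sequence of pentagonal faces,
consecutive faces sharing exactly one edge, non-consecutive faces vertex-disjoint,
and the shared edges forming a matching. -/
def IsPentagonalRing [DecidableEq V] (faces : Finset (Finset (Sym2 V)))
    (l : ℕ) (ring : ZMod l → Finset (Sym2 V)) : Prop :=
  3 ≤ l ∧ Function.Injective ring ∧
  (∀ i, ring i ∈ faces ∧ (ring i).card = 5) ∧
  (∀ i, ∃ e, ring i ∩ ring (i + 1) = {e}) ∧
  (∀ i j : ZMod l, j ≠ i → j ≠ i + 1 → j ≠ i - 1 →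
    Disjoint (faceVerts (ring i)) (faceVerts (ring j))) ∧
  (∀ i j : ZMod l, i ≠ j → ∀ e ∈ ring i ∩ ring (i + 1), ∀ e' ∈ ring j ∩ ring (j + 1),
    ∀ v : V, v ∈ e → v ∉ e')

namespace IsPentagonalRing

variable {V : Type*} [DecidableEq V] {faces : Finset (Finset (Sym2 V))} {l : ℕ}
  {ring : ZMod l → Finset (Sym2 V)} {e : ZMod l → Sym2 V}

lemma ne_add_one (hR : IsPentagonalRing faces l ring) (i : ZMod l) : i ≠ i + 1 := by
  have : Fact (1 < l) := ⟨by have := hR.1; omega⟩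
  simp

lemma shared_mem (he : ∀ i, ring i ∩ ring (i + 1) = {e i}) (i : ZMod l) :
    e i ∈ ring i ∧ e i ∈ ring (i + 1) := by
  rw [← Finset.mem_inter, he]
  exact Finset.mem_singleton_self _

lemma shared_disjoint (hR : IsPentagonalRing faces l ring)
    (he : ∀ i, ring i ∩ ring (i + 1) = {e i}) {i j : ZMod l} {v : V} (hi : v ∈ e i)
    (hj : v ∈ e j) : i = j := by
  by_contra hij
  exact hR.2.2.2.2.2 i j hij (e i) (by simp [he]) (e j) (by simp [he]) v hi hj

lemma shared_injective (hR : IsPentagonalRing faces l ring)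
    (he : ∀ i, ring i ∩ ring (i + 1) = {e i}) : Function.Injective e := fun i _ h =>
  hR.shared_disjoint he (e i).out_fst_mem (h ▸ (e i).out_fst_mem)

theorem length_le_card_pentagons (hR : IsPentagonalRing faces l ring) :
    l ≤ (faces.filter fun f => f.card = 5).card := by
  have : NeZero l := ⟨by have := hR.1; omega⟩
  rw [← ZMod.card l, ← Finset.card_univ, ← Finset.card_image_of_injective _ hR.2.1]
  refine Finset.card_le_card fun f hf => ?_
  obtain ⟨i, -, rfl⟩ := Finset.mem_image.mp hf
  exact Finset.mem_filter.mpr (hR.2.2.1 i)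

end IsPentagonalRing

section Fullerene

variable {V : Type*} [Fintype V] [DecidableEq V] {G : SimpleGraph V}
  {faces : Finset (Finset (Sym2 V))}

namespace IsFullerene

lemma subset_edgeSet (hF : IsFullerene G faces) {f : Finset (Sym2 V)} (hf : f ∈ faces)
    {e : Sym2 V} (he : e ∈ f) : e ∈ G.edgeSet := by
  obtain ⟨v, c, -, rfl⟩ := hF.face_cycle f hf
  exact c.edges_subset_edgeSet (List.mem_toFinset.mp he)

/-- A vertex meets either no edge or exactly two edges of a face boundary. -/
lemma card_filter_mem_eq (hF : IsFullerene G faces) {f : Finset (Sym2 V)} (hf : f ∈ faces)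
    (v : V) : (f.filter (v ∈ ·)).card = 0 ∨ (f.filter (v ∈ ·)).card = 2 := by
  obtain ⟨x, c, hc, rfl⟩ := hF.face_cycle f hf
  by_cases hv : v ∈ c.support
  · right
    rw [← hc.ncard_neighborSet_toSubgraph_eq_two hv, ← Set.ncard_coe_finset]
    symm
    refine Set.ncard_congr (fun w _ => s(v, w)) ?_ ?_ ?_
    · intro w hw
      have : s(v, w) ∈ c.edges := c.mem_edges_toSubgraph.mp hw
      simpa using this
    · intro a b _ _ h
      exact Sym2.congr_right.mp h
    · intro e he
      simp only [Finset.coe_filter, List.mem_toFinset, Set.mem_ofPred_eq] at he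
      obtain ⟨he, w, rfl⟩ := he
      exact ⟨w, c.mem_edges_toSubgraph.mpr he, rfl⟩
  · left
    rw [Finset.card_eq_zero, Finset.filter_eq_empty_iff]
    intro e he hve
    obtain ⟨w, rfl⟩ := hve
    exact hv (c.fst_mem_support_of_mem_edges (List.mem_toFinset.mp he))

lemma card_filter_mem_eq_two (hF : IsFullerene G faces) {f : Finset (Sym2 V)} (hf : f ∈ faces)
    {v : V} {e : Sym2 V} (he : e ∈ f) (hv : v ∈ e) : (f.filter (v ∈ ·)).card = 2 :=
  (hF.card_filter_mem_eq hf v).resolve_left fun h =>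
    (Finset.card_eq_zero.mp h ▸ Finset.notMem_empty e : e ∉ f.filter (v ∈ ·))
      (Finset.mem_filter.mpr ⟨he, hv⟩)

lemma card_incidenceFinset [DecidableRel G.Adj] (hF : IsFullerene G faces) (v : V) :
    (G.incidenceFinset v).card = 3 := by
  rw [G.card_incidenceFinset_eq_degree, ← G.card_neighborSet_eq_degree, ← hF.cubic v,
    Set.ncard_eq_toFinset_card', Set.toFinset_card]

lemma filter_mem_subset_incidenceFinset [DecidableRel G.Adj] (hF : IsFullerene G faces)
    {f : Finset (Sym2 V)} (hf : f ∈ faces) (v : V) :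
    f.filter (v ∈ ·) ⊆ G.incidenceFinset v := by
  intro e he
  rw [Finset.mem_filter] at he
  rw [mem_incidenceFinset]
  exact ⟨hF.subset_edgeSet hf he.1, he.2⟩

lemma connected (hF : IsFullerene G faces) : G.Connected := by
  have h := hF.threeConnected ∅ (by simp)
  rw [Set.compl_empty] at h
  exact (induceUnivIso G).connected_iff.mp h

/-- A function on faces that agrees on faces sharing an edge is constant. -/
lemma eq_of_forall_shared_edge (hF : IsFullerene G faces) {α : Type*}
    (x : Finset (Sym2 V) → α)
    (hx : ∀ f ∈ faces, ∀ g ∈ faces, ∀ e ∈ f, e ∈ g → x f = x g)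
    {f g : Finset (Sym2 V)} (hf : f ∈ faces) (hg : g ∈ faces) : x f = x g := by
  classical
  have local_eq : ∀ v : V, ∀ f ∈ faces, ∀ g ∈ faces, (∃ e ∈ f, v ∈ e) → (∃ e ∈ g, v ∈ e) →
      x f = x g := by
    rintro v f hf g hg ⟨e, he, hve⟩ ⟨e', he', hve'⟩
    have h₁ := hF.card_filter_mem_eq_two hf he hve
    have h₂ := hF.card_filter_mem_eq_two hg he' hve'
    obtain ⟨d, hd⟩ : ((f.filter (v ∈ ·)) ∩ (g.filter (v ∈ ·))).Nonempty := by
      refine Finset.inter_nonempty_of_card_lt_card_add_card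
        (hF.filter_mem_subset_incidenceFinset hf v)
        (hF.filter_mem_subset_incidenceFinset hg v) ?_
      rw [hF.card_incidenceFinset, h₁, h₂]
      norm_num
    simp only [Finset.mem_inter, Finset.mem_filter] at hd
    exact hx f hf g hg d hd.1.1 hd.2.1
  have walk_eq : ∀ u v : V, G.Walk u v → ∀ f ∈ faces, ∀ g ∈ faces,
      (∃ e ∈ f, u ∈ e) → (∃ e ∈ g, v ∈ e) → x f = x g := by
    intro u v p
    induction p with
    | nil => exact local_eq _
    | @cons u w v h p ih =>
      intro f hf g hg hfu hgv
      have hc := hF.edge_two_faces s(u, w) h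
      obtain ⟨k, hk⟩ : (faces.filter (fun f => s(u, w) ∈ f)).Nonempty := by
        rw [← Finset.card_pos, hc]
        norm_num
      rw [Finset.mem_filter] at hk
      exact (local_eq u f hf k hk.1 hfu ⟨_, hk.2, by simp⟩).trans
        (ih k hk.1 g hg ⟨_, hk.2, by simp⟩ hgv)
  have touch : ∀ f ∈ faces, ∃ v : V, ∃ e ∈ f, v ∈ e := by
    intro f hf
    obtain ⟨e, he⟩ : f.Nonempty := by
      rw [← Finset.card_pos]
      rcases hF.face_size f hf with h | h <;> omega
    exact ⟨e.out.1, e, he, e.out_fst_mem⟩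
  obtain ⟨u, hu⟩ := touch f hf
  obtain ⟨v, hv⟩ := touch g hg
  obtain ⟨p⟩ := hF.connected.preconnected u v
  exact walk_eq u v p f hf g hg hu hv

/-- A vertex function whose coboundary vanishes is constant. -/
lemma eq_of_forall_adj (hF : IsFullerene G faces) {α : Type*} (y : V → α)
    (hy : ∀ u v, G.Adj u v → y u = y v) (u v : V) : y u = y v := by
  obtain ⟨p⟩ := hF.connected.preconnected u v
  induction p with
  | nil => rfl
  | cons h p ih => exact (hy _ _ h).trans ih

/-- Two distinct faces through an edge are the only faces through it. -/
lemma filter_mem_eq_pair (hF : IsFullerene G faces) {f g : Finset (Sym2 V)} (hf : f ∈ faces)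
    (hg : g ∈ faces) (hfg : f ≠ g) {e : Sym2 V} (hef : e ∈ f) (heg : e ∈ g) :
    faces.filter (e ∈ ·) = {f, g} := by
  symm
  apply Finset.eq_of_subset_of_card_le
  · intro k hk
    rcases Finset.mem_insert.mp hk with rfl | hk
    · simp [hf, hef]
    · rw [Finset.mem_singleton] at hk
      subst hk
      simp [hg, heg]
  · rw [hF.edge_two_faces e (hF.subset_edgeSet hf hef), Finset.card_pair hfg]

/-- An edge set meeting every face boundary evenly is an edge cut: over the two-element field, the
vertex–edge–face chain complex is exact at the edges, by Euler's formula. -/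
lemma exists_coloring (hF : IsFullerene G faces) (D : Finset (Sym2 V))
    (heven : ∀ f ∈ faces, Even (f ∩ D).card) :
    ∃ c : V → ZMod 2, ∀ u v, G.Adj u v → (s(u, v) ∈ D ↔ c u ≠ c v) := by
  classical
  let M : Matrix G.edgeSet faces (ZMod 2) := Matrix.of fun e f => if e.1 ∈ f.1 then 1 else 0
  let N : Matrix G.edgeSet V (ZMod 2) := Matrix.of fun e v => if v ∈ e.1 then 1 else 0
  have sum_faces (f : faces) (P : Sym2 V → Prop) [DecidablePred P] :
      (∑ e : G.edgeSet, (if e.1 ∈ f.1 then (if P e.1 then 1 else 0) else 0 : ZMod 2)) =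
        (f.1.filter P).card := by
    rw [Finset.natCast_card_filter, ← Finset.sum_coe_sort f.1]
    rw [← Finset.sum_filter]
    refine Finset.sum_bij' (fun e he => ⟨e.1, by simpa using he⟩)
      (fun e _ => ⟨e.1, hF.subset_edgeSet f.2 e.2⟩) ?_ ?_ ?_ ?_ ?_ <;> simp
  have hMN : M.transpose * N = 0 := by
    ext f v
    rw [Matrix.mul_apply]
    have := sum_faces f (v ∈ ·)
    simp only [M, N, Matrix.transpose_apply, Matrix.of_apply, ite_mul, one_mul, zero_mul,
      Matrix.zero_apply]
    rw [this]
    rcases hF.card_filter_mem_eq f.2 v with h | h <;> rw [h] <;> decide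
  have hN_apply (y : V → ZMod 2) {u v : V} (h : G.Adj u v) :
      N.mulVec y ⟨s(u, v), h⟩ = y u + y v := by
    simp only [Matrix.mulVec, dotProduct, N, Matrix.of_apply, ite_mul, one_mul, zero_mul]
    rw [← Finset.sum_filter, ← Finset.sum_pair h.ne]
    congr 1
    ext w
    simp
  have hN : Module.finrank (ZMod 2) (LinearMap.ker N.mulVecLin) ≤ 1 := by
    refine finrank_le_one ⟨fun _ => 1, ?_⟩ ?_
    · rw [LinearMap.mem_ker, Matrix.mulVecLin_apply]
      ext ⟨e, he⟩
      induction e with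
      | _ u v =>
        rw [hN_apply _ he]
        exact CharTwo.add_self_eq_zero 1
    · rintro ⟨y, hy⟩
      obtain ⟨v₀⟩ := hF.connected.nonempty
      refine ⟨y v₀, Subtype.ext (funext fun v => ?_)⟩
      rw [LinearMap.mem_ker, Matrix.mulVecLin_apply] at hy
      have := hF.eq_of_forall_adj y (fun u v h => by
        have h' := congrFun hy ⟨s(u, v), h⟩
        rw [hN_apply y h] at h'
        exact CharTwo.add_eq_zero.mp h') v₀ v
      simpa using this
  have hM : Module.finrank (ZMod 2) (LinearMap.ker M.mulVecLin) ≤ 1 := by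
    have hshare : ∀ x : faces → ZMod 2, M.mulVec x = 0 → ∀ f g : faces, x f = x g := by
      intro x hx f g
      have := hF.eq_of_forall_shared_edge (fun f => if h : f ∈ faces then x ⟨f, h⟩ else 0) ?_
        f.2 g.2
      · simpa using this
      intro f hf g hg e hef heg
      have he := hF.subset_edgeSet hf hef
      simp only [hf, hg, dif_pos]
      by_cases hfg : f = g
      · subst hfg
        rfl
      have h := congrFun hx ⟨e, he⟩
      simp only [Matrix.mulVec, dotProduct, M, Matrix.of_apply, ite_mul, one_mul, zero_mul,
        Pi.zero_apply] at h
      have hne : (⟨f, hf⟩ : faces) ≠ ⟨g, hg⟩ := fun h => hfg (congrArg Subtype.val h)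
      have hset := hF.filter_mem_eq_pair hf hg hfg hef heg
      have hset' : (Finset.univ.filter fun k : faces => e ∈ k.1) = {⟨f, hf⟩, ⟨g, hg⟩} := by
        ext ⟨k, hk⟩
        have := Finset.ext_iff.mp hset k
        simpa [hk] using this
      rw [← Finset.sum_filter, hset', Finset.sum_pair hne] at h
      exact CharTwo.add_eq_zero.mp h
    obtain ⟨f₀, hf₀⟩ : faces.Nonempty := by
      have := hF.pentagons
      rw [Finset.nonempty_iff_ne_empty]
      rintro rfl
      simp at this
    by_cases hone : M.mulVec (fun _ => 1) = 0
    · refine finrank_le_one ⟨fun _ => 1, hone⟩ ?_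
      rintro ⟨x, hx⟩
      refine ⟨x ⟨f₀, hf₀⟩, Subtype.ext (funext fun f => ?_)⟩
      simpa using hshare x hx ⟨f₀, hf₀⟩ f
    · refine finrank_le_one 0 ?_
      rintro ⟨x, hx⟩
      refine ⟨0, Subtype.ext (funext fun f => ?_)⟩
      by_contra hne
      apply hone
      have h1 : x = fun _ => 1 := funext fun g => by
        rw [hshare x hx g f]
        have : ∀ z : ZMod 2, ¬ (0 : ZMod 2) = z → z = 1 := by decide
        exact this _ (by simpa using hne)
      rw [← h1]
      exact hx
  have hle : LinearMap.range N.mulVecLin ≤ LinearMap.ker M.transpose.mulVecLin := by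
    rintro _ ⟨y, rfl⟩
    rw [LinearMap.mem_ker, Matrix.mulVecLin_apply, Matrix.mulVecLin_apply, Matrix.mulVec_mulVec,
      hMN, Matrix.zero_mulVec]
  have heq : LinearMap.range N.mulVecLin = LinearMap.ker M.transpose.mulVecLin := by
    apply Submodule.eq_of_le_of_finrank_le hle
    have h₁ := N.mulVecLin.finrank_range_add_finrank_ker
    have h₂ := M.mulVecLin.finrank_range_add_finrank_ker
    have h₃ := M.transpose.mulVecLin.finrank_range_add_finrank_ker
    have h₄ : Module.finrank (ZMod 2) (LinearMap.range M.transpose.mulVecLin) =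
        Module.finrank (ZMod 2) (LinearMap.range M.mulVecLin) := M.rank_transpose
    have h₅ := hF.euler
    rw [Set.ncard_eq_toFinset_card', Set.toFinset_card] at h₅
    rw [Module.finrank_fintype_fun_eq_card] at h₁ h₂ h₃
    rw [Fintype.card_coe] at h₂
    omega
  have hD : (fun e : G.edgeSet => if e.1 ∈ D then (1 : ZMod 2) else 0) ∈
      LinearMap.ker M.transpose.mulVecLin := by
    rw [LinearMap.mem_ker, Matrix.mulVecLin_apply]
    ext f
    have := sum_faces f (· ∈ D)
    simp only [Matrix.mulVec, dotProduct, M, Matrix.transpose_apply, Matrix.of_apply, ite_mul,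
      one_mul, zero_mul, Pi.zero_apply]
    rw [this, Finset.filter_mem_eq_inter]
    exact (ZMod.natCast_eq_zero_iff_even).mpr (heven f.1 f.2)
  rw [← heq] at hD
  obtain ⟨c, hc⟩ := hD
  refine ⟨c, fun u v h => ?_⟩
  have h' := congrFun hc ⟨s(u, v), h⟩
  rw [Matrix.mulVecLin_apply, hN_apply c h] at h'
  rw [ne_eq, ← CharTwo.add_eq_zero, h']
  split_ifs with hmem <;> simp [hmem]

end IsFullerene

/-- The edges of `X` with both endpoints of colour `a`. -/
def monoEdges (c : V → ZMod 2) (a : ZMod 2) (X : Finset (Sym2 V)) : Finset (Sym2 V) :=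
  X.filter fun d => ∀ v ∈ d, c v = a

/-- The vertices of colour `a`. -/
def colorClass (c : V → ZMod 2) (a : ZMod 2) : Finset V := Finset.univ.filter (c · = a)

section Cut

variable {D : Finset (Sym2 V)} {c : V → ZMod 2}

lemma card_colorClass_filter_mem (hc : ∀ u v, G.Adj u v → (s(u, v) ∈ D ↔ c u ≠ c v))
    (a : ZMod 2) {d : Sym2 V} (hd : d ∈ G.edgeSet) :
    ((colorClass c a).filter (· ∈ d)).card =
      2 * (if ∀ v ∈ d, c v = a then 1 else 0) + if d ∈ D then 1 else 0 := by
  induction d with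
  | _ u v =>
    have huv : G.Adj u v := hd
    have h : (colorClass c a).filter (· ∈ s(u, v)) = ({u, v} : Finset V).filter (c · = a) := by
      ext w
      simp [colorClass, and_comm]
    have key : ∀ x y a : ZMod 2, (if x = a then 1 else 0) + (if y = a then 1 else 0) =
        2 * (if x = a ∧ y = a then 1 else 0) + (if x ≠ y then 1 else 0) := by decide
    rw [h, Finset.card_filter, Finset.sum_pair huv.ne]
    simp only [hc u v huv, Sym2.mem_iff, forall_eq_or_imp, forall_eq]
    exact key _ _ _

/-- Double counting of the incidences between an edge set and a colour class of a cut. -/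
lemma sum_colorClass_card_filter_mem (hc : ∀ u v, G.Adj u v → (s(u, v) ∈ D ↔ c u ≠ c v))
    (a : ZMod 2) {X : Finset (Sym2 V)} (hX : ∀ d ∈ X, d ∈ G.edgeSet) :
    ∑ v ∈ colorClass c a, (X.filter (v ∈ ·)).card =
      2 * (monoEdges c a X).card + (X ∩ D).card := by
  have h := Finset.sum_card_bipartiteAbove_eq_sum_card_bipartiteBelow
    (s := colorClass c a) (t := X) (fun v d => v ∈ d)
  simp only [Finset.bipartiteAbove, Finset.bipartiteBelow] at h
  rw [h, Finset.sum_congr rfl fun d hd => card_colorClass_filter_mem hc a (hX d hd),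
    Finset.sum_add_distrib, ← Finset.mul_sum, monoEdges, Finset.card_filter,
    ← Finset.filter_mem_eq_inter, Finset.card_filter]

lemma card_monoEdges_add (hc : ∀ u v, G.Adj u v → (s(u, v) ∈ D ↔ c u ≠ c v))
    {X : Finset (Sym2 V)} (hX : ∀ d ∈ X, d ∈ G.edgeSet) :
    (monoEdges c 0 X).card + (monoEdges c 1 X).card + (X ∩ D).card = X.card := by
  rw [monoEdges, monoEdges, ← Finset.filter_mem_eq_inter, Finset.card_filter, Finset.card_filter,
    Finset.card_filter, ← Finset.sum_add_distrib, ← Finset.sum_add_distrib,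
    Finset.card_eq_sum_ones]
  refine Finset.sum_congr rfl fun d hd => ?_
  have hd' := hX d hd
  induction d with
  | _ u v =>
    have key : ∀ x y : ZMod 2, (if x = 0 ∧ y = 0 then 1 else 0) +
        (if x = 1 ∧ y = 1 then 1 else 0) + (if x ≠ y then 1 else 0) = 1 := by decide
    simp only [hc u v hd', Sym2.mem_iff, forall_eq_or_imp, forall_eq]
    exact key _ _

namespace IsFullerene

lemma sum_monoEdges_faces [DecidableRel G.Adj] (hF : IsFullerene G faces) (a : ZMod 2) :
    ∑ f ∈ faces, (monoEdges c a f).card = 2 * (monoEdges c a G.edgeFinset).card := by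
  have h := Finset.sum_card_bipartiteAbove_eq_sum_card_bipartiteBelow
    (s := faces) (t := monoEdges c a G.edgeFinset) (fun f d => d ∈ f)
  simp only [Finset.bipartiteAbove, Finset.bipartiteBelow] at h
  rw [Finset.sum_congr rfl fun f hf => ?_, h, Finset.sum_congr rfl fun d hd =>
    hF.edge_two_faces d ?_, Finset.sum_const, smul_eq_mul, mul_comm]
  · simpa using (Finset.mem_filter.mp hd).1
  · congr 1
    ext d
    have := hF.subset_edgeSet hf (e := d)
    simp only [monoEdges, Finset.mem_filter, mem_edgeFinset]
    tauto

lemma three_mul_card_colorClass [DecidableRel G.Adj] (hF : IsFullerene G faces)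
    (hc : ∀ u v, G.Adj u v → (s(u, v) ∈ D ↔ c u ≠ c v)) (hD : ∀ d ∈ D, d ∈ G.edgeSet)
    (a : ZMod 2) :
    3 * (colorClass c a).card = 2 * (monoEdges c a G.edgeFinset).card + D.card := by
  have h := sum_colorClass_card_filter_mem hc a (X := G.edgeFinset) (by simp)
  rw [Finset.inter_eq_right.mpr (fun d hd => by simpa using hD d hd)] at h
  rw [← h, Finset.sum_congr rfl fun v _ => ?_, Finset.sum_const, smul_eq_mul, mul_comm]
  rw [← hF.card_incidenceFinset v]
  congr 1
  ext d
  simp [incidenceSet]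

lemma card_colorClass_face (hF : IsFullerene G faces)
    (hc : ∀ u v, G.Adj u v → (s(u, v) ∈ D ↔ c u ≠ c v)) (a : ZMod 2)
    {f : Finset (Sym2 V)} (hf : f ∈ faces) :
    2 * ((colorClass c a).filter fun v => ∃ d ∈ f, v ∈ d).card =
      2 * (monoEdges c a f).card + (f ∩ D).card := by
  rw [← sum_colorClass_card_filter_mem hc a fun d => hF.subset_edgeSet hf, Finset.card_filter,
    Finset.mul_sum]
  refine Finset.sum_congr rfl fun v _ => ?_
  split_ifs with h
  · obtain ⟨d, hd, hv⟩ := h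
    rw [hF.card_filter_mem_eq_two hf hd hv, mul_one]
  · rw [eq_comm, mul_zero, Finset.card_eq_zero, Finset.filter_eq_empty_iff]
    exact fun d hd hv => h ⟨d, hd, hv⟩

/-- A face avoiding the cut has all its edges on one side. -/
lemma card_monoEdges_of_disjoint (hF : IsFullerene G faces)
    (hc : ∀ u v, G.Adj u v → (s(u, v) ∈ D ↔ c u ≠ c v)) (a : ZMod 2)
    {f : Finset (Sym2 V)} (hf : f ∈ faces) (hfD : ∀ d ∈ f, d ∉ D) :
    (monoEdges c a f).card = 0 ∨ (monoEdges c a f).card = 5 ∨ (monoEdges c a f).card = 6 := by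
  obtain ⟨x, p, -, hp⟩ := hF.face_cycle f hf
  have walk_const : ∀ (y z : V) (p : G.Walk y z), (∀ d ∈ p.edges, d ∉ D) →
      ∀ v ∈ p.support, c v = c y := by
    intro y z p
    induction p with
    | nil => simp
    | @cons y w z h p ih =>
      intro hd v hv
      rw [Walk.support_cons, List.mem_cons] at hv
      rcases hv with rfl | hv
      · rfl
      · rw [ih (fun d hd' => hd d (by simp [hd'])) v hv]
        by_contra hne
        exact hd s(y, w) (by simp) ((hc y w h).mpr fun h => hne h.symm)
  have hconst : ∀ d ∈ f, ∀ v ∈ d, c v = c x := by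
    intro d hd v hv
    subst hp
    obtain ⟨w, rfl⟩ := hv
    exact walk_const x x p (fun d hd => hfD d (List.mem_toFinset.mpr hd)) v
      (p.fst_mem_support_of_mem_edges (List.mem_toFinset.mp hd))
  by_cases ha : c x = a
  · right
    rw [monoEdges, Finset.filter_true_of_mem fun d hd v hv => (hconst d hd v hv).trans ha]
    exact hF.face_size f hf
  · left
    rw [monoEdges, Finset.card_eq_zero, Finset.filter_eq_empty_iff]
    intro d hd h
    exact ha ((hconst d hd _ d.out_fst_mem).symm.trans (h _ d.out_fst_mem))

end IsFullerene

end Cut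

section Ring

variable {l : ℕ} {ring : ZMod l → Finset (Sym2 V)} {e : ZMod l → Sym2 V}

namespace IsPentagonalRing

/-- The only faces through a shared edge are the two consecutive faces sharing it. -/
lemma eq_or_eq_of_shared_mem (hF : IsFullerene G faces) (hR : IsPentagonalRing faces l ring)
    (he : ∀ i, ring i ∩ ring (i + 1) = {e i}) {i : ZMod l} {f : Finset (Sym2 V)}
    (hf : f ∈ faces) (hi : e i ∈ f) : f = ring i ∨ f = ring (i + 1) := by
  have h := hF.filter_mem_eq_pair (hR.2.2.1 i).1 (hR.2.2.1 (i + 1)).1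
    (hR.2.1.ne (hR.ne_add_one i)) (shared_mem he i).1 (shared_mem he i).2
  have hf' : f ∈ faces.filter (e i ∈ ·) := Finset.mem_filter.mpr ⟨hf, hi⟩
  simpa [h] using hf'

lemma card_ring_inter_shared [NeZero l] (hF : IsFullerene G faces)
    (hR : IsPentagonalRing faces l ring)
    (he : ∀ i, ring i ∩ ring (i + 1) = {e i}) (i : ZMod l) :
    (ring i ∩ Finset.univ.image e).card = 2 := by
  have h : ring i ∩ Finset.univ.image e = {e (i - 1), e i} := by
    ext d
    simp only [Finset.mem_inter, Finset.mem_image, Finset.mem_univ, true_and, Finset.mem_insert,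
      Finset.mem_singleton]
    constructor
    · rintro ⟨hd, j, rfl⟩
      rcases hR.eq_or_eq_of_shared_mem hF he (hR.2.2.1 i).1 hd with h | h
      · exact Or.inr (congrArg e (hR.2.1 h).symm)
      · exact Or.inl (congrArg e (eq_sub_of_add_eq (hR.2.1 h).symm))
    · rintro (rfl | rfl)
      · exact ⟨by simpa using (shared_mem he (i - 1)).2, _, rfl⟩
      · exact ⟨(shared_mem he i).1, _, rfl⟩
  rw [h, Finset.card_pair]
  refine (hR.shared_injective he).ne fun h => hR.ne_add_one (i - 1) ?_
  simpa using h

/-- An edge at an endpoint of a shared edge lies on one of the two faces sharing it. -/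
lemma mem_ring_of_adj (hF : IsFullerene G faces) (hR : IsPentagonalRing faces l ring)
    (he : ∀ i, ring i ∩ ring (i + 1) = {e i}) {i : ZMod l} {u v : V} (hu : u ∈ e i)
    (huv : G.Adj u v) : s(u, v) ∈ ring i ∨ s(u, v) ∈ ring (i + 1) := by
  classical
  have h₁ := hF.card_filter_mem_eq_two (hR.2.2.1 i).1 (shared_mem he i).1 hu
  have h₂ := hF.card_filter_mem_eq_two (hR.2.2.1 (i + 1)).1 (shared_mem he i).2 hu
  have h₃ : ((ring i).filter (u ∈ ·) ∩ (ring (i + 1)).filter (u ∈ ·)).card ≤ 1 := by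
    rw [← Finset.filter_inter_distrib, he]
    exact (Finset.card_filter_le _ _).trans (Finset.card_singleton _).le
  have h₄ := Finset.card_union_add_card_inter ((ring i).filter (u ∈ ·))
    ((ring (i + 1)).filter (u ∈ ·))
  have h₅ : (ring i).filter (u ∈ ·) ∪ (ring (i + 1)).filter (u ∈ ·) = G.incidenceFinset u := by
    apply Finset.eq_of_subset_of_card_le
    · exact Finset.union_subset (hF.filter_mem_subset_incidenceFinset (hR.2.2.1 i).1 u)
        (hF.filter_mem_subset_incidenceFinset (hR.2.2.1 (i + 1)).1 u)
    · rw [hF.card_incidenceFinset]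
      omega
  have h₆ : s(u, v) ∈ G.incidenceFinset u := by
    rw [mem_incidenceFinset]
    exact ⟨huv, by simp⟩
  rw [← h₅] at h₆
  simpa using h₆

/-- If a side of the cut formed by the shared edges has at most two ring vertices off the shared
edges, then it has no other vertices, by `3`-connectedness. -/
lemma card_colorClass_bounds [NeZero l] (hF : IsFullerene G faces)
    (hR : IsPentagonalRing faces l ring)
    (he : ∀ i, ring i ∩ ring (i + 1) = {e i}) {c : V → ZMod 2}
    (hc : ∀ u v, G.Adj u v → (s(u, v) ∈ Finset.univ.image e ↔ c u ≠ c v)) (a : ZMod 2)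
    (hsmall : ∑ i, (monoEdges c a (ring i)).card ≤ l + 2) :
    l ≤ (colorClass c a).card ∧ (colorClass c a).card ≤ ∑ i, (monoEdges c a (ring i)).card := by
  have hends : ∀ i, ∃ s t, e i = s(s, t) ∧ c s = a ∧ c t ≠ a := by
    intro i
    have hi := hF.subset_edgeSet (hR.2.2.1 i).1 (shared_mem he i).1
    obtain ⟨⟨u, v⟩, huv⟩ := Quot.exists_rep (e i)
    replace huv : e i = s(u, v) := huv.symm
    have hne := (hc u v (by rwa [huv] at hi)).mp (by simp [← huv])
    have key : ∀ x y a : ZMod 2, x ≠ y → (x = a ∧ y ≠ a) ∨ (y = a ∧ x ≠ a) := by decide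
    rcases key _ _ a hne with h | h
    · exact ⟨u, v, huv, h⟩
    · exact ⟨v, u, huv.trans Sym2.eq_swap, h⟩
  choose s t hst hs ht using hends
  have hse : ∀ i, s i ∈ e i := fun i => by simp [hst]
  have s_inj : Function.Injective s := fun i j h =>
    hR.shared_disjoint he (hse i) (h ▸ hse j)
  have eq_s : ∀ i v, v ∈ e i → c v = a → v = s i := by
    intro i v hv hva
    rw [hst, Sym2.mem_iff] at hv
    rcases hv with rfl | rfl
    · rfl
    · exact absurd hva (ht i)
  let A : ZMod l → Finset V := fun i => (colorClass c a).filter fun v => ∃ d ∈ ring i, v ∈ d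
  let W : Finset V := Finset.univ.biUnion fun i => A i \ {s (i - 1), s i}
  have hA : ∀ i, (A i).card = (monoEdges c a (ring i)).card + 1 := by
    intro i
    have h := hF.card_colorClass_face hc a (hR.2.2.1 i).1
    rw [hR.card_ring_inter_shared hF he] at h
    change 2 * (A i).card = _ at h
    omega
  have hpair : ∀ i, (A i \ {s (i - 1), s i}).card + 1 = (monoEdges c a (ring i)).card := by
    intro i
    have hsub : ({s (i - 1), s i} : Finset V) ⊆ A i := by
      intro v hv
      rw [Finset.mem_insert, Finset.mem_singleton] at hv
      rcases hv with rfl | rfl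
      · have := (shared_mem he (i - 1)).2
        rw [sub_add_cancel] at this
        simpa [A, colorClass, hs] using ⟨_, this, hse (i - 1)⟩
      · simpa [A, colorClass, hs] using ⟨_, (shared_mem he i).1, hse i⟩
    have hcard : ({s (i - 1), s i} : Finset V).card = 2 := by
      refine Finset.card_pair (s_inj.ne fun h => hR.ne_add_one (i - 1) ?_)
      simpa using h
    have h₁ := Finset.card_sdiff_add_card_eq_card hsub
    have h₂ := hA i
    omega
  have hW : W.card + l ≤ ∑ i, (monoEdges c a (ring i)).card := by
    calc W.card + l ≤ (∑ i, (A i \ {s (i - 1), s i}).card) + l := by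
          gcongr
          exact Finset.card_biUnion_le
      _ = ∑ i, (monoEdges c a (ring i)).card := by
          rw [← Finset.sum_congr rfl fun i _ => hpair i, Finset.sum_add_distrib]
          simp [ZMod.card]
  have hS : (Finset.univ.image s).card = l := by
    rw [Finset.card_image_of_injective _ s_inj, Finset.card_univ, ZMod.card]
  have hWa : ∀ v ∈ W, c v = a := by
    intro v hv
    simp only [W, A, colorClass, Finset.mem_biUnion, Finset.mem_sdiff, Finset.mem_filter] at hv
    obtain ⟨i, -, h, -⟩ := hv
    exact h.1.2
  have step : ∀ u v, G.Adj u v → v ∉ W → (c u = a → ∃ i, u = s i) → c v = a → ∃ i, v = s i := by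
    intro u v huv hvW hu hva
    by_cases hua : c u = a
    · obtain ⟨i, rfl⟩ := hu hua
      obtain ⟨j, hj⟩ : ∃ j, s(s i, v) ∈ ring j := by
        rcases hR.mem_ring_of_adj hF he (hse i) huv with h | h
        · exact ⟨_, h⟩
        · exact ⟨_, h⟩
      by_contra hns
      push Not at hns
      apply hvW
      simp only [W, A, colorClass, Finset.mem_biUnion, Finset.mem_sdiff, Finset.mem_filter,
        Finset.mem_univ, true_and, Finset.mem_insert, Finset.mem_singleton]
      exact ⟨j, ⟨hva, _, hj, by simp⟩, fun h => h.elim (hns _) (hns _)⟩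
    · have hmem := (hc u v huv).mpr fun h => hua (h.trans hva)
      obtain ⟨i, -, hi⟩ := Finset.mem_image.mp hmem
      exact ⟨i, eq_s i v (by simp [hi]) hva⟩
  have hconn := hF.threeConnected (W : Set V) (by
    rw [Set.ncard_coe_finset]
    omega)
  have hall : ∀ v, v ∉ W → c v = a → ∃ i, v = s i := by
    intro v hv
    have ht0 : t 0 ∉ W := fun h => ht 0 (hWa _ h)
    obtain ⟨p⟩ := hconn.preconnected ⟨t 0, by simpa using ht0⟩ ⟨v, by simpa using hv⟩
    have walk_step : ∀ x y : ((W : Set V)ᶜ : Set V), (G.induce (W : Set V)ᶜ).Walk x y →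
        (c x = a → ∃ i, x.1 = s i) → c y = a → ∃ i, y.1 = s i := by
      intro x y p
      induction p with
      | nil => exact id
      | @cons x w y h p ih =>
        intro hx
        exact ih (step x.1 w.1 h (fun hw => w.2 (Finset.mem_coe.mpr hw)) hx)
    exact walk_step _ _ p fun h => absurd h (ht 0)
  constructor
  · rw [← hS]
    refine Finset.card_le_card fun v hv => ?_
    obtain ⟨i, -, rfl⟩ := Finset.mem_image.mp hv
    simp [colorClass, hs]
  · have hsub : colorClass c a ⊆ W ∪ Finset.univ.image s := by
      intro v hv
      rw [Finset.mem_union]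
      by_cases hvW : v ∈ W
      · exact Or.inl hvW
      · obtain ⟨i, rfl⟩ := hall v hvW (by simpa [colorClass] using hv)
        exact Or.inr (Finset.mem_image_of_mem _ (Finset.mem_univ _))
    have h₁ := Finset.card_le_card hsub
    have h₂ := Finset.card_union_le W (Finset.univ.image s)
    omega

theorem five_le_length (hF : IsFullerene G faces) (hR : IsPentagonalRing faces l ring) :
    5 ≤ l := by
  classical
  have hl := hR.1
  have : NeZero l := ⟨by omega⟩
  choose e he using hR.2.2.2.1
  let D : Finset (Sym2 V) := Finset.univ.image e
  have hDcard : D.card = l := by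
    rw [Finset.card_image_of_injective _ (hR.shared_injective he), Finset.card_univ, ZMod.card]
  have hDedge : ∀ d ∈ D, d ∈ G.edgeSet := by
    intro d hd
    obtain ⟨i, -, rfl⟩ := Finset.mem_image.mp hd
    exact hF.subset_edgeSet (hR.2.2.1 i).1 (shared_mem he i).1
  have off_ring : ∀ f ∈ faces, f ∉ Finset.univ.image ring → ∀ d ∈ f, d ∉ D := by
    intro f hf hfr d hd hdD
    obtain ⟨i, -, rfl⟩ := Finset.mem_image.mp hdD
    rcases hR.eq_or_eq_of_shared_mem hF he hf hd with rfl | rfl <;> simp at hfr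
  obtain ⟨c, hc⟩ := hF.exists_coloring D (by
    intro f hf
    by_cases hfr : f ∈ Finset.univ.image ring
    · obtain ⟨i, -, rfl⟩ := Finset.mem_image.mp hfr
      exact ⟨1, hR.card_ring_inter_shared hF he i⟩
    · rw [Finset.disjoint_iff_inter_eq_empty.mp (Finset.disjoint_left.mpr (off_ring f hf hfr))]
      simp)
  by_contra! hlt
  have side : ∀ a, ¬ 2 * ∑ i, (monoEdges c a (ring i)).card ≤ 3 * l := by
    intro a ha
    have hbounds := hR.card_colorClass_bounds hF he hc a (by omega)
    have h₁ := hF.sum_monoEdges_faces (c := c) a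
    have h₂ := hF.three_mul_card_colorClass hc hDedge a
    have hsub : Finset.univ.image ring ⊆ faces := by
      intro f hf
      obtain ⟨i, -, rfl⟩ := Finset.mem_image.mp hf
      exact (hR.2.2.1 i).1
    rw [← Finset.sum_sdiff hsub, Finset.sum_image fun i _ j _ h => hR.2.1 h] at h₁
    obtain ⟨p, q, hpq⟩ : ∃ p q : ℕ,
        ∑ f ∈ faces \ Finset.univ.image ring, (monoEdges c a f).card = 5 * p + 6 * q := by
      refine Finset.sum_induction _ (fun n => ∃ p q : ℕ, n = 5 * p + 6 * q) ?_ ⟨0, 0, rfl⟩ ?_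
      · rintro _ _ ⟨p, q, rfl⟩ ⟨p', q', rfl⟩
        exact ⟨p + p', q + q', by ring⟩
      · intro f hf
        rw [Finset.mem_sdiff] at hf
        rcases hF.card_monoEdges_of_disjoint hc a hf.1 (off_ring f hf.1 hf.2) with h | h | h
        · exact ⟨0, 0, h⟩
        · exact ⟨1, 0, h⟩
        · exact ⟨0, 1, h⟩
    have hpq' : p = 0 ∧ q = 0 ∨ p = 1 ∧ q = 0 ∨ p = 0 ∧ q = 1 := by omega
    have hl' : l = 3 ∨ l = 4 := by omega
    rcases hpq' with ⟨rfl, rfl⟩ | ⟨rfl, rfl⟩ | ⟨rfl, rfl⟩ <;> rcases hl' with h | h <;> omega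
  have htotal : ∑ i, (monoEdges c 0 (ring i)).card + ∑ i, (monoEdges c 1 (ring i)).card =
      3 * l := by
    rw [← Finset.sum_add_distrib, Finset.sum_congr rfl fun i _ => ?_, Finset.sum_const,
      Finset.card_univ, ZMod.card, smul_eq_mul, mul_comm]
    have h := card_monoEdges_add hc (X := ring i) fun d => hF.subset_edgeSet (hR.2.2.1 i).1
    rw [(hR.2.2.1 i).2, hR.card_ring_inter_shared hF he i] at h
    omega
  have h₀ := side 0
  have h₁ := side 1
  omega

end IsPentagonalRing

end Ring

end Fullerene

/-- if a fullerene graph contains a pentagonal ring, then the minimum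
length of a pentagonal ring satisfies `5 ≤ τ(F) ≤ 12`: every pentagonal ring has
length at least 5, and there is one of length at most 12. -/
theorem tau_bounds {V : Type*} [Fintype V] [DecidableEq V]
    (G : SimpleGraph V) (faces : Finset (Finset (Sym2 V)))
    (hF : IsFullerene G faces)
    (hex : ∃ (l : ℕ) (ring : ZMod l → Finset (Sym2 V)), IsPentagonalRing faces l ring) :
    (∀ (l : ℕ) (ring : ZMod l → Finset (Sym2 V)),
        IsPentagonalRing faces l ring → 5 ≤ l) ∧
    (∃ (l : ℕ) (ring : ZMod l → Finset (Sym2 V)),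
        IsPentagonalRing faces l ring ∧ l ≤ 12) := by
  obtain ⟨l, ring, hR⟩ := hex
  refine ⟨fun _ _ hR => hR.five_le_length hF, l, ring, hR, ?_⟩
  rw [← hF.pentagons]
  exact hR.length_le_card_pentagons
end
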